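/- arXiv:2304.04690 — 2 statements merged into one kernel-verified Lean document; each statement's English description precedes it below -/
import Mathlib

section
/- Let k ≥ 3 and let D be a Hajós bijoin of two digraphs D1 and D2. If D is k-extremal, then both D1 and D2 are k-extremal. -/
/-!
Common framework: finite digraphs on vertex set a `Finset ℕ`,
loopless and without parallel arcs (arcs are a `Finset (ℕ × ℕ)`).
-/

structure Dgraph where
  verts : Finset ℕ
  arcs : Finset (ℕ × ℕ)

namespace Dgraph

/-- Well-formedness: every arc joins two distinct vertices of the digraph
(no loops, arcs within the vertex set). -/
def WF (D : Dgraph) : Prop :=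
  ∀ a ∈ D.arcs, a.1 ∈ D.verts ∧ a.2 ∈ D.verts ∧ a.1 ≠ a.2

/-- `p` is a directed path from `u` to `v` in `D` (vertices pairwise distinct,
consecutive pairs are arcs). -/
def IsDipath (D : Dgraph) (p : List ℕ) (u v : ℕ) : Prop :=
  p.Nodup ∧ p.head? = some u ∧ p.getLast? = some v ∧
    (∀ x ∈ p, x ∈ D.verts) ∧ p.Chain' (fun a b => (a, b) ∈ D.arcs)

/-- The set of arcs used by a path (consecutive pairs). -/
def arcsOf (p : List ℕ) : Finset (ℕ × ℕ) := (p.zip p.tail).toFinset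

/-- Local arc-connectivity `λ(u,v)`: the maximum number of pairwise
arc-disjoint directed paths from `u` to `v`. -/
noncomputable def locLam (D : Dgraph) (u v : ℕ) : ℕ :=
  sSup {n | ∃ P : Fin n → List ℕ, (∀ i, D.IsDipath (P i) u v) ∧
    Pairwise fun i j => Disjoint (arcsOf (P i)) (arcsOf (P j))}

/-- Maximum local arc-connectivity `λ(D)`. -/
noncomputable def lam (D : Dgraph) : ℕ :=
  sSup {n | ∃ u ∈ D.verts, ∃ v ∈ D.verts, u ≠ v ∧ n = D.locLam u v}

/-- `p` is a directed cycle of `D` (cyclically consecutive pairs are arcs,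
vertices pairwise distinct). -/
def IsDicycle (D : Dgraph) (p : List ℕ) : Prop :=
  2 ≤ p.length ∧ p.Nodup ∧ (∀ x ∈ p, x ∈ D.verts) ∧
    p.Chain' (fun a b => (a, b) ∈ D.arcs) ∧
    ∀ x y, p.getLast? = some x → p.head? = some y → (x, y) ∈ D.arcs

/-- A colouring `φ` of the vertices with `k` colours is a `k`-dicolouring if
no directed cycle is monochromatic, i.e. every colour class induces an
acyclic subdigraph. -/
def IsDicolouring (D : Dgraph) (k : ℕ) (φ : ℕ → Fin k) : Prop :=
  ∀ p, D.IsDicycle p → ¬∃ c, ∀ x ∈ p, φ x = c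

/-- The dichromatic number: least `k` admitting a `k`-dicolouring. -/
noncomputable def dichi (D : Dgraph) : ℕ :=
  sInf {k | ∃ φ : ℕ → Fin k, D.IsDicolouring k φ}

/-- A monochromatic list of vertices. -/
def Mono {k : ℕ} (φ : ℕ → Fin k) (p : List ℕ) : Prop := ∃ c, ∀ x ∈ p, φ x = c

/-- `D` is strong: any vertex can reach any other by a directed path. -/
def Strong (D : Dgraph) : Prop :=
  ∀ u ∈ D.verts, ∀ v ∈ D.verts, u ≠ v → ∃ p, D.IsDipath p u v

/-- Induced subdigraph on `S`. -/
def induce (D : Dgraph) (S : Finset ℕ) : Dgraph where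
  verts := D.verts ∩ S
  arcs := D.arcs.filter fun a => a.1 ∈ S ∧ a.2 ∈ S

/-- Adjacency in the underlying undirected graph. -/
def adj (D : Dgraph) (x y : ℕ) : Prop := (x, y) ∈ D.arcs ∨ (y, x) ∈ D.arcs

/-- Reachability in the underlying undirected graph. -/
def UReach (D : Dgraph) (x y : ℕ) : Prop := Relation.ReflTransGen D.adj x y

/-- Connectivity of the underlying undirected graph. -/
def UConnected (D : Dgraph) : Prop :=
  D.verts.Nonempty ∧ ∀ u ∈ D.verts, ∀ v ∈ D.verts, D.UReach u v

/-- Deletion of a vertex. -/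
def delVert (D : Dgraph) (v : ℕ) : Dgraph := D.induce (D.verts.erase v)

/-- `v` is a cutvertex: its removal disconnects the underlying graph. -/
def IsCutvertex (D : Dgraph) (v : ℕ) : Prop :=
  v ∈ D.verts ∧ ¬(D.delVert v).UConnected

/-- Biconnected: the underlying graph is connected and has no cutvertex. -/
def Biconnected (D : Dgraph) : Prop :=
  D.UConnected ∧ ∀ v, ¬D.IsCutvertex v

/-- `D` is `k`-extremal: biconnected, strong and `χ⃗(D) = λ(D) + 1 = k + 1`. -/
def Extremal (k : ℕ) (D : Dgraph) : Prop :=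
  D.Biconnected ∧ D.Strong ∧ D.dichi = k + 1 ∧ D.lam = k

/-- The arcs of the dicut `(X, X̄)`: arcs from `X` to its complement. -/
def dicutArcs (D : Dgraph) (X : Finset ℕ) : Finset (ℕ × ℕ) :=
  D.arcs.filter fun a => a.1 ∈ X ∧ a.2 ∉ X

/-- `X` is the side of a dicut: `∅ ≠ X ⊊ V(D)`. -/
def IsDicutSide (D : Dgraph) (X : Finset ℕ) : Prop :=
  X ⊆ D.verts ∧ X.Nonempty ∧ X ≠ D.verts

/-- `(X, X̄)` is a minimum dicut of `D`. -/
def IsMinDicut (D : Dgraph) (X : Finset ℕ) : Prop :=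
  D.IsDicutSide X ∧ ∀ Y, D.IsDicutSide Y → (D.dicutArcs X).card ≤ (D.dicutArcs Y).card

def outdeg (D : Dgraph) (v : ℕ) : ℕ := (D.arcs.filter fun a => a.1 = v).card
def indeg (D : Dgraph) (v : ℕ) : ℕ := (D.arcs.filter fun a => a.2 = v).card

/-- Eulerian: every vertex has equal in- and out-degree. -/
def Eulerian (D : Dgraph) : Prop := ∀ v ∈ D.verts, D.outdeg v = D.indeg v

/-- Deleting a set of arcs. -/
def delArcs (D : Dgraph) (s : Finset (ℕ × ℕ)) : Dgraph := ⟨D.verts, D.arcs \ s⟩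

/-- Adding an arc. -/
def addArc (D : Dgraph) (u v : ℕ) : Dgraph :=
  ⟨insert u (insert v D.verts), insert (u, v) D.arcs⟩

/-- `D` is `m`-dicritical: `χ⃗(D) = m` and deleting any arc drops the
dichromatic number to at most `m - 1`. -/
def Dicritical (m : ℕ) (D : Dgraph) : Prop :=
  D.dichi = m ∧ ∀ a ∈ D.arcs, (D.delArcs {a}).dichi ≤ m - 1

/-- Renaming a vertex `x` to `y`. -/
def ren (x y z : ℕ) : ℕ := if z = x then y else z

def renArc (x y : ℕ) (a : ℕ × ℕ) : ℕ × ℕ := (ren x y a.1, ren x y a.2)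

/-- Cyclically consecutive pairs of a list: the arcs of the directed cycle
through `p` in this cyclic order. -/
def cycArcs (p : List ℕ) : Finset (ℕ × ℕ) := (p.zip (p.rotate 1)).toFinset

/-- `D` is a directed cycle. -/
def IsDirectedCycleGraph (D : Dgraph) : Prop :=
  ∃ p : List ℕ, 2 ≤ p.length ∧ p.Nodup ∧ D.verts = p.toFinset ∧ D.arcs = cycArcs p

/-- `D` is the bidirected complete digraph `↔K_n`. -/
def IsBiComplete (D : Dgraph) (n : ℕ) : Prop :=
  D.verts.card = n ∧ D.arcs = (D.verts ×ˢ D.verts).filter fun a => a.1 ≠ a.2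

/-- Arcs of a bidirected (symmetric) cycle through `p`. -/
def symmCyc (p : List ℕ) : Finset (ℕ × ℕ) := cycArcs p ∪ (cycArcs p).image Prod.swap

/-- `D` is a symmetric odd wheel: a bidirected odd cycle (≥ 3 vertices)
plus a hub joined by digons to all cycle vertices. -/
def IsSymOddWheel (D : Dgraph) : Prop :=
  ∃ (p : List ℕ) (x : ℕ), 3 ≤ p.length ∧ Odd p.length ∧ p.Nodup ∧ x ∉ p ∧
    D.verts = insert x p.toFinset ∧
    D.arcs = symmCyc p ∪ p.toFinset.image (fun y => (x, y)) ∪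
      p.toFinset.image (fun y => (y, x))

/-- A fresh vertex not in `D`. -/
def fresh (D : Dgraph) : ℕ := (D.verts.sup id) + 1

/-- Contraction `D/X`: `X` is contracted into a single new vertex; arcs
inside `X` are deleted and parallel arcs created by contraction are
identified. -/
def contract (D : Dgraph) (X : Finset ℕ) : Dgraph where
  verts := insert (fresh D) (D.verts \ X)
  arcs := (D.arcs.image fun a =>
      (if a.1 ∈ X then fresh D else a.1, if a.2 ∈ X then fresh D else a.2)).filter
      fun a => a.1 ≠ a.2

/-- `D` is the directed Hajós join of `D1` and `D2` with respect to the arcs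
`(u,v1) ∈ A(D1)` and `(v2,w) ∈ A(D2)`, the vertices `v1, v2` being
identified into the new vertex `v`, and the arc `(u,w)` being added. -/
def IsDirHajosJoinAt (D D1 D2 : Dgraph) (u v1 v2 w v : ℕ) : Prop :=
  D1.WF ∧ D2.WF ∧ Disjoint D1.verts D2.verts ∧
  (u, v1) ∈ D1.arcs ∧ (v2, w) ∈ D2.arcs ∧
  v ∉ (D1.verts.erase v1) ∪ (D2.verts.erase v2) ∧
  D.verts = insert v ((D1.verts.erase v1) ∪ (D2.verts.erase v2)) ∧
  D.arcs = insert (u, w)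
    (((D1.arcs.erase (u, v1)) ∪ (D2.arcs.erase (v2, w))).image
      fun a => renArc v2 v (renArc v1 v a))

def IsDirHajosJoin (D D1 D2 : Dgraph) : Prop :=
  ∃ u v1 v2 w v, IsDirHajosJoinAt D D1 D2 u v1 v2 w v

/-- Bidirected Hajós join with respect to the digons `[u,v1] ⊆ A(D1)` and
`[w,v2] ⊆ A(D2)`. -/
def IsBidirHajosJoinAt (D D1 D2 : Dgraph) (u v1 v2 w v : ℕ) : Prop :=
  D1.WF ∧ D2.WF ∧ Disjoint D1.verts D2.verts ∧
  (u, v1) ∈ D1.arcs ∧ (v1, u) ∈ D1.arcs ∧ (w, v2) ∈ D2.arcs ∧ (v2, w) ∈ D2.arcs ∧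
  v ∉ (D1.verts.erase v1) ∪ (D2.verts.erase v2) ∧
  D.verts = insert v ((D1.verts.erase v1) ∪ (D2.verts.erase v2)) ∧
  D.arcs = insert (u, w) (insert (w, u)
    (((D1.arcs \ {(u, v1), (v1, u)}) ∪ (D2.arcs \ {(w, v2), (v2, w)})).image
      fun a => renArc v2 v (renArc v1 v a)))

def IsBidirHajosJoin (D D1 D2 : Dgraph) : Prop :=
  ∃ u v1 v2 w v, IsBidirHajosJoinAt D D1 D2 u v1 v2 w v

/-- Hajós bijoin of `D1` and `D2` with respect to `((t,a1,w),(v,a2,u))`: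
`ta1, a1w ∈ A(D1)` with `t,w` in the same connected component of `D1 ∖ a1`,
`va2, a2u ∈ A(D2)` with `u,v` in the same connected component of `D2 ∖ a2`;
`a1` and `a2` are identified into the new vertex `a` and the arcs
`tu` and `vw` are added. -/
def IsHajosBijoinAt (D D1 D2 : Dgraph) (t a1 w v a2 u a : ℕ) : Prop :=
  D1.WF ∧ D2.WF ∧ Disjoint D1.verts D2.verts ∧
  (t, a1) ∈ D1.arcs ∧ (a1, w) ∈ D1.arcs ∧
  (v, a2) ∈ D2.arcs ∧ (a2, u) ∈ D2.arcs ∧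
  (D1.delVert a1).UReach t w ∧
  (D2.delVert a2).UReach u v ∧
  a ∉ (D1.verts.erase a1) ∪ (D2.verts.erase a2) ∧
  D.verts = insert a ((D1.verts.erase a1) ∪ (D2.verts.erase a2)) ∧
  D.arcs = insert (t, u) (insert (v, w)
    (((D1.arcs \ {(t, a1), (a1, w)}) ∪ (D2.arcs \ {(v, a2), (a2, u)})).image
      fun x => renArc a2 a (renArc a1 a x)))

def IsHajosBijoin (D D1 D2 : Dgraph) : Prop :=
  ∃ t a1 w v a2 u a, IsHajosBijoinAt D D1 D2 t a1 w v a2 u a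

/-! ### Trees, Euler tours and Hajós tree joins -/

/-- Vertex set of the tree given by edges `e : Fin n → ℕ × ℕ`. -/
def treeVerts (n : ℕ) (e : Fin n → ℕ × ℕ) : Finset ℕ :=
  Finset.univ.image (fun i => (e i).1) ∪ Finset.univ.image (fun i => (e i).2)

/-- The bidirected digraph `↔T` of the tree. -/
def treeDigraph (n : ℕ) (e : Fin n → ℕ × ℕ) : Dgraph where
  verts := treeVerts n e
  arcs := Finset.univ.image (fun i : Fin n => e i) ∪
    Finset.univ.image (fun i : Fin n => (e i).swap)

/-- `e` lists the edges of a tree: loopless, pairwise distinct edges,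
connected, with `n + 1` vertices for `n` edges. -/
def IsTree (n : ℕ) (e : Fin n → ℕ × ℕ) : Prop :=
  (∀ i, (e i).1 ≠ (e i).2) ∧
  (∀ i j, i ≠ j → e i ≠ e j ∧ e i ≠ (e j).swap) ∧
  (treeDigraph n e).UConnected ∧
  (treeVerts n e).card = n + 1

/-- The leaves of the tree: vertices incident to exactly one edge. -/
def leafSet (n : ℕ) (e : Fin n → ℕ × ℕ) : Finset ℕ :=
  (treeVerts n e).filter fun x =>
    (Finset.univ.filter fun i : Fin n => (e i).1 = x ∨ (e i).2 = x).card = 1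

/-- `L` is an Eulerian list of the tree: the cyclic sequence of consecutive
pairs of `L` traverses each arc of `↔T` exactly once. -/
def IsEulerTour (n : ℕ) (e : Fin n → ℕ × ℕ) (L : List ℕ) : Prop :=
  ((L.zip (L.rotate 1) : List (ℕ × ℕ)) : Multiset (ℕ × ℕ)) = (treeDigraph n e).arcs.val

/-- `C` is a partial Eulerian list: a circular sublist of an Eulerian list
containing every leaf, in which every non-leaf vertex appears at most once. -/
def IsPartialEulerList (n : ℕ) (e : Fin n → ℕ × ℕ) (C : List ℕ) : Prop :=
  ∃ L m, IsEulerTour n e L ∧ List.Sublist C (L.rotate m) ∧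
    (∀ x ∈ leafSet n e, x ∈ C) ∧
    ∀ x ∈ C, x ∉ leafSet n e → C.count x ≤ 1

/-- Compatibility of the data of a (extended) Hajós tree join:
a tree with edges `uᵢvᵢ = e i`, digraphs `Ds i` with
`V(Ds i) ∩ V(T) = {uᵢ, vᵢ}`, `[uᵢ,vᵢ] ⊆ A(Ds i)` and whose remaining
vertex sets are pairwise disjoint. -/
def JoinCompat (n : ℕ) (e : Fin n → ℕ × ℕ) (Ds : Fin n → Dgraph) : Prop :=
  IsTree n e ∧ (∀ i, (Ds i).WF) ∧
  (∀ i, (Ds i).verts ∩ treeVerts n e = {(e i).1, (e i).2}) ∧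
  (∀ i, e i ∈ (Ds i).arcs ∧ (e i).swap ∈ (Ds i).arcs) ∧
  (∀ i j, i ≠ j →
    Disjoint ((Ds i).verts \ {(e i).1, (e i).2}) ((Ds j).verts \ {(e j).1, (e j).2}))

/-- The digraph obtained from the digraphs `Ds i − [uᵢ,vᵢ]` by adding the
directed cycle through the list `C`. -/
def joinOf (n : ℕ) (e : Fin n → ℕ × ℕ) (Ds : Fin n → Dgraph) (C : List ℕ) : Dgraph where
  verts := Finset.univ.biUnion fun i => (Ds i).verts
  arcs := (Finset.univ.biUnion fun i => (Ds i).arcs \ {e i, (e i).swap}) ∪ cycArcs C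

/-- `D` is the Hajós tree join `T(D₁, …, Dₙ; C)`: the peripheral cycle runs
through the leaves of `T` in the circular order given by a plane embedding
of `T` (equivalently, the order of the leaves along an Euler tour of `↔T`). -/
def IsHajosTreeJoin (D : Dgraph) (n : ℕ) (e : Fin n → ℕ × ℕ)
    (Ds : Fin n → Dgraph) : Prop :=
  JoinCompat n e Ds ∧ ∃ L, IsEulerTour n e L ∧
    D = joinOf n e Ds (L.filter fun x => decide (x ∈ leafSet n e))

/-- `D` is an extended Hajós tree join: the peripheral cycle runs through a
partial Eulerian list of `T`. -/
def IsExtHajosTreeJoin (D : Dgraph) (n : ℕ) (e : Fin n → ℕ × ℕ)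
    (Ds : Fin n → Dgraph) : Prop :=
  JoinCompat n e Ds ∧ ∃ C, IsPartialEulerList n e C ∧ D = joinOf n e Ds C

/-- Hajós star join: a Hajós tree join whose tree is a star. -/
def IsHajosStarJoin (D : Dgraph) (n : ℕ) (e : Fin n → ℕ × ℕ)
    (Ds : Fin n → Dgraph) : Prop :=
  IsHajosTreeJoin D n e Ds ∧ ∃ c, ∀ i, (e i).1 = c ∨ (e i).2 = c

/-- The class `H⃗_k`: for `k = 3` the smallest class containing the symmetric
odd wheels and closed under directed Hajós joins and Hajós tree joins; for
`k ≥ 4` the smallest class containing `↔K_{k+1}` and closed under directed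
Hajós joins and Hajós tree joins. -/
inductive HClass (k : ℕ) : Dgraph → Prop
  | wheel (D : Dgraph) (hk : k = 3) (h : IsSymOddWheel D) : HClass k D
  | complete (D : Dgraph) (hk : 4 ≤ k) (h : IsBiComplete D (k + 1)) : HClass k D
  | dirJoin (D D1 D2 : Dgraph) (h1 : HClass k D1) (h2 : HClass k D2)
      (h : IsDirHajosJoin D D1 D2) : HClass k D
  | treeJoin (D : Dgraph) (n : ℕ) (e : Fin n → ℕ × ℕ) (Ds : Fin n → Dgraph)
      (h : ∀ i, HClass k (Ds i)) (hj : IsHajosTreeJoin D n e Ds) : HClass k D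

/-- The class `EH⃗T_k`: for `k = 3` the smallest class containing the
symmetric odd wheels and closed under extended Hajós tree joins; for `k ≥ 4`
the smallest class containing `↔K_{k+1}` and closed under extended Hajós
tree joins. -/
inductive EHTClass (k : ℕ) : Dgraph → Prop
  | wheel (D : Dgraph) (hk : k = 3) (h : IsSymOddWheel D) : EHTClass k D
  | complete (D : Dgraph) (hk : 4 ≤ k) (h : IsBiComplete D (k + 1)) : EHTClass k D
  | extJoin (D : Dgraph) (n : ℕ) (e : Fin n → ℕ × ℕ) (Ds : Fin n → Dgraph)
      (h : ∀ i, EHTClass k (Ds i)) (hj : IsExtHajosTreeJoin D n e Ds) : EHTClass k D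

/-- Parallel Hajós join of `D_AC` and `D_B` with respect to
`(t, u, v, w, [a,b])`. -/
def IsParallelHajosJoinAt (D DAC DB : Dgraph) (A C : Finset ℕ)
    (x t u v w a b : ℕ) : Prop :=
  DAC.WF ∧ DB.WF ∧
  (a, b) ∈ DB.arcs ∧ (b, a) ∈ DB.arcs ∧
  DAC.verts = A ∪ C ∧ A ∩ C = {x} ∧
  t ∈ A.erase x ∧ w ∈ A.erase x ∧ u ∈ C.erase x ∧ v ∈ C.erase x ∧
  (t, u) ∈ DAC.arcs ∧ (v, w) ∈ DAC.arcs ∧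
  (DAC.delVert x).UReach t w ∧
  ((DAC.induce C).delVert x).UReach u v ∧
  Disjoint DAC.verts DB.verts ∧
  D.verts = DB.verts ∪ (A.erase x) ∪ (C.erase x) ∧
  D.arcs = insert (t, u) (insert (v, w)
    ((DB.arcs \ {(a, b), (b, a)}) ∪
      ((DAC.induce A).arcs.image (renArc x a)) ∪
      ((DAC.induce C).arcs.image (renArc x b))))

def IsParallelHajosJoin (D DAC DB : Dgraph) : Prop :=
  ∃ A C x t u v w a b, IsParallelHajosJoinAt D DAC DB A C x t u v w a b

/-- `S` is (the vertex set of) a strong component of `D`. -/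
def IsStrongComponent (D : Dgraph) (S : Finset ℕ) : Prop :=
  S ⊆ D.verts ∧ S.Nonempty ∧ (D.induce S).Strong ∧
  ∀ S', S ⊆ S' → S' ⊆ D.verts → (D.induce S').Strong → S' = S

/-- `B` is (the vertex set of) a block of `D`: a maximal set inducing a
biconnected subdigraph. -/
def IsBlock (D : Dgraph) (B : Finset ℕ) : Prop :=
  B ⊆ D.verts ∧ (D.induce B).Biconnected ∧
  ∀ B', B ⊆ B' → B' ⊆ D.verts → (D.induce B').Biconnected → B' = B

end Dgraph

open Dgraph

open Dgraph


namespace Bij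

/-- Arc relation of a set of arcs. -/
def Rel (A : Finset (ℕ × ℕ)) (x y : ℕ) : Prop := (x, y) ∈ A

/-- Arcs leaving `X`. -/
def cut (A : Finset (ℕ × ℕ)) (X : Finset ℕ) : Finset (ℕ × ℕ) :=
  A.filter fun e => e.1 ∈ X ∧ e.2 ∉ X

lemma exists_path {R : ℕ → ℕ → Prop} {x y : ℕ} (h : Relation.ReflTransGen R x y) :
    ∃ p : List ℕ, p.Nodup ∧ p.head? = some x ∧ p.getLast? = some y ∧ p.IsChain R := by
  induction h using Relation.ReflTransGen.head_induction_on with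
  | refl => exact ⟨[y], by simp⟩
  | head hab hbc ih =>
    rename_i a b
    obtain ⟨p, hn, hh, hl, hc⟩ := ih
    by_cases ha : a ∈ p
    · obtain ⟨s, t, rfl⟩ := List.append_of_mem ha
      refine ⟨a :: t, hn.of_append_right, rfl, ?_, hc.right_of_append⟩
      simpa using hl
    · cases p with
      | nil => simp at hh
      | cons c q =>
        simp at hh
        subst hh
        refine ⟨a :: c :: q, List.nodup_cons.2 ⟨ha, hn⟩, rfl, by simpa using hl, ?_⟩
        exact List.isChain_cons_cons.2 ⟨hab, hc⟩

lemma reach_of_path {R : ℕ → ℕ → Prop} {y : ℕ} (p : List ℕ) : ∀ {x : ℕ},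
    p.head? = some x → p.getLast? = some y → p.IsChain R → Relation.ReflTransGen R x y := by
  induction p with
  | nil => intro x h; simp at h
  | cons a q ih =>
    intro x hh hl hc
    simp at hh
    subst hh
    cases q with
    | nil => simp at hl; subst hl; exact .refl
    | cons b q =>
      rw [List.isChain_cons_cons] at hc
      exact .head hc.1 (ih rfl (by simpa using hl) hc.2)

lemma strong_iff {D : Dgraph} (hD : D.WF) :
    D.Strong ↔ ∀ x ∈ D.verts, ∀ y ∈ D.verts, Relation.ReflTransGen (Rel D.arcs) x y := by
  constructor
  · intro h x hx y hy
    by_cases hxy : x = y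
    · subst hxy; exact .refl
    · obtain ⟨p, -, h1, h2, -, h3⟩ := h x hx y hy hxy
      exact reach_of_path p h1 h2 h3
  · intro h x hx y hy hxy
    obtain ⟨p, hn, h1, h2, h3⟩ := exists_path (h x hx y hy)
    refine ⟨p, hn, h1, h2, ?_, h3⟩
    clear h hn h2 hxy
    induction p generalizing x with
    | nil => simp
    | cons a q ih =>
      simp at h1
      subst h1
      cases q with
      | nil => simpa using hx
      | cons b q =>
        rw [List.isChain_cons_cons] at h3
        intro z hz
        rcases List.mem_cons.1 hz with rfl | hz
        · exact hx
        · exact ih b (hD _ h3.1).2.1 rfl h3.2 z hz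

/-- Crossing arc. -/
lemma exists_cross {R : ℕ → ℕ → Prop} {x y : ℕ} (h : Relation.ReflTransGen R x y)
    (X : Finset ℕ) (hx : x ∈ X) (hy : y ∉ X) : ∃ z z', R z z' ∧ z ∈ X ∧ z' ∉ X := by
  by_contra! hc
  apply hy
  clear hy
  induction h with
  | refl => exact hx
  | tail _ h2 ih => exact hc _ _ h2 ih

lemma arcsOf_cons (a b : ℕ) (q : List ℕ) :
    arcsOf (a :: b :: q) = insert (a, b) (arcsOf (b :: q)) := by
  simp [arcsOf]

lemma path_cross {A : Finset (ℕ × ℕ)} {X : Finset ℕ} {y : ℕ} (hy : y ∉ X) (p : List ℕ) :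
    ∀ {x : ℕ}, x ∈ X → p.head? = some x → p.getLast? = some y → p.IsChain (Rel A) →
    ∃ e ∈ cut A X, e ∈ arcsOf p := by
  induction p with
  | nil => intro x _ h; simp at h
  | cons a q ih =>
    intro x hx hh hl hc
    simp at hh
    subst hh
    cases q with
    | nil => simp at hl; subst hl; exact absurd hx hy
    | cons b q =>
      rw [List.isChain_cons_cons] at hc
      rw [arcsOf_cons]
      by_cases hb : b ∈ X
      · obtain ⟨e, h1, h2⟩ := ih hb rfl (by simpa using hl) hc.2
        exact ⟨e, h1, Finset.mem_insert_of_mem h2⟩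
      · exact ⟨(a, b), by simpa [cut] using ⟨hc.1, hx, hb⟩, Finset.mem_insert_self _ _⟩

/-- Easy direction of Menger. -/
lemma menger_easy {D : Dgraph} {x y : ℕ} {X : Finset ℕ} (hx : x ∈ X) (hy : y ∉ X) {n : ℕ}
    (P : Fin n → List ℕ) (hP : ∀ i, D.IsDipath (P i) x y)
    (hd : Pairwise fun i j => Disjoint (arcsOf (P i)) (arcsOf (P j))) :
    n ≤ (cut D.arcs X).card := by
  have h : ∀ i, ∃ e ∈ cut D.arcs X, e ∈ arcsOf (P i) := fun i =>
    path_cross hy (P i) hx (hP i).2.1 (hP i).2.2.1 (hP i).2.2.2.2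
  choose g hg1 hg2 using h
  have hinj : Function.Injective g := by
    intro i j hij
    by_contra hne
    exact Finset.disjoint_left.1 (hd hne) (hg2 i) (hij ▸ hg2 j)
  calc n = (Finset.univ.image g).card := by
        rw [Finset.card_image_of_injective _ hinj]; simp
    _ ≤ _ := Finset.card_le_card (by
        intro e he
        obtain ⟨i, -, rfl⟩ := Finset.mem_image.1 he
        exact hg1 i)

lemma locLam_le {D : Dgraph} {x y : ℕ} {X : Finset ℕ} (hx : x ∈ X) (hy : y ∉ X) :
    D.locLam x y ≤ (cut D.arcs X).card :=
  csSup_le' (by rintro n ⟨P, hP, hd⟩; exact menger_easy hx hy P hP hd)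

lemma le_locLam {D : Dgraph} {x y : ℕ} (hxy : x ≠ y) {n : ℕ}
    (P : Fin n → List ℕ) (hP : ∀ i, D.IsDipath (P i) x y)
    (hd : Pairwise fun i j => Disjoint (arcsOf (P i)) (arcsOf (P j))) :
    n ≤ D.locLam x y := by
  refine le_csSup ⟨(cut D.arcs {x}).card, ?_⟩ ⟨P, hP, hd⟩
  rintro m ⟨Q, hQ, hdQ⟩
  exact menger_easy (by simp) (by simpa using hxy.symm) Q hQ hdQ

lemma locLam_le_lam {D : Dgraph} {x y : ℕ} (hx : x ∈ D.verts) (hy : y ∈ D.verts) (hxy : x ≠ y) :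
    D.locLam x y ≤ D.lam := by
  refine le_csSup ?_ ⟨x, hx, y, hy, hxy, rfl⟩
  apply Set.Finite.bddAbove
  apply (((D.verts ×ˢ D.verts).image fun p => D.locLam p.1 p.2).finite_toSet).subset
  rintro n ⟨u, hu, v, hv, -, rfl⟩
  simp only [Finset.coe_image, Set.mem_image]
  exact ⟨(u, v), by simp [hu, hv], rfl⟩

/-! ### Flows -/

/-- Divergence of an arc set at a vertex. -/
def dv (F : Finset (ℕ × ℕ)) (z : ℕ) : ℤ :=
  ∑ e ∈ F, ((if e.1 = z then 1 else 0) - (if e.2 = z then 1 else 0))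

def ind (x z : ℕ) : ℤ := if x = z then 1 else 0

lemma dv_insert {F : Finset (ℕ × ℕ)} {x y : ℕ} (h : (x, y) ∉ F) (z : ℕ) :
    dv (insert (x, y) F) z = dv F z + ind x z - ind y z := by
  unfold dv ind
  rw [Finset.sum_insert h]
  simp only
  ring

lemma dv_erase {F : Finset (ℕ × ℕ)} {x y : ℕ} (h : (x, y) ∈ F) (z : ℕ) :
    dv (F.erase (x, y)) z = dv F z - ind x z + ind y z := by
  have := dv_insert (F := F.erase (x, y)) (Finset.notMem_erase (x, y) F) z
  rw [Finset.insert_erase h] at this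
  linarith

lemma sum_dv (F : Finset (ℕ × ℕ)) (X : Finset ℕ) :
    ∑ z ∈ X, dv F z =
      ∑ e ∈ F, (((if e.1 ∈ X then 1 else 0) : ℤ) - (if e.2 ∈ X then 1 else 0)) := by
  unfold dv
  rw [Finset.sum_comm]
  apply Finset.sum_congr rfl
  intro e _
  rw [Finset.sum_sub_distrib]
  simp

/-- Residual relation. -/
def Res (A F : Finset (ℕ × ℕ)) (x y : ℕ) : Prop := ((x, y) ∈ A ∧ (x, y) ∉ F) ∨ (y, x) ∈ F

lemma augment {A F : Finset (ℕ × ℕ)} (hF : F ⊆ A) {y : ℕ} (p : List ℕ) :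
    ∀ {x : ℕ}, p.Nodup → p.head? = some x → p.getLast? = some y → p.IsChain (Res A F) →
    ∃ F' ⊆ A, (∀ z, dv F' z = dv F z + ind x z - ind y z) ∧
      ∀ e : ℕ × ℕ, (e.1 ∉ p ∨ e.2 ∉ p) → (e ∈ F' ↔ e ∈ F) := by
  induction p with
  | nil => intro x _ h; simp at h
  | cons a q ih =>
    intro x hn hh hl hc
    simp at hh
    subst hh
    cases q with
    | nil =>
      simp at hl
      subst hl
      exact ⟨F, hF, fun z => by ring, fun e _ => Iff.rfl⟩
    | cons b q =>
      rw [List.isChain_cons_cons] at hc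
      obtain ⟨F', h1, h2, h3⟩ := ih hn.of_cons rfl (by simpa using hl) hc.2
      have ha : a ∉ b :: q := (List.nodup_cons.1 hn).1
      rcases hc.1 with ⟨hA, hnF⟩ | hin
      · refine ⟨insert (a, b) F', Finset.insert_subset hA h1, ?_, ?_⟩
        · intro z
          rw [dv_insert (fun h => hnF ((h3 (a, b) (Or.inl ha)).1 h)), h2]
          ring
        · intro e he
          have hne : e ≠ (a, b) := by rintro rfl; simp at he
          rw [Finset.mem_insert, or_iff_right hne]
          exact h3 e (he.imp (fun h h' => h (List.mem_cons_of_mem _ h'))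
            (fun h h' => h (List.mem_cons_of_mem _ h')))
      · refine ⟨F'.erase (b, a), (Finset.erase_subset _ _).trans h1, ?_, ?_⟩
        · intro z
          rw [dv_erase ((h3 (b, a) (Or.inr ha)).2 hin), h2]
          ring
        · intro e he
          have hne : e ≠ (b, a) := by rintro rfl; simp at he
          rw [Finset.mem_erase, and_iff_right hne]
          exact h3 e (he.imp (fun h h' => h (List.mem_cons_of_mem _ h'))
            (fun h h' => h (List.mem_cons_of_mem _ h')))

lemma reach_mem {V : Finset ℕ} {R : ℕ → ℕ → Prop} (hV : ∀ z z', R z z' → z' ∈ V) {x y : ℕ}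
    (hx : x ∈ V) (h : Relation.ReflTransGen R x y) : y ∈ V := by
  induction h with
  | refl => exact hx
  | tail _ h _ => exact hV _ _ h

open Classical in
/-- Max-flow: cuts all large give a flow. -/
lemma exists_flow {V : Finset ℕ} {A : Finset (ℕ × ℕ)} (hA : ∀ e ∈ A, e.1 ∈ V ∧ e.2 ∈ V)
    {x y : ℕ} (hx : x ∈ V) (n : ℕ)
    (hcut : ∀ X : Finset ℕ, x ∈ X → y ∉ X → n ≤ (cut A X).card) :
    ∀ m ≤ n, ∃ F ⊆ A, ∀ z, dv F z = m * (ind x z - ind y z) := by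
  intro m
  induction m with
  | zero => intro _; exact ⟨∅, by simp, by simp [dv]⟩
  | succ m ih =>
    intro hm
    obtain ⟨F, hF, hd⟩ := ih (by omega)
    have hreach : Relation.ReflTransGen (Res A F) x y := by
      by_contra hnr
      set X := V.filter fun z => Relation.ReflTransGen (Res A F) x z with hX
      have hVR : ∀ z z', Res A F z z' → z' ∈ V := by
        rintro z z' (⟨h, -⟩ | h)
        · exact (hA _ h).2
        · exact (hA _ (hF h)).1
      have hXm : ∀ z, z ∈ X ↔ Relation.ReflTransGen (Res A F) x z := by
        intro z
        rw [hX, Finset.mem_filter]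
        exact ⟨fun h => h.2, fun h => ⟨reach_mem hVR hx h, h⟩⟩
      have hxX : x ∈ X := (hXm x).2 .refl
      have hyX : y ∉ X := fun h => hnr ((hXm y).1 h)
      have h1 := sum_dv F X
      have h2 : ∑ z ∈ X, dv F z = m := by
        simp only [hd, ← Finset.mul_sum, Finset.sum_sub_distrib, ind]
        simp [hxX, hyX]
      have h3 : ((cut A X).card : ℤ) ≤
          ∑ e ∈ F, (((if e.1 ∈ X then 1 else 0) : ℤ) - (if e.2 ∈ X then 1 else 0)) := by
        have hsub : cut A X ⊆ F := by
          intro e he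
          simp only [cut, Finset.mem_filter] at he
          by_contra hne
          exact he.2.2 ((hXm _).2 (.tail ((hXm _).1 he.2.1) (Or.inl ⟨he.1, hne⟩)))
        rw [← Finset.sum_sdiff hsub]
        have ha : ∑ e ∈ cut A X, (((if e.1 ∈ X then 1 else 0) : ℤ) - (if e.2 ∈ X then 1 else 0))
            = (cut A X).card := by
          rw [Finset.card_eq_sum_ones]
          push_cast
          apply Finset.sum_congr rfl
          intro e he
          simp only [cut, Finset.mem_filter] at he
          simp [he.2.1, he.2.2]
        have hb : 0 ≤ ∑ e ∈ F \ cut A X,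
            (((if e.1 ∈ X then 1 else 0) : ℤ) - (if e.2 ∈ X then 1 else 0)) := by
          apply Finset.sum_nonneg
          intro e he
          have heF := (Finset.mem_sdiff.1 he).1
          by_cases h2 : e.2 ∈ X
          · have : e.1 ∈ X := (hXm _).2 (.tail ((hXm _).1 h2) (Or.inr heF))
            simp [h2, this]
          · simp only [h2, if_false]
            split_ifs <;> simp
        linarith
      have h4 := hcut X hxX hyX
      have : (m : ℤ) ≥ n := by
        have : (n : ℤ) ≤ (cut A X).card := by exact_mod_cast h4
        linarith
      omega
    obtain ⟨p, hn, hh, hl, hc⟩ := exists_path hreach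
    obtain ⟨F', h1, h2, -⟩ := augment hF p hn hh hl hc
    refine ⟨F', h1, fun z => ?_⟩
    rw [h2, hd]
    push_cast
    ring

lemma arcsOf_sub {F : Finset (ℕ × ℕ)} (p : List ℕ) (hc : p.IsChain (Rel F)) : arcsOf p ⊆ F := by
  induction p with
  | nil => simp [arcsOf]
  | cons a q ih =>
    cases q with
    | nil => simp [arcsOf]
    | cons b q =>
      rw [List.isChain_cons_cons] at hc
      rw [arcsOf_cons]
      exact Finset.insert_subset hc.1 (ih hc.2)

lemma arcsOf_mem (p : List ℕ) (e : ℕ × ℕ) (he : e ∈ arcsOf p) : e.1 ∈ p := by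
  simp only [arcsOf, List.mem_toFinset] at he
  exact (List.of_mem_zip (a := e.1) (b := e.2) he).1

lemma dv_arcsOf {y : ℕ} (p : List ℕ) : ∀ {x : ℕ}, p.Nodup → p.head? = some x →
    p.getLast? = some y → ∀ z, dv (arcsOf p) z = ind x z - ind y z := by
  induction p with
  | nil => intro x _ h; simp at h
  | cons a q ih =>
    intro x hn hh hl z
    simp at hh
    subst hh
    cases q with
    | nil => simp at hl; subst hl; simp [arcsOf, dv]
    | cons b q =>
      rw [arcsOf_cons, dv_insert, ih hn.of_cons rfl (by simpa using hl)]
      · ring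
      · intro h
        exact (List.nodup_cons.1 hn).1 (arcsOf_mem _ _ h)

lemma dv_sdiff {F G : Finset (ℕ × ℕ)} (h : G ⊆ F) (z : ℕ) : dv (F \ G) z = dv F z - dv G z := by
  unfold dv
  rw [← Finset.sum_sdiff h]
  ring

open Classical in
lemma flow_paths {V : Finset ℕ} {x y : ℕ} (hx : x ∈ V) (hxy : x ≠ y) (n : ℕ) :
    ∀ F : Finset (ℕ × ℕ), (∀ e ∈ F, e.1 ∈ V ∧ e.2 ∈ V) →
    (∀ z, dv F z = n * (ind x z - ind y z)) →
    ∃ P : Fin n → List ℕ, (∀ i, (P i).Nodup ∧ (P i).head? = some x ∧ (P i).getLast? = some y ∧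
      (P i).IsChain (Rel F)) ∧
      Pairwise fun i j => Disjoint (arcsOf (P i)) (arcsOf (P j)) := by
  induction n with
  | zero => intro F _ _; exact ⟨fun i => i.elim0, fun i => i.elim0, fun i => i.elim0⟩
  | succ n ih =>
    intro F hF hd
    have hreach : Relation.ReflTransGen (Rel F) x y := by
      by_contra hnr
      set X := V.filter fun z => Relation.ReflTransGen (Rel F) x z with hX
      have hXm : ∀ z, z ∈ X ↔ Relation.ReflTransGen (Rel F) x z := by
        intro z
        rw [hX, Finset.mem_filter]
        exact ⟨fun h => h.2, fun h => ⟨reach_mem (fun _ _ h => (hF _ h).2) hx h, h⟩⟩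
      have hxX : x ∈ X := (hXm x).2 .refl
      have hyX : y ∉ X := fun h => hnr ((hXm y).1 h)
      have h1 := sum_dv F X
      have h2 : ∑ z ∈ X, dv F z = ((n + 1 : ℕ) : ℤ) := by
        simp only [hd, ← Finset.mul_sum, Finset.sum_sub_distrib, ind]
        simp [hxX, hyX]
      have h3 : ∑ e ∈ F, (((if e.1 ∈ X then 1 else 0) : ℤ) - (if e.2 ∈ X then 1 else 0)) ≤ 0 := by
        apply Finset.sum_nonpos
        intro e he
        by_cases h1 : e.1 ∈ X
        · have : e.2 ∈ X := (hXm _).2 (.tail ((hXm _).1 h1) he)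
          simp [h1, this]
        · simp only [h1, if_false]
          split_ifs <;> simp
      push_cast at h2
      omega
    obtain ⟨p, hn, hh, hl, hc⟩ := exists_path hreach
    have hsub := arcsOf_sub p hc
    obtain ⟨P, hP, hdis⟩ := ih (F \ arcsOf p) (fun e he => hF e (Finset.mem_sdiff.1 he).1) (by
      intro z
      rw [dv_sdiff hsub, hd, dv_arcsOf p hn hh hl]
      push_cast
      ring)
    have hpd : ∀ i, Disjoint (arcsOf p) (arcsOf (P i)) := fun i =>
      Finset.disjoint_of_subset_right (arcsOf_sub _ (hP i).2.2.2) Finset.disjoint_sdiff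
    refine ⟨Fin.cons p P, ?_, ?_⟩
    · intro i
      refine Fin.cases ?_ (fun i => ?_) i
      · exact ⟨hn, hh, hl, hc⟩
      · obtain ⟨a, b, c, d⟩ := hP i
        exact ⟨a, b, c, d.imp fun _ _ h => (Finset.mem_sdiff.1 h).1⟩
    · intro i j
      refine Fin.cases ?_ (fun i => ?_) i <;> refine Fin.cases ?_ (fun j => ?_) j
      · intro h; exact absurd rfl h
      · intro _; exact hpd j
      · intro _; exact (hpd i).symm
      · intro h; exact hdis (fun h' => h (congrArg Fin.succ h'))

lemma path_verts {D : Dgraph} (hD : D.WF) (p : List ℕ) {x : ℕ} (hx : x ∈ D.verts)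
    (h1 : p.head? = some x) (h3 : p.IsChain (Rel D.arcs)) : ∀ z ∈ p, z ∈ D.verts := by
  induction p generalizing x with
  | nil => simp
  | cons a q ih =>
    simp at h1
    subst h1
    cases q with
    | nil => simpa using hx
    | cons b q =>
      rw [List.isChain_cons_cons] at h3
      intro z hz
      rcases List.mem_cons.1 hz with rfl | hz
      · exact hx
      · exact ih (hD _ h3.1).2.1 rfl h3.2 z hz

/-- Menger: small local arc-connectivity gives a small cut. -/
lemma exists_cut {D : Dgraph} (hD : D.WF) {x y : ℕ} (hx : x ∈ D.verts) (hxy : x ≠ y) :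
    ∃ X : Finset ℕ, x ∈ X ∧ y ∉ X ∧ (cut D.arcs X).card ≤ D.locLam x y := by
  by_contra! hc
  obtain ⟨F, hF, hd⟩ := exists_flow (V := D.verts) (A := D.arcs) (x := x) (y := y)
    (fun e he => ⟨(hD e he).1, (hD e he).2.1⟩) hx (D.locLam x y + 1) (fun X h1 h2 => hc X h1 h2)
    _ le_rfl
  obtain ⟨P, hP, hdis⟩ := flow_paths (V := D.verts) hx hxy _ F
    (fun e he => ⟨(hD e (hF he)).1, (hD e (hF he)).2.1⟩) hd
  have := le_locLam (D := D) hxy P (fun i => by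
    obtain ⟨a, b, c, d⟩ := hP i
    have d' : (P i).IsChain (Rel D.arcs) := d.imp fun _ _ h => hF h
    exact ⟨a, b, c, path_verts hD _ hx b d', d'⟩) hdis
  omega

/-! ### Colourings -/

/-- The arc set `A` has a dicolouring with `k` colours (with an explicit potential). -/
def Col (A : Finset (ℕ × ℕ)) (k : ℕ) : Prop :=
  ∃ (φ : ℕ → Fin k) (f : ℕ → ℕ), ∀ e ∈ A, φ e.1 = φ e.2 → f e.1 < f e.2

lemma chain_lt {R : ℕ → ℕ → Prop} {f : ℕ → ℕ} (hR : ∀ a b, R a b → f a < f b) {x y : ℕ}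
    (h : Relation.ReflTransGen R x y) : f x ≤ f y := by
  induction h with
  | refl => exact le_rfl
  | tail _ h ih => exact ih.trans (hR _ _ h).le

lemma mono_chain {A : Finset (ℕ × ℕ)} {k : ℕ} {φ : ℕ → Fin k} {c : Fin k} (p : List ℕ)
    (hm : ∀ x ∈ p, φ x = c) (hc : p.IsChain (Rel A)) :
    p.IsChain (fun a b => (a, b) ∈ A ∧ φ a = φ b) := by
  induction p with
  | nil => simp
  | cons a q ih =>
    cases q with
    | nil => simp
    | cons b q =>
      rw [List.isChain_cons_cons] at hc ⊢
      refine ⟨⟨hc.1, ?_⟩, ih (fun x hx => hm x (List.mem_cons_of_mem _ hx)) hc.2⟩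
      rw [hm a (by simp), hm b (by simp)]

open Classical in
lemma dicol_iff {D : Dgraph} (hD : D.WF) {k : ℕ} (φ : ℕ → Fin k) :
    D.IsDicolouring k φ ↔ ∃ f : ℕ → ℕ, ∀ e ∈ D.arcs, φ e.1 = φ e.2 → f e.1 < f e.2 := by
  constructor
  · intro h
    set R : ℕ → ℕ → Prop := fun a b => (a, b) ∈ D.arcs ∧ φ a = φ b with hR
    have hac : ∀ x y, R x y → ¬ Relation.ReflTransGen R y x := by
      intro x y hxy hyx
      obtain ⟨p, hn, hh, hl, hc⟩ := exists_path hyx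
      have hc' : p.IsChain (Rel D.arcs) := hc.imp fun _ _ h => h.1
      have hw := hD _ hxy.1
      refine h p ⟨?_, hn, path_verts hD p hw.2.1 hh hc', hc', ?_⟩ ⟨φ y, ?_⟩
      · rcases p with _ | ⟨a, _ | ⟨b, q⟩⟩
        · simp at hh
        · simp at hh hl
          exact absurd (hl.symm.trans hh) hw.2.2
        · simp
      · intro a b ha hb
        rw [hl] at ha
        rw [hh] at hb
        simp at ha hb
        subst ha hb
        exact hxy.1
      · clear hn hl hc' hyx hxy hw
        induction p generalizing y with
        | nil => simp
        | cons a q ih =>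
          simp at hh
          subst hh
          cases q with
          | nil => simp
          | cons b q =>
            rw [List.isChain_cons_cons] at hc
            intro z hz
            rcases List.mem_cons.1 hz with rfl | hz
            · rfl
            · rw [ih b rfl hc.2 z hz, hc.1.2]
    refine ⟨fun x => (D.verts.filter fun z => Relation.TransGen R z x).card, ?_⟩
    intro e he hφ
    have hRe : R e.1 e.2 := ⟨he, hφ⟩
    apply Finset.card_lt_card
    rw [Finset.ssubset_iff_of_subset]
    · refine ⟨e.1, ?_, ?_⟩
      · simp only [Finset.mem_filter]
        exact ⟨(hD e he).1, .single hRe⟩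
      · simp only [Finset.mem_filter, not_and]
        intro _ h
        obtain ⟨y, h1, h2⟩ := Relation.TransGen.head'_iff.1 h
        exact hac _ _ h1 h2
    · intro z hz
      simp only [Finset.mem_filter] at hz ⊢
      exact ⟨hz.1, hz.2.tail hRe⟩
  · rintro ⟨f, hf⟩ p ⟨h2, hn, hv, hc, hcl⟩ ⟨c, hm⟩
    have hp : p ≠ [] := by rintro rfl; simp at h2
    have hch := mono_chain p hm hc
    have h1 : p.head? = some (p.head hp) := List.head?_eq_some_head hp
    have h3 : p.getLast? = some (p.getLast hp) := List.getLast?_eq_some_getLast hp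
    have hle := chain_lt (f := f) (fun a b h => hf (a, b) h.1 h.2) (reach_of_path p h1 h3 hch)
    have hlt := hf (p.getLast hp, p.head hp) (hcl _ _ h3 h1)
      ((hm _ (List.getLast_mem hp)).trans (hm _ (List.head_mem hp)).symm)
    simp only at hlt
    omega

lemma Col.mono {A : Finset (ℕ × ℕ)} {k m : ℕ} (h : Col A k) (hkm : k ≤ m) : Col A m := by
  obtain ⟨φ, f, hf⟩ := h
  exact ⟨fun x => Fin.castLE hkm (φ x), f, fun e he h => hf e he (Fin.castLE_injective hkm h)⟩

lemma Col.subset {A B : Finset (ℕ × ℕ)} {k : ℕ} (h : Col A k) (hB : B ⊆ A) : Col B k := by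
  obtain ⟨φ, f, hf⟩ := h
  exact ⟨φ, f, fun e he h => hf e (hB he) h⟩

lemma dichi_iff {D : Dgraph} (hD : D.WF) (k : ℕ) :
    D.dichi = k + 1 ↔ Col D.arcs (k + 1) ∧ ¬ Col D.arcs k := by
  have key : ∀ m, m ∈ {k | ∃ φ : ℕ → Fin k, D.IsDicolouring k φ} ↔ Col D.arcs m := by
    intro m
    simp only [Set.mem_setOf_eq, Col, dicol_iff hD]
  constructor
  · intro h
    constructor
    · rw [← key, ← h]
      apply Nat.sInf_mem
      by_contra hne
      rw [Set.not_nonempty_iff_eq_empty] at hne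
      rw [dichi, hne] at h
      simp at h
    · rw [← key]
      intro hm
      have := Nat.sInf_le hm
      rw [dichi] at h
      omega
  · rintro ⟨h1, h2⟩
    apply le_antisymm
    · exact Nat.sInf_le ((key _).2 h1)
    · by_contra hlt
      push Not at hlt
      have hm := Nat.sInf_mem ⟨_, (key _).2 h1⟩
      rw [key] at hm
      exact h2 (hm.mono (by rw [dichi] at hlt; omega))

/-- Combining two colourings along a small cut. -/
lemma combine {A : Finset (ℕ × ℕ)} {k : ℕ} {X : Finset ℕ}
    (h1 : Col (A.filter fun e => e.1 ∈ X ∧ e.2 ∈ X) k)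
    (h2 : Col (A.filter fun e => e.1 ∉ X ∧ e.2 ∉ X) k)
    (hc : (cut A X).card < k) : Col A k := by
  obtain ⟨φ, f, hf⟩ := h1
  obtain ⟨ψ, g, hg⟩ := h2
  have : NeZero k := ⟨by omega⟩
  obtain ⟨s, hs⟩ : ∃ s : Fin k, s ∉ (cut A X).image (fun e => φ e.1 - ψ e.2) := by
    by_contra! h
    have : Finset.univ ⊆ (cut A X).image (fun e => φ e.1 - ψ e.2) := fun s _ => h s
    have h3 := Finset.card_le_card this
    rw [Finset.card_univ, Fintype.card_fin] at h3
    have := Finset.card_image_le (s := cut A X) (f := fun e => φ e.1 - ψ e.2)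
    omega
  let N := ∑ e ∈ A, (g e.1 + 1)
  refine ⟨fun x => if x ∈ X then φ x else ψ x + s, fun x => if x ∈ X then f x + N else g x, ?_⟩
  intro e he
  simp only
  by_cases ha : e.1 ∈ X <;> by_cases hb : e.2 ∈ X <;> simp only [ha, hb, if_true, if_false]
  · intro h
    have := hf e (by simp [he, ha, hb]) h
    omega
  · intro h
    exfalso
    apply hs
    rw [Finset.mem_image]
    exact ⟨e, by simp [cut, he, ha, hb], by rw [h]; simp⟩
  · intro _
    have : g e.1 + 1 ≤ N := Finset.single_le_sum (f := fun e : ℕ × ℕ => g e.1 + 1)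
      (fun _ _ => Nat.zero_le _) he
    omega
  · intro h
    exact hg e (by simp [he, ha, hb]) (add_right_cancel h)

/-- Neumann-Lara. -/
lemma neumann_lara {V : Finset ℕ} {A : Finset (ℕ × ℕ)} {k : ℕ} (hk : 0 < k)
    (hA : ∀ e ∈ A, e.1 ∈ V ∧ e.2 ∈ V ∧ e.1 ≠ e.2)
    (hcut : ∀ x ∈ V, ∀ y ∈ V, x ≠ y → ∃ X : Finset ℕ, x ∈ X ∧ y ∉ X ∧ (cut A X).card < k) :
    Col A k := by
  have main : ∀ n, ∀ S ⊆ V, S.card ≤ n → Col (A.filter fun e => e.1 ∈ S ∧ e.2 ∈ S) k := by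
    intro n
    induction n with
    | zero =>
      intro S _ hS
      have : S = ∅ := Finset.card_eq_zero.1 (by omega)
      subst this
      exact ⟨fun _ => ⟨0, hk⟩, fun _ => 0, by simp⟩
    | succ n ih =>
      intro S hSV hS
      by_cases h1 : S.card ≤ 1
      · refine ⟨fun _ => ⟨0, hk⟩, fun _ => 0, ?_⟩
        intro e he
        simp only [Finset.mem_filter] at he
        exact absurd (Finset.card_le_one.1 h1 _ he.2.1 _ he.2.2) (hA e he.1).2.2
      · obtain ⟨x, hx, y, hy, hxy⟩ := Finset.one_lt_card.1 (by omega : 1 < S.card)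
        obtain ⟨X, hxX, hyX, hX⟩ := hcut x (hSV hx) y (hSV hy) hxy
        apply combine (X := X)
        · have hlt : (S ∩ X).card < S.card := by
            apply Finset.card_lt_card
            rw [Finset.ssubset_iff_of_subset Finset.inter_subset_left]
            exact ⟨y, hy, by simp [hyX]⟩
          refine (ih (S ∩ X) (Finset.inter_subset_left.trans hSV) (by omega)).subset ?_
          intro e
          simp only [Finset.mem_filter, Finset.mem_inter]
          tauto
        · have hlt : (S \ X).card < S.card := by
            apply Finset.card_lt_card
            rw [Finset.ssubset_iff_of_subset Finset.sdiff_subset]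
            exact ⟨x, hx, by simp [hxX]⟩
          refine (ih (S \ X) (Finset.sdiff_subset.trans hSV) (by omega)).subset ?_
          intro e
          simp only [Finset.mem_filter, Finset.mem_sdiff]
          tauto
        · refine lt_of_le_of_lt (Finset.card_le_card ?_) hX
          intro e
          simp only [cut, Finset.mem_filter]
          tauto
  refine (main _ V le_rfl le_rfl).subset ?_
  intro e he
  simp only [Finset.mem_filter]
  exact ⟨he, (hA e he).1, (hA e he).2.1⟩

/-- In a minimal non-`k`-colourable arc set, cuts have size at least `k`. -/
lemma min_cut {B : Finset (ℕ × ℕ)} {k : ℕ} (hB : ¬ Col B k) (hmin : ∀ C, C ⊂ B → Col C k)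
    {X : Finset ℕ} (h1 : ∃ e ∈ B, e.1 ∉ X ∨ e.2 ∉ X) (h2 : ∃ e ∈ B, e.1 ∈ X ∨ e.2 ∈ X) :
    k ≤ (cut B X).card := by
  by_contra! hlt
  refine hB (combine (X := X) (hmin _ ?_) (hmin _ ?_) hlt)
  · rw [Finset.filter_ssubset]
    obtain ⟨e, he, h⟩ := h1
    exact ⟨e, he, by tauto⟩
  · rw [Finset.filter_ssubset]
    obtain ⟨e, he, h⟩ := h2
    exact ⟨e, he, by tauto⟩

lemma adj_delVert {D : Dgraph} {x z z' : ℕ} (h : (D.delVert x).adj z z') :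
    z ≠ x ∧ z' ≠ x ∧ D.adj z z' := by
  simp only [delVert, induce, adj, Finset.mem_filter, Finset.mem_erase] at h ⊢
  tauto

/-- Extremal digraphs are dicritical. -/
lemma extremal_critical {D : Dgraph} (hD : D.WF) {k : ℕ} (hk : 0 < k) (h : Extremal k D) :
    ∀ C, C ⊂ D.arcs → Col C k := by
  obtain ⟨⟨-, hbi⟩, hst, hchi, hlam⟩ := h
  rw [strong_iff hD] at hst
  have hnc := ((dichi_iff hD k).1 hchi).2
  intro C hC
  by_contra hCn
  -- a minimal non-colourable subset of `C`
  obtain ⟨B, hBC, hBn, hBmin⟩ : ∃ B ⊆ C, ¬ Col B k ∧ ∀ B', B' ⊂ B → Col B' k := by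
    clear hC
    induction C using Finset.strongInduction with
    | H C ih =>
      by_cases hex : ∃ B', B' ⊂ C ∧ ¬ Col B' k
      · obtain ⟨B', h1, h2⟩ := hex
        obtain ⟨B, h3, h4⟩ := ih B' h1 h2
        exact ⟨B, h3.trans h1.subset, h4⟩
      · push Not at hex
        exact ⟨C, subset_rfl, hCn, hex⟩
  have hBA : B ⊂ D.arcs := lt_of_le_of_lt hBC hC
  let W : ℕ → Prop := fun z => ∃ e ∈ B, e.1 = z ∨ e.2 = z
  have hWV : ∀ z, W z → z ∈ D.verts := by
    rintro z ⟨e, he, rfl | rfl⟩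
    · exact (hD e (hBA.subset he)).1
    · exact (hD e (hBA.subset he)).2.1
  let E := Rel (D.arcs \ B)
  -- no ears with distinct ends
  have hear : ∀ x y, W x → W y → Relation.ReflTransGen E x y → x = y := by
    intro x y hx hy hxy
    by_contra hne
    obtain ⟨X, hxX, hyX, hXc⟩ := exists_cut hD (hWV x hx) hne
    have hle := locLam_le_lam (hWV x hx) (hWV y hy) hne
    obtain ⟨z, z', hzz, hz, hz'⟩ := exists_cross hxy X hxX hyX
    have hk1 : k ≤ (cut B X).card := by
      apply min_cut hBn hBmin
      · obtain ⟨e, he, h | h⟩ := hy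
        · exact ⟨e, he, Or.inl (h ▸ hyX)⟩
        · exact ⟨e, he, Or.inr (h ▸ hyX)⟩
      · obtain ⟨e, he, h | h⟩ := hx
        · exact ⟨e, he, Or.inl (h ▸ hxX)⟩
        · exact ⟨e, he, Or.inr (h ▸ hxX)⟩
    have hzz' := Finset.mem_sdiff.1 hzz
    have : (cut B X).card < (cut D.arcs X).card := by
      apply Finset.card_lt_card
      rw [Finset.ssubset_iff_of_subset (show cut B X ⊆ cut D.arcs X from
        Finset.filter_subset_filter _ hBA.subset)]
      refine ⟨(z, z'), ?_, ?_⟩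
      · simpa [cut] using ⟨hzz'.1, hz, hz'⟩
      · intro h
        exact hzz'.2 (Finset.mem_filter.1 h).1
    omega
  -- `B` is nonempty
  obtain ⟨b, hb⟩ : B.Nonempty := by
    by_contra hne
    rw [Finset.not_nonempty_iff_eq_empty] at hne
    exact hBn (hne ▸ ⟨fun _ => ⟨0, hk⟩, fun _ => 0, by simp⟩)
  have hWb1 : W b.1 := ⟨b, hb, Or.inl rfl⟩
  have hWb2 : W b.2 := ⟨b, hb, Or.inr rfl⟩
  have hS : ∀ z ∈ D.verts, ∃ x, W x ∧ Relation.ReflTransGen E x z := by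
    intro z hz
    have hr := hst b.1 (hWV _ hWb1) z hz
    clear hz
    induction hr with
    | refl => exact ⟨b.1, hWb1, .refl⟩
    | tail _ h ih =>
      rename_i p q _
      obtain ⟨x, hx, hxp⟩ := ih
      by_cases hpq : (p, q) ∈ B
      · exact ⟨q, ⟨_, hpq, Or.inr rfl⟩, .refl⟩
      · exact ⟨x, hx, hxp.tail (Finset.mem_sdiff.2 ⟨h, hpq⟩)⟩
  have hT : ∀ z ∈ D.verts, ∃ y, W y ∧ Relation.ReflTransGen E z y := by
    intro z hz
    have hr := hst z hz b.1 (hWV _ hWb1)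
    clear hz
    induction hr using Relation.ReflTransGen.head_induction_on with
    | refl => exact ⟨b.1, hWb1, .refl⟩
    | head h _ ih =>
      rename_i p q _
      obtain ⟨y, hy, hqy⟩ := ih
      by_cases hpq : (p, q) ∈ B
      · exact ⟨p, ⟨_, hpq, Or.inl rfl⟩, .refl⟩
      · exact ⟨y, hy, hqy.head (Finset.mem_sdiff.2 ⟨h, hpq⟩)⟩
  obtain ⟨e, heA, heB⟩ := Finset.exists_of_ssubset hBA
  have heD := hD e heA
  obtain ⟨x, hWx, hxe⟩ := hS e.1 heD.1
  -- `C' z` : the anchor of `z` is `x`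
  have harc : ∀ p q, (p, q) ∈ D.arcs → p ≠ x → q ≠ x →
      (Relation.ReflTransGen E x p ↔ Relation.ReflTransGen E x q) := by
    intro p q hpq hpx hqx
    by_cases hB : (p, q) ∈ B
    · constructor
      · intro h
        exact absurd (hear x p hWx ⟨_, hB, Or.inl rfl⟩ h).symm hpx
      · intro h
        exact absurd (hear x q hWx ⟨_, hB, Or.inr rfl⟩ h).symm hqx
    · have hE : E p q := Finset.mem_sdiff.2 ⟨hpq, hB⟩
      constructor
      · intro h; exact h.tail hE
      · intro h
        obtain ⟨x', hx', h1⟩ := hS p (hD _ hpq).1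
        obtain ⟨y, hy, h2⟩ := hT q (hD _ hpq).2.1
        have e1 := hear x y hWx hy (h.trans h2)
        have e2 := hear x' y hx' hy ((h1.tail hE).trans h2)
        rw [e1, ← e2]
        exact h1
  have hxe2 : Relation.ReflTransGen E x e.2 := hxe.tail (Finset.mem_sdiff.2 ⟨heA, heB⟩)
  obtain ⟨r, hrV, hrx, hr⟩ : ∃ r ∈ D.verts, r ≠ x ∧ Relation.ReflTransGen E x r := by
    by_cases h : e.1 = x
    · exact ⟨e.2, heD.2.1, fun h' => heD.2.2 (h.trans h'.symm), hxe2⟩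
    · exact ⟨e.1, heD.1, h, hxe⟩
  obtain ⟨y, hWy, hyx⟩ : ∃ y, W y ∧ y ≠ x := by
    by_cases h : b.1 = x
    · exact ⟨b.2, hWb2, fun h' => (hD b (hBA.subset hb)).2.2 (h.trans h'.symm)⟩
    · exact ⟨b.1, hWb1, h⟩
  have hcon : (D.delVert x).UConnected := by
    by_contra hc
    exact hbi x ⟨hWV x hWx, hc⟩
  have hry := hcon.2 r (by simp [delVert, induce, hrV, hrx]) y
    (by simp [delVert, induce, hWV y hWy, hyx])
  have : Relation.ReflTransGen E x y := by
    clear hrV hrx hWy hyx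
    induction hry with
    | refl => exact hr
    | tail _ h ih =>
      obtain ⟨h1, h2, h3 | h3⟩ := adj_delVert h
      · exact (harc _ _ h3 h1 h2).1 ih
      · exact (harc _ _ h3 h2 h1).2 ih
  exact hyx (hear x y hWx hWy this).symm

/-! ### The join -/

/-- Convenient reformulation of the bijoin. -/
structure J (D D1 D2 : Dgraph) (t a1 w v a2 u a : ℕ) (ρ : ℕ → ℕ) : Prop where
  wf1 : D1.WF
  wf2 : D2.WF
  ta : (t, a1) ∈ D1.arcs
  aw : (a1, w) ∈ D1.arcs
  va : (v, a2) ∈ D2.arcs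
  au : (a2, u) ∈ D2.arcs
  re : (D1.delVert a1).UReach t w
  r1 : ∀ x ∈ D1.verts, x ≠ a1 → ρ x = x
  r2 : ∀ x ∈ D2.verts, x ≠ a2 → ρ x = x
  ra1 : ρ a1 = a
  ra2 : ρ a2 = a
  dis : ∀ x ∈ D1.verts, x ∉ D2.verts
  an1 : ∀ x ∈ D1.verts, x ≠ a1 → x ≠ a
  an2 : ∀ x ∈ D2.verts, x ≠ a2 → x ≠ a
  vs : ∀ x, x ∈ D.verts ↔ x = a ∨ (x ∈ D1.verts ∧ x ≠ a1) ∨ (x ∈ D2.verts ∧ x ≠ a2)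
  as : ∀ e, e ∈ D.arcs ↔ e = (t, u) ∨ e = (v, w) ∨
    (∃ e' ∈ D1.arcs, e' ≠ (t, a1) ∧ e' ≠ (a1, w) ∧ e = (ρ e'.1, ρ e'.2)) ∨
    (∃ e' ∈ D2.arcs, e' ≠ (v, a2) ∧ e' ≠ (a2, u) ∧ e = (ρ e'.1, ρ e'.2))

lemma toJ {D D1 D2 : Dgraph} {t a1 w v a2 u a : ℕ}
    (h : IsHajosBijoinAt D D1 D2 t a1 w v a2 u a) :
    J D D1 D2 t a1 w v a2 u a (fun x => ren a2 a (ren a1 a x)) := by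
  obtain ⟨wf1, wf2, dis, ta, aw, va, au, re, -, hn, hv, ha⟩ := h
  have hdis : ∀ x ∈ D1.verts, x ∉ D2.verts := fun x h1 h2 => Finset.disjoint_left.1 dis h1 h2
  have hne : a1 ≠ a2 := fun h => hdis _ (wf1 _ ta).2.1 (h ▸ (wf2 _ va).2.1)
  have ha1 : a1 ∈ D1.verts := (wf1 _ ta).2.1
  have ha2 : a2 ∈ D2.verts := (wf2 _ va).2.1
  simp only [Finset.mem_union, Finset.mem_erase, not_or, not_and] at hn
  refine ⟨wf1, wf2, ta, aw, va, au, re, ?_, ?_, ?_, ?_, hdis, ?_, ?_, ?_, ?_⟩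
  · intro x hx hxa
    have : x ≠ a2 := by rintro rfl; exact hdis _ hx ha2
    simp [ren, hxa, this]
  · intro x hx hxa
    have : x ≠ a1 := by rintro rfl; exact hdis _ ha1 hx
    simp [ren, hxa, this]
  · simp only [ren]; grind
  · simp only [ren]; grind
  · rintro x hx hxa rfl
    exact hn.1 hxa hx
  · rintro x hx hxa rfl
    exact hn.2 hxa hx
  · intro x
    rw [hv]
    simp only [Finset.mem_insert, Finset.mem_union, Finset.mem_erase]
    tauto
  · intro e
    rw [ha]
    simp only [Finset.mem_insert, Finset.mem_image, Finset.mem_union, Finset.mem_sdiff,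
      Finset.mem_singleton, not_or, renArc]
    constructor
    · rintro (h | h | ⟨e', ⟨h1, h2, h3⟩ | ⟨h1, h2, h3⟩, h4⟩)
      · exact Or.inl h
      · exact Or.inr (Or.inl h)
      · exact Or.inr (Or.inr (Or.inl ⟨e', h1, h2, h3, h4.symm⟩))
      · exact Or.inr (Or.inr (Or.inr ⟨e', h1, h2, h3, h4.symm⟩))
    · rintro (h | h | ⟨e', h1, h2, h3, h4⟩ | ⟨e', h1, h2, h3, h4⟩)
      · exact Or.inl h
      · exact Or.inr (Or.inl h)
      · exact Or.inr (Or.inr ⟨e', Or.inl ⟨h1, h2, h3⟩, h4.symm⟩)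
      · exact Or.inr (Or.inr ⟨e', Or.inr ⟨h1, h2, h3⟩, h4.symm⟩)

lemma ureach_symm {D : Dgraph} {x y : ℕ} (h : D.UReach x y) : D.UReach y x := by
  induction h with
  | refl => exact .refl
  | tail _ h ih => exact .head h.symm ih

lemma bijoin_symm {D D1 D2 : Dgraph} {t a1 w v a2 u a : ℕ}
    (h : IsHajosBijoinAt D D1 D2 t a1 w v a2 u a) :
    IsHajosBijoinAt D D2 D1 v a2 u t a1 w a := by
  obtain ⟨wf1, wf2, dis, ta, aw, va, au, re1, re2, hn, hv, ha⟩ := h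
  refine ⟨wf2, wf1, dis.symm, va, au, ta, aw, ureach_symm re2, ureach_symm re1, ?_, ?_, ?_⟩
  · rwa [Finset.union_comm]
  · rwa [Finset.union_comm]
  · rw [ha, Finset.insert_comm, Finset.union_comm]
    congr 2
    apply Finset.image_congr
    intro x _
    simp only [renArc, ren]
    grind

lemma reach_lift {R S : ℕ → ℕ → Prop} (f : ℕ → ℕ)
    (h : ∀ p q, R p q → Relation.ReflTransGen S (f p) (f q)) {x y : ℕ}
    (hxy : Relation.ReflTransGen R x y) : Relation.ReflTransGen S (f x) (f y) := by
  induction hxy with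
  | refl => exact .refl
  | tail _ h' ih => exact ih.trans (h _ _ h')

section
variable {D D1 D2 : Dgraph} {t a1 w v a2 u a : ℕ} {ρ : ℕ → ℕ}

/-- Where `ρ` sends vertices of `D1`. -/
lemma J.rho1 (h : J D D1 D2 t a1 w v a2 u a ρ) {x : ℕ} (hx : x ∈ D1.verts) :
    (x = a1 ∧ ρ x = a) ∨ (x ≠ a1 ∧ ρ x = x ∧ x ≠ a ∧ x ∉ D2.verts) := by
  by_cases hxa : x = a1
  · subst hxa; exact Or.inl ⟨rfl, h.ra1⟩
  · exact Or.inr ⟨hxa, h.r1 x hx hxa, h.an1 x hx hxa, h.dis x hx⟩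

lemma J.rho2 (h : J D D1 D2 t a1 w v a2 u a ρ) {x : ℕ} (hx : x ∈ D2.verts) :
    (x = a2 ∧ ρ x = a) ∨ (x ≠ a2 ∧ ρ x = x ∧ x ≠ a ∧ x ∉ D1.verts) := by
  by_cases hxa : x = a2
  · subst hxa; exact Or.inl ⟨rfl, h.ra2⟩
  · exact Or.inr ⟨hxa, h.r2 x hx hxa, h.an2 x hx hxa, fun h' => h.dis x h' hx⟩

lemma J.ends (h : J D D1 D2 t a1 w v a2 u a ρ) :
    (t ∈ D1.verts ∧ t ≠ a1) ∧ (w ∈ D1.verts ∧ w ≠ a1) ∧ (v ∈ D2.verts ∧ v ≠ a2) ∧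
      (u ∈ D2.verts ∧ u ≠ a2) ∧ a1 ∈ D1.verts ∧ a2 ∈ D2.verts := by
  have h1 := h.wf1 _ h.ta
  have h2 := h.wf1 _ h.aw
  have h3 := h.wf2 _ h.va
  have h4 := h.wf2 _ h.au
  exact ⟨⟨h1.1, h1.2.2⟩, ⟨h2.2.1, h2.2.2.symm⟩, ⟨h3.1, h3.2.2⟩, ⟨h4.2.1, h4.2.2.symm⟩, h1.2.1, h3.2.1⟩

lemma J.wf (h : J D D1 D2 t a1 w v a2 u a ρ) : D.WF := by
  intro e he
  obtain ⟨ht, hw, hv, hu, -, -⟩ := h.ends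
  rw [h.vs, h.vs]
  rcases (h.as e).1 he with rfl | rfl | ⟨e', h1, -, -, rfl⟩ | ⟨e', h1, -, -, rfl⟩
  · exact ⟨Or.inr (Or.inl ht), Or.inr (Or.inr hu), fun h' => h.dis _ ht.1 (by simp at h'; rw [h']; exact hu.1)⟩
  · exact ⟨Or.inr (Or.inr hv), Or.inr (Or.inl hw), fun h' => h.dis _ hw.1 (by simp at h'; rw [← h']; exact hv.1)⟩
  · have hw := h.wf1 _ h1
    rcases h.rho1 hw.1 with h3 | h3 <;> rcases h.rho1 hw.2.1 with h4 | h4 <;> grind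
  · have hw := h.wf2 _ h1
    rcases h.rho2 hw.1 with h3 | h3 <;> rcases h.rho2 hw.2.1 with h4 | h4 <;> grind

lemma J.rho_mem (h : J D D1 D2 t a1 w v a2 u a ρ) {x : ℕ} (hx : x ∈ D1.verts) :
    ρ x ∈ D.verts := by
  rw [h.vs]
  rcases h.rho1 hx with h3 | h3 <;> grind

open Classical in
/-- Contract the `D2` side into `a1`. -/
noncomputable def prj (D1 : Dgraph) (a1 a : ℕ) (x : ℕ) : ℕ :=
  if x ∈ D1.verts ∧ x ≠ a then x else a1

lemma J.prj_rho (h : J D D1 D2 t a1 w v a2 u a ρ) {x : ℕ} (hx : x ∈ D1.verts) :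
    prj D1 a1 a (ρ x) = x := by
  unfold prj
  rcases h.rho1 hx with h3 | h3 <;> grind

lemma J.prj_two (h : J D D1 D2 t a1 w v a2 u a ρ) {x : ℕ} (hx : x ∈ D2.verts) :
    prj D1 a1 a (ρ x) = a1 := by
  unfold prj
  rcases h.rho2 hx with h3 | h3 <;> grind

/-- Image of an arc under the contraction. -/
lemma J.prj_arc (h : J D D1 D2 t a1 w v a2 u a ρ) {x y : ℕ} (hxy : (x, y) ∈ D.arcs) :
    prj D1 a1 a x = prj D1 a1 a y ∨ (prj D1 a1 a x, prj D1 a1 a y) ∈ D1.arcs := by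
  obtain ⟨ht, hw, hv, hu, -, -⟩ := h.ends
  have pt := h.prj_rho ht.1
  have pw := h.prj_rho hw.1
  have pu := h.prj_two hu.1
  have pv := h.prj_two hv.1
  rw [h.r1 _ ht.1 ht.2] at pt
  rw [h.r1 _ hw.1 hw.2] at pw
  rw [h.r2 _ hu.1 hu.2] at pu
  rw [h.r2 _ hv.1 hv.2] at pv
  rcases (h.as _).1 hxy with h0 | h0 | ⟨e', h1, -, -, h0⟩ | ⟨e', h1, -, -, h0⟩ <;>
    obtain ⟨rfl, rfl⟩ := Prod.mk.inj h0
  · right; rw [pt, pu]; exact h.ta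
  · right; rw [pv, pw]; exact h.aw
  · right; rw [h.prj_rho (h.wf1 _ h1).1, h.prj_rho (h.wf1 _ h1).2.1]; exact h1
  · left; rw [h.prj_two (h.wf2 _ h1).1, h.prj_two (h.wf2 _ h1).2.1]

lemma J.strong (h : J D D1 D2 t a1 w v a2 u a ρ) (hs : D.Strong) : D1.Strong := by
  rw [strong_iff h.wf] at hs
  rw [strong_iff h.wf1]
  intro x hx y hy
  rw [← h.prj_rho hx, ← h.prj_rho hy]
  refine reach_lift _ ?_ (hs _ (h.rho_mem hx) _ (h.rho_mem hy))
  intro p q hpq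
  rcases h.prj_arc hpq with h' | h'
  · rw [h']
  · exact .single h'

lemma mem_delVert {D : Dgraph} {x z : ℕ} : z ∈ (D.delVert x).verts ↔ z ∈ D.verts ∧ z ≠ x := by
  simp [delVert, induce]
  tauto

lemma arc_delVert {D : Dgraph} (hD : D.WF) {x z z' : ℕ} :
    (z, z') ∈ (D.delVert x).arcs ↔ (z, z') ∈ D.arcs ∧ z ≠ x ∧ z' ≠ x := by
  simp only [delVert, induce, Finset.mem_filter, Finset.mem_erase]
  constructor
  · tauto
  · rintro ⟨h1, h2, h3⟩
    exact ⟨h1, ⟨h2, (hD _ h1).1⟩, h3, (hD _ h1).2.1⟩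

lemma J.biconn (h : J D D1 D2 t a1 w v a2 u a ρ) (hb : D.Biconnected) (hs : D1.Strong) :
    D1.Biconnected := by
  obtain ⟨ht, hw, hv, hu, ha1, -⟩ := h.ends
  have hs' := (strong_iff h.wf1).1 hs
  refine ⟨⟨⟨t, ht.1⟩, fun x hx y hy => reach_lift (fun z => z) (fun _ _ h => .single (Or.inl h)) (hs' x hx y hy)⟩, ?_⟩
  rintro x ⟨hx, hxc⟩
  apply hxc
  have hcon : (D.delVert (ρ x)).UConnected := by
    by_contra hc
    exact hb.2 (ρ x) ⟨h.rho_mem hx, hc⟩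
  have hinj : ∀ r ∈ D1.verts, r ≠ x → ρ r ≠ ρ x := by
    intro r hr hrx hρ
    apply hrx
    rw [← h.prj_rho hr, hρ, h.prj_rho hx]
  by_cases hxa : x = a1
  · subst hxa
    rw [h.ra1] at hcon hinj
    refine ⟨⟨t, mem_delVert.2 ht⟩, ?_⟩
    intro r hr y hy
    rw [mem_delVert] at hr hy
    have hρ := hcon.2 r (mem_delVert.2 ⟨by simpa [h.r1 r hr.1 hr.2] using h.rho_mem hr.1, h.an1 r hr.1 hr.2⟩) y (mem_delVert.2 ⟨by simpa [h.r1 y hy.1 hy.2] using h.rho_mem hy.1, h.an1 y hy.1 hy.2⟩)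
    classical
    let π : ℕ → ℕ := fun z => if z ∈ D1.verts ∧ z ≠ x then z else t
    have π1 : ∀ z ∈ D1.verts, z ≠ x → π z = z := fun z h1 h2 => if_pos ⟨h1, h2⟩
    have π2 : ∀ z ∈ D2.verts, π z = t := fun z h1 => if_neg fun h' => h.dis z h'.1 h1
    rw [← π1 r hr.1 hr.2, ← π1 y hy.1 hy.2]
    have key : ∀ p q, (p, q) ∈ D.arcs → p ≠ a → q ≠ a → (D1.delVert x).UReach (π p) (π q) := by
      intro p q hpq hpa hqa
      rcases (h.as _).1 hpq with h0 | h0 | ⟨e', h1, -, -, h0⟩ | ⟨e', h1, -, -, h0⟩ <;>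
        obtain ⟨rfl, rfl⟩ := Prod.mk.inj h0
      · rw [π1 _ ht.1 ht.2, π2 _ hu.1]; exact .refl
      · rw [π1 _ hw.1 hw.2, π2 _ hv.1]; exact h.re
      · have hw' := h.wf1 _ h1
        have e1 := (h.rho1 hw'.1).resolve_left fun h' => hpa h'.2
        have e2 := (h.rho1 hw'.2.1).resolve_left fun h' => hqa h'.2
        rw [e1.2.1, e2.2.1, π1 _ hw'.1 e1.1, π1 _ hw'.2.1 e2.1]
        exact .single (Or.inl ((arc_delVert h.wf1).2 ⟨h1, e1.1, e2.1⟩))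
      · have hw' := h.wf2 _ h1
        have e1 := (h.rho2 hw'.1).resolve_left fun h' => hpa h'.2
        have e2 := (h.rho2 hw'.2.1).resolve_left fun h' => hqa h'.2
        rw [e1.2.1, e2.2.1, π2 _ hw'.1, π2 _ hw'.2.1]
        exact .refl
    refine reach_lift π ?_ hρ
    intro p q hpq
    obtain ⟨h1, h2, h3 | h3⟩ := adj_delVert hpq
    · exact key p q h3 h1 h2
    · exact ureach_symm (key q p h3 h2 h1)
  · have hρx := h.r1 x hx hxa
    refine ⟨⟨a1, mem_delVert.2 ⟨ha1, fun h => hxa h.symm⟩⟩, ?_⟩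
    intro r hr y hy
    rw [mem_delVert] at hr hy
    have hρ := hcon.2 (ρ r) (mem_delVert.2 ⟨h.rho_mem hr.1, hinj r hr.1 hr.2⟩)
      (ρ y) (mem_delVert.2 ⟨h.rho_mem hy.1, hinj y hy.1 hy.2⟩)
    rw [← h.prj_rho hr.1, ← h.prj_rho hy.1]
    have hne : ∀ p, p ≠ ρ x → prj D1 a1 a p ≠ x := by
      intro p hp
      unfold prj
      grind
    have key : ∀ p q, (p, q) ∈ D.arcs → p ≠ ρ x → q ≠ ρ x →
        (D1.delVert x).UReach (prj D1 a1 a p) (prj D1 a1 a q) := by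
      intro p q hpq hp hq
      rcases h.prj_arc hpq with h' | h'
      · rw [h']; exact .refl
      · exact .single (Or.inl ((arc_delVert h.wf1).2 ⟨h', hne p hp, hne q hq⟩))
    refine reach_lift _ ?_ hρ
    intro p q hpq
    obtain ⟨h1, h2, h3 | h3⟩ := adj_delVert hpq
    · exact key p q h3 h1 h2
    · exact ureach_symm (key q p h3 h2 h1)

end

section
variable {D D1 D2 : Dgraph} {t a1 w v a2 u a : ℕ} {ρ : ℕ → ℕ}

/-- Arcs of the `D2` side. -/
def R2 (D2 : Dgraph) (v a2 u : ℕ) (ρ : ℕ → ℕ) (p q : ℕ) : Prop :=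
  ∃ e' ∈ D2.arcs, e' ≠ (v, a2) ∧ e' ≠ (a2, u) ∧ p = ρ e'.1 ∧ q = ρ e'.2

lemma J.r2_arc (h : J D D1 D2 t a1 w v a2 u a ρ) {p q : ℕ} (hpq : R2 D2 v a2 u ρ p q) :
    (p, q) ∈ D.arcs := by
  obtain ⟨e', h1, h2, h3, rfl, rfl⟩ := hpq
  exact (h.as _).2 (Or.inr (Or.inr (Or.inr ⟨e', h1, h2, h3, rfl⟩)))

lemma J.r2_mem (h : J D D1 D2 t a1 w v a2 u a ρ) {p q : ℕ} (hpq : R2 D2 v a2 u ρ p q) :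
    (p = a ∨ p ∈ D2.verts) ∧ (q = a ∨ q ∈ D2.verts) := by
  obtain ⟨e', h1, h2, h3, rfl, rfl⟩ := hpq
  have hw := h.wf2 _ h1
  constructor
  · rcases h.rho2 hw.1 with h3 | h3 <;> grind
  · rcases h.rho2 hw.2.1 with h3 | h3 <;> grind

open Classical in
lemma J.reach_ua (h : J D D1 D2 t a1 w v a2 u a ρ) {k : ℕ} (hk : 2 ≤ k) (hn : ¬ Col D.arcs k)
    (hmin : ∀ C, C ⊂ D.arcs → Col C k) : Relation.ReflTransGen (R2 D2 v a2 u ρ) u a := by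
  by_contra hnr
  obtain ⟨ht, hw, hv, hu, ha1, ha2⟩ := h.ends
  set X := D.verts.filter fun z => Relation.ReflTransGen (R2 D2 v a2 u ρ) u z with hX
  have hXm : ∀ z, z ∈ X ↔ Relation.ReflTransGen (R2 D2 v a2 u ρ) u z := by
    intro z
    rw [hX, Finset.mem_filter]
    exact ⟨fun h => h.2, fun h' => ⟨reach_mem (fun _ _ h1 => (h.wf _ (h.r2_arc h1)).2.1)
      ((h.vs u).2 (Or.inr (Or.inr hu))) h', h'⟩⟩
  have hX2 : ∀ z ∈ X, z ≠ a ∧ z ∈ D2.verts := by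
    intro z hz
    rw [hXm] at hz
    have hza : z ≠ a := by rintro rfl; exact hnr hz
    refine ⟨hza, ?_⟩
    rcases Relation.ReflTransGen.cases_tail hz with h1 | ⟨y, -, h1⟩
    · rw [h1]; exact hu.1
    · exact (h.r2_mem h1).2.resolve_left hza
  have huX : u ∈ X := (hXm u).2 .refl
  have hua : (t, u) ∈ D.arcs := (h.as _).2 (Or.inl rfl)
  have hk1 := min_cut hn hmin (X := X) ⟨_, hua, Or.inl fun h' => h.dis t ht.1 (hX2 t h').2⟩
    ⟨_, hua, Or.inr huX⟩
  have hsub : cut D.arcs X ⊆ {(v, w)} := by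
    intro e he
    simp only [cut, Finset.mem_filter] at he
    obtain ⟨heA, he1, he2⟩ := he
    rw [Finset.mem_singleton]
    rcases (h.as e).1 heA with rfl | rfl | ⟨e', h1, -, -, rfl⟩ | ⟨e', h1, h2, h3, rfl⟩
    · exact absurd huX he2
    · rfl
    · exfalso
      have := hX2 _ he1
      rcases h.rho1 (h.wf1 _ h1).1 with h3 | h3 <;> grind
    · exact absurd ((hXm _).2 (((hXm _).1 he1).tail ⟨e', h1, h2, h3, rfl, rfl⟩)) he2
  have := Finset.card_le_card hsub
  simp at this
  omega

open Classical in
lemma J.reach_av (h : J D D1 D2 t a1 w v a2 u a ρ) {k : ℕ} (hk : 2 ≤ k) (hn : ¬ Col D.arcs k)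
    (hmin : ∀ C, C ⊂ D.arcs → Col C k) : Relation.ReflTransGen (R2 D2 v a2 u ρ) a v := by
  by_contra hnr
  obtain ⟨ht, hw, hv, hu, ha1, ha2⟩ := h.ends
  set X := D.verts.filter fun z => ¬ Relation.ReflTransGen (R2 D2 v a2 u ρ) z v with hX
  have hX2 : ∀ z, Relation.ReflTransGen (R2 D2 v a2 u ρ) z v → z ≠ a ∧ z ∈ D2.verts := by
    intro z hz
    have hza : z ≠ a := by rintro rfl; exact hnr hz
    refine ⟨hza, ?_⟩
    rcases Relation.ReflTransGen.cases_head hz with h1 | ⟨y, h1, -⟩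
    · rw [h1]; exact hv.1
    · exact (h.r2_mem h1).1.resolve_left hza
  have hXm : ∀ z ∈ D.verts, z ∉ X → Relation.ReflTransGen (R2 D2 v a2 u ρ) z v := by
    intro z hz hzX
    by_contra h'
    exact hzX (Finset.mem_filter.2 ⟨hz, h'⟩)
  have hvX : v ∉ X := fun h' => (Finset.mem_filter.1 h').2 .refl
  have hvw : (v, w) ∈ D.arcs := (h.as _).2 (Or.inr (Or.inl rfl))
  have hwX : w ∈ X := Finset.mem_filter.2 ⟨(h.wf _ hvw).2.1, fun h' => h.dis w hw.1 (hX2 w h').2⟩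
  have hk1 := min_cut hn hmin (X := X) ⟨_, hvw, Or.inl hvX⟩ ⟨_, hvw, Or.inr hwX⟩
  have hsub : cut D.arcs X ⊆ {(t, u)} := by
    intro e he
    simp only [cut, Finset.mem_filter] at he
    obtain ⟨heA, he1, he2⟩ := he
    have he2' := hXm _ (h.wf _ heA).2.1 he2
    rw [Finset.mem_singleton]
    rcases (h.as e).1 heA with rfl | rfl | ⟨e', h1, -, -, rfl⟩ | ⟨e', h1, h2, h3, rfl⟩
    · rfl
    · exact absurd hwX he2
    · exfalso
      have := hX2 _ he2'
      rcases h.rho1 (h.wf1 _ h1).2.1 with h3 | h3 <;> grind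
    · exact absurd (he2'.head ⟨e', h1, h2, h3, rfl, rfl⟩) (Finset.mem_filter.1 he1).2
  have := Finset.card_le_card hsub
  simp at this
  omega

/-- Cuts of `D` give cuts of `D1`. -/
lemma J.cut_le (h : J D D1 D2 t a1 w v a2 u a ρ) {k : ℕ} (hk : 2 ≤ k) (hn : ¬ Col D.arcs k)
    (hmin : ∀ C, C ⊂ D.arcs → Col C k) (X : Finset ℕ) :
    (cut D1.arcs (D1.verts.filter fun z => ρ z ∈ X)).card ≤ (cut D.arcs X).card := by
  obtain ⟨ht, hw, hv, hu, ha1, ha2⟩ := h.ends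
  set Y := D1.verts.filter fun z => ρ z ∈ X with hY
  have hmem : ∀ e, e ∈ cut D1.arcs Y ↔ e ∈ D1.arcs ∧ ρ e.1 ∈ X ∧ ρ e.2 ∉ X := by
    intro e
    simp only [cut, hY, Finset.mem_filter, not_and]
    constructor
    · rintro ⟨h1, h2, h3⟩
      exact ⟨h1, h2.2, h3 (h.wf1 _ h1).2.1⟩
    · rintro ⟨h1, h2, h3⟩
      exact ⟨h1, ⟨(h.wf1 _ h1).1, h2⟩, fun _ => h3⟩
  have hρt := h.r1 t ht.1 ht.2
  have hρw := h.r1 w hw.1 hw.2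
  -- an extra arc in the cut of `D`
  have hex : ∃ e1 : ℕ × ℕ, ((t, a1) ∈ cut D1.arcs Y ∨ (a1, w) ∈ cut D1.arcs Y) →
      e1 ∈ cut D.arcs X ∧ ((e1.1 ∈ D2.verts ∧ e1.1 ≠ a) ∨ (e1.2 ∈ D2.verts ∧ e1.2 ≠ a)) := by
    have hR2 : ∀ z z', R2 D2 v a2 u ρ z z' → z ∈ X → z' ∉ X →
        (z, z') ∈ cut D.arcs X ∧ ((z ∈ D2.verts ∧ z ≠ a) ∨ (z' ∈ D2.verts ∧ z' ≠ a)) := by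
      intro z z' hzz hz hz'
      refine ⟨by simpa [cut] using ⟨h.r2_arc hzz, hz, hz'⟩, ?_⟩
      have h1 := h.r2_mem hzz
      have h2 := (h.wf _ (h.r2_arc hzz)).2.2
      simp only at h2
      grind
    have hua := h.an2 u hu.1 hu.2
    have hva := h.an2 v hv.1 hv.2
    by_cases h1 : (t, a1) ∈ cut D1.arcs Y
    · rw [hmem] at h1
      simp only [h.ra1, hρt] at h1
      by_cases huX : u ∈ X
      · obtain ⟨z, z', hzz, hz, hz'⟩ := exists_cross (h.reach_ua hk hn hmin) X huX h1.2.2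
        exact ⟨(z, z'), fun _ => hR2 z z' hzz hz hz'⟩
      · refine ⟨(t, u), fun _ => ⟨?_, Or.inr ⟨hu.1, hua⟩⟩⟩
        simp only [cut, Finset.mem_filter]
        exact ⟨(h.as _).2 (Or.inl rfl), h1.2.1, huX⟩
    · by_cases h2 : (a1, w) ∈ cut D1.arcs Y
      · rw [hmem] at h2
        simp only [h.ra1, hρw] at h2
        by_cases hvX : v ∈ X
        · refine ⟨(v, w), fun _ => ⟨?_, Or.inl ⟨hv.1, hva⟩⟩⟩
          simp only [cut, Finset.mem_filter]
          exact ⟨(h.as _).2 (Or.inr (Or.inl rfl)), hvX, h2.2.2⟩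
        · obtain ⟨z, z', hzz, hz, hz'⟩ := exists_cross (h.reach_av hk hn hmin) X h2.2.1 hvX
          exact ⟨(z, z'), fun _ => hR2 z z' hzz hz hz'⟩
      · exact ⟨(0, 0), fun h' => absurd h' (by tauto)⟩
  obtain ⟨e1, he1⟩ := hex
  have hnot : ¬ ((t, a1) ∈ cut D1.arcs Y ∧ (a1, w) ∈ cut D1.arcs Y) := by
    rintro ⟨h1, h2⟩
    rw [hmem] at h1 h2
    exact h1.2.2 h2.2.1
  have hside : ∀ e ∈ D1.arcs, e1 = (ρ e.1, ρ e.2) →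
      ¬ ((e1.1 ∈ D2.verts ∧ e1.1 ≠ a) ∨ (e1.2 ∈ D2.verts ∧ e1.2 ≠ a)) := by
    rintro e he rfl
    have hw := h.wf1 _ he
    rcases h.rho1 hw.1 with h3 | h3 <;> rcases h.rho1 hw.2.1 with h4 | h4 <;> grind
  let g : ℕ × ℕ → ℕ × ℕ := fun e => if e = (t, a1) ∨ e = (a1, w) then e1 else (ρ e.1, ρ e.2)
  apply Finset.card_le_card_of_injOn g
  · intro e he
    have he' : e ∈ cut D1.arcs Y := he
    change g e ∈ cut D.arcs X
    by_cases hs : e = (t, a1) ∨ e = (a1, w)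
    · simp only [g, if_pos hs]
      exact (he1 (by rcases hs with rfl | rfl <;> tauto)).1
    · simp only [g, if_neg hs]
      rw [hmem] at he'
      simp only [cut, Finset.mem_filter]
      push Not at hs
      exact ⟨(h.as _).2 (Or.inr (Or.inr (Or.inl ⟨e, he'.1, hs.1, hs.2, rfl⟩))), he'.2⟩
  · intro e he e' he' hee
    have he : e ∈ cut D1.arcs Y := he
    have he' : e' ∈ cut D1.arcs Y := he'
    have hA := ((hmem _).1 he).1
    have hA' := ((hmem _).1 he').1
    by_cases hs : e = (t, a1) ∨ e = (a1, w) <;> by_cases hs' : e' = (t, a1) ∨ e' = (a1, w)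
    · rcases hs with rfl | rfl <;> rcases hs' with rfl | rfl <;> tauto
    · simp only [g, if_pos hs, if_neg hs'] at hee
      exact absurd (he1 (by rcases hs with rfl | rfl <;> tauto)).2 (hside _ hA' hee)
    · simp only [g, if_pos hs', if_neg hs] at hee
      exact absurd (he1 (by rcases hs' with rfl | rfl <;> tauto)).2 (hside _ hA hee.symm)
    · simp only [g, if_neg hs, if_neg hs', Prod.mk.injEq] at hee
      have w1 := h.wf1 _ hA
      have w2 := h.wf1 _ hA'
      apply Prod.ext
      · rw [← h.prj_rho w1.1, hee.1, h.prj_rho w2.1]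
      · rw [← h.prj_rho w1.2.1, hee.2, h.prj_rho w2.2.1]

lemma exists_perm {k : ℕ} (hk : 3 ≤ k) (x y c d : Fin k) :
    ∃ σ : Equiv.Perm (Fin k), σ x = c ∧ (d ≠ c → σ y ≠ d) := by
  by_cases hd : d = c
  · exact ⟨Equiv.swap x c, by simp, fun h => absurd hd h⟩
  by_cases hy : Equiv.swap x c y = d
  · obtain ⟨d', hd'⟩ : ∃ d' : Fin k, d' ∉ ({c, d} : Finset (Fin k)) := by
      by_contra! hall
      have h1 : (Finset.univ : Finset (Fin k)) ⊆ {c, d} := fun z _ => hall z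
      have h2 := Finset.card_le_card h1
      have h3 := Finset.card_le_two (a := c) (b := d)
      simp at h2
      omega
    simp at hd'
    refine ⟨(Equiv.swap x c).trans (Equiv.swap d d'), ?_, ?_⟩
    · simp only [Equiv.trans_apply, Equiv.swap_apply_left]
      exact Equiv.swap_apply_of_ne_of_ne (fun h => hd h.symm) (fun h => hd'.1 h.symm)
    · intro _
      simp only [Equiv.trans_apply, hy, Equiv.swap_apply_left]
      exact hd'.2
  · exact ⟨Equiv.swap x c, by simp, fun _ => hy⟩

open Classical in
lemma J.not_col (h : J D D1 D2 t a1 w v a2 u a ρ) {k : ℕ} (hk : 3 ≤ k) (hn : ¬ Col D.arcs k)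
    (hmin : ∀ C, C ⊂ D.arcs → Col C k) : ¬ Col D1.arcs k := by
  rintro ⟨φ, f, hf⟩
  obtain ⟨ht, hw, hv, hu, ha1, ha2⟩ := h.ends
  have hta := h.an1 t ht.1 ht.2
  have hwa := h.an1 w hw.1 hw.2
  have hua := h.an2 u hu.1 hu.2
  have hva := h.an2 v hv.1 hv.2
  obtain ⟨ψ, g, hg⟩ := hmin (D.arcs.filter fun e => R2 D2 v a2 u ρ e.1 e.2) (by
    rw [Finset.filter_ssubset]
    refine ⟨(t, u), (h.as _).2 (Or.inl rfl), fun h' => ?_⟩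
    rcases (h.r2_mem h').1 with h1 | h1
    · exact hta h1
    · exact h.dis t ht.1 h1)
  obtain ⟨σ, hσ1, hσ2⟩ := exists_perm hk (ψ a) (ψ u) (φ a1) (φ t)
  apply hn
  let N := (∑ z ∈ D.verts, (g z + 1)) + 1
  have hN : ∀ z ∈ D.verts, g z + 1 < N := by
    intro z hz
    have := Finset.single_le_sum (f := fun z => g z + 1) (fun _ _ => Nat.zero_le _) hz
    simp only [N]
    omega
  have haN := hN a ((h.vs a).2 (Or.inl rfl))
  let Φ : ℕ → Fin k := fun x => if x = a then φ a1 else if x ∈ D1.verts then φ x else σ (ψ x)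
  let Fn : ℕ → ℕ := fun x => if x = a then N * (2 * f a1 + 2) else
    if x ∈ D1.verts then N * (2 * f x + 2) else
    if σ (ψ x) = φ a1 then N * (2 * f a1 + 2) + g x - g a else g x
  -- values on the two sides
  have Φ1 : ∀ x ∈ D1.verts, Φ (ρ x) = φ x ∧ Fn (ρ x) = N * (2 * f x + 2) := by
    intro x hx
    rcases h.rho1 hx with ⟨rfl, h3⟩ | ⟨h1, h2, h3, h4⟩
    · simp [Φ, Fn, h3]
    · simp [Φ, Fn, h2, h3, hx]
  have Φ2 : ∀ x, x = a ∨ x ∈ D2.verts → x ∈ D.verts → Φ x = σ (ψ x) ∧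
      Fn x = if σ (ψ x) = φ a1 then N * (2 * f a1 + 2) + g x - g a else g x := by
    intro x hx _
    by_cases hxa : x = a
    · subst hxa
      simp [Φ, Fn, hσ1]
    · have hx2 := hx.resolve_left hxa
      have hx1 : x ∉ D1.verts := fun h' => h.dis x h' hx2
      simp [Φ, Fn, hxa, hx1]
  have mt := Φ1 t ht.1
  have mw := Φ1 w hw.1
  rw [h.r1 t ht.1 ht.2] at mt
  rw [h.r1 w hw.1 hw.2] at mw
  have huD := (h.vs u).2 (Or.inr (Or.inr hu))
  have hvD := (h.vs v).2 (Or.inr (Or.inr hv))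
  have mu := Φ2 u (Or.inr hu.1) huD
  have mv := Φ2 v (Or.inr hv.1) hvD
  refine ⟨Φ, Fn, ?_⟩
  intro e he heq
  rcases (h.as e).1 he with rfl | rfl | ⟨e', h1, -, -, rfl⟩ | ⟨e', h1, h2, h3, rfl⟩
  · simp only [mt.1, mu.1] at heq
    simp only [mt.2, mu.2]
    have hc : φ t = φ a1 := by
      by_contra hne
      exact hσ2 hne heq.symm
    rw [if_pos (heq.symm.trans hc)]
    have hlt := hf _ h.ta hc
    simp only at hlt
    have : N * (2 * f t + 2) + N ≤ N * (2 * f a1 + 2) := by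
      calc N * (2 * f t + 2) + N = N * (2 * f t + 3) := by ring
        _ ≤ _ := Nat.mul_le_mul_left _ (by omega)
    omega
  · simp only [mw.1, mv.1] at heq
    simp only [mw.2, mv.2]
    have := hN v hvD
    split_ifs with hc
    · have hlt := hf _ h.aw (hc.symm.trans heq)
      simp only at hlt
      have : N * (2 * f a1 + 2) + N ≤ N * (2 * f w + 2) := by
        calc N * (2 * f a1 + 2) + N = N * (2 * f a1 + 3) := by ring
          _ ≤ _ := Nat.mul_le_mul_left _ (by omega)
      omega
    · have : N * 1 ≤ N * (2 * f w + 2) := Nat.mul_le_mul_left _ (by omega)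
      omega
  · have hw' := h.wf1 _ h1
    have p1 := Φ1 _ hw'.1
    have p2 := Φ1 _ hw'.2.1
    simp only [p1.1, p2.1] at heq
    simp only [p1.2, p2.2]
    have := hf _ h1 heq
    exact Nat.mul_lt_mul_of_pos_left (by omega) (by omega)
  · have hR : R2 D2 v a2 u ρ (ρ e'.1) (ρ e'.2) := ⟨e', h1, h2, h3, rfl, rfl⟩
    have hm := h.r2_mem hR
    have hwf := h.wf _ he
    have p1 := Φ2 _ hm.1 hwf.1
    have p2 := Φ2 _ hm.2 hwf.2.1
    simp only [p1.1, p2.1] at heq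
    simp only [p1.2, p2.2]
    have hψ := σ.injective heq
    have hlt := hg (ρ e'.1, ρ e'.2) (Finset.mem_filter.2 ⟨he, hR⟩) hψ
    simp only at hlt
    rw [hψ]
    have : N * 1 ≤ N * (2 * f a1 + 2) := Nat.mul_le_mul_left _ (by omega)
    split_ifs <;> omega

/-- The result for the first digraph. -/
lemma J.extremal (h : J D D1 D2 t a1 w v a2 u a ρ) {k : ℕ} (hk : 3 ≤ k) (hext : Extremal k D) :
    Extremal k D1 := by
  have hmin := extremal_critical h.wf (by omega) hext
  obtain ⟨hb, hs, hchi, hlam⟩ := hext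
  have hn := ((dichi_iff h.wf k).1 hchi).2
  have hs1 := h.strong hs
  have hn1 := h.not_col hk hn hmin
  have hcuts : ∀ x ∈ D1.verts, ∀ y ∈ D1.verts, x ≠ y →
      ∃ X : Finset ℕ, x ∈ X ∧ y ∉ X ∧ (cut D1.arcs X).card ≤ k := by
    intro x hx y hy hxy
    have hne : ρ x ≠ ρ y := by
      intro h'
      apply hxy
      rw [← h.prj_rho hx, h', h.prj_rho hy]
    obtain ⟨X, h1, h2, h3⟩ := exists_cut h.wf (h.rho_mem hx) hne
    have h4 := locLam_le_lam (h.rho_mem hx) (h.rho_mem hy) hne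
    refine ⟨D1.verts.filter fun z => ρ z ∈ X, by simp [hx, h1], by simp [h2], ?_⟩
    exact (h.cut_le (by omega) hn hmin X).trans (by omega)
  refine ⟨h.biconn hb hs1, hs1, (dichi_iff h.wf1 k).2 ⟨?_, hn1⟩, le_antisymm ?_ ?_⟩
  · refine neumann_lara (V := D1.verts) (by omega) h.wf1 ?_
    intro x hx y hy hxy
    obtain ⟨X, h1, h2, h3⟩ := hcuts x hx y hy hxy
    exact ⟨X, h1, h2, by omega⟩
  · apply csSup_le'
    rintro n ⟨x, hx, y, hy, hxy, rfl⟩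
    obtain ⟨X, h1, h2, h3⟩ := hcuts x hx y hy hxy
    exact (locLam_le h1 h2).trans h3
  · by_contra! hlt
    refine hn1 (neumann_lara (V := D1.verts) (by omega) h.wf1 ?_)
    intro x hx y hy hxy
    obtain ⟨X, h1, h2, h3⟩ := exists_cut h.wf1 hx hxy
    exact ⟨X, h1, h2, by have := locLam_le_lam hx hy hxy; omega⟩

end

end Bij

/-- Lemma 5.5: if a Hajós bijoin of two digraphs is
k-extremal (k ≥ 3), then both of them are k-extremal. -/
theorem statement_11 (k : ℕ) (hk : 3 ≤ k) (D D1 D2 : Dgraph)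
    (hjoin : IsHajosBijoin D D1 D2) (hext : Extremal k D) :
    Extremal k D1 ∧ Extremal k D2 := by
  obtain ⟨t, a1, w, v, a2, u, a, h⟩ := hjoin
  exact ⟨(Bij.toJ h).extremal hk hext, (Bij.toJ (Bij.bijoin_symm h)).extremal hk hext⟩
end

section
/- Let k ≥ 3 and let D be a k-extremal digraph. Suppose there exist arcs tu and uw in A(D) such that D − {tu, uw} has a cutvertex. Then D is a directed Hajós join or a Hajós bijoin of two digraphs. -/
namespace HJ

open Relation Classical

/-! ### Arc version of the theorem of Menger -/

/-- Arcs of `F` leaving `Y`. -/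
noncomputable def cut (F : Finset (ℕ × ℕ)) (Y : Set ℕ) : Finset (ℕ × ℕ) :=
  F.filter fun a => a.1 ∈ Y ∧ a.2 ∉ Y

lemma mem_cut {F : Finset (ℕ × ℕ)} {Y : Set ℕ} {a : ℕ × ℕ} :
    a ∈ cut F Y ↔ a ∈ F ∧ a.1 ∈ Y ∧ a.2 ∉ Y := by
  simp [cut]

noncomputable def ind (Y : Set ℕ) (a : ℕ) : ℤ := if a ∈ Y then 1 else 0

/-- Net flow of `G` out of `Y`. -/
noncomputable def net (G : Finset (ℕ × ℕ)) (Y : Set ℕ) : ℤ :=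
  ∑ e ∈ G, (ind Y e.1 - ind Y e.2)

lemma exists_nodup {R : ℕ → ℕ → Prop} {a b : ℕ} (h : ReflTransGen R a b) :
    ∃ l : List ℕ, (a :: l).Nodup ∧ List.IsChain R (a :: l) ∧ (a :: l).getLast? = some b := by
  induction h using ReflTransGen.head_induction_on with
  | refl => exact ⟨[], by simp, by simp, by simp⟩
  | @head a c hac _ ih =>
    obtain ⟨l, hn, hc, hl⟩ := ih
    by_cases ha : a ∈ c :: l
    · obtain ⟨s, r, hsr⟩ := List.append_of_mem ha
      rw [hsr] at hn hc hl
      refine ⟨r, (List.nodup_append.1 hn).2.1, hc.right_of_append, ?_⟩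
      rw [List.getLast?_append] at hl
      simpa using hl
    · refine ⟨c :: l, List.nodup_cons.2 ⟨ha, hn⟩, List.isChain_cons_cons.2 ⟨hac, hc⟩, ?_⟩
      simpa using hl

lemma augment (F : Finset (ℕ × ℕ)) (b : ℕ) : ∀ (l : List ℕ) (G : Finset (ℕ × ℕ)) (a : ℕ),
    (a :: l).Nodup →
    List.IsChain (fun p q => ((p, q) ∈ F ∧ (p, q) ∉ G) ∨ (q, p) ∈ G) (a :: l) → G ⊆ F →
    (a :: l).getLast? = some b →
    ∃ G' ⊆ F, ∀ Y, net G' Y = net G Y + ind Y a - ind Y b := by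
  intro l
  induction l with
  | nil =>
    intro G a _ _ hG hl
    have : a = b := by simpa using hl
    subst this
    exact ⟨G, hG, fun Y => by ring⟩
  | cons c l ih =>
    intro G a hn hc hG hl
    rw [List.isChain_cons_cons] at hc
    rw [List.nodup_cons] at hn
    obtain ⟨hac, hc⟩ := hc
    obtain ⟨hna, hn⟩ := hn
    have hl' : (c :: l).getLast? = some b := by simpa using hl
    rcases hac with ⟨h1, h2⟩ | h1
    · obtain ⟨G', hG', h⟩ := ih (insert (a, c) G) c hn
        (by
          refine hc.imp_of_mem_imp ?_
          rintro p q hp hq (⟨h3, h4⟩ | h3)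
          · left
            refine ⟨h3, ?_⟩
            simp only [Finset.mem_insert, Prod.mk.injEq, not_or]
            refine ⟨?_, h4⟩
            rintro ⟨rfl, rfl⟩
            exact hna hp
          · right; simp [h3])
        (by intro e he; rcases Finset.mem_insert.1 he with rfl | he
            · exact h1
            · exact hG he) hl'
      refine ⟨G', hG', fun Y => ?_⟩
      rw [h, net, Finset.sum_insert h2]
      simp only [net]; ring
    · obtain ⟨G', hG', h⟩ := ih (G.erase (c, a)) c hn
        (by
          refine hc.imp_of_mem_imp ?_
          rintro p q hp hq (⟨h3, h4⟩ | h3)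
          · left
            exact ⟨h3, fun h => h4 (Finset.mem_of_mem_erase h)⟩
          · right
            refine Finset.mem_erase.2 ⟨?_, h3⟩
            intro h
            simp only [Prod.mk.injEq] at h
            exact hna (h.2 ▸ hp))
        ((Finset.erase_subset _ _).trans hG) hl'
      refine ⟨G', hG', fun Y => ?_⟩
      have := Finset.sum_erase_add G (fun e : ℕ × ℕ => ind Y e.1 - ind Y e.2) h1
      rw [h]
      simp only [net] at *
      linarith

lemma ind_of_mem {Y : Set ℕ} {a : ℕ} (h : a ∈ Y) : ind Y a = 1 := by simp [ind, h]
lemma ind_of_not_mem {Y : Set ℕ} {a : ℕ} (h : a ∉ Y) : ind Y a = 0 := by simp [ind, h]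

lemma exists_flow (F : Finset (ℕ × ℕ)) (y z : ℕ) (n : ℕ)
    (hcut : ∀ Y : Set ℕ, y ∈ Y → z ∉ Y → n ≤ (cut F Y).card) :
    ∀ m ≤ n, ∃ G ⊆ F, ∀ Y, net G Y = m * (ind Y y - ind Y z) := by
  intro m
  induction m with
  | zero => intro _; exact ⟨∅, by simp, fun Y => by simp [net]⟩
  | succ m ih =>
    intro hm
    obtain ⟨G, hG, hnet⟩ := ih (by omega)
    by_cases hr : ReflTransGen (fun p q => ((p, q) ∈ F ∧ (p, q) ∉ G) ∨ (q, p) ∈ G) y z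
    · obtain ⟨l, h1, h2, h3⟩ := exists_nodup hr
      obtain ⟨G', hG', h⟩ := augment F z l G y h1 h2 hG h3
      refine ⟨G', hG', fun Y => ?_⟩
      rw [h, hnet]; push_cast; ring
    · exfalso
      set Y : Set ℕ := {v | ReflTransGen
        (fun p q => ((p, q) ∈ F ∧ (p, q) ∉ G) ∨ (q, p) ∈ G) y v} with hY
      have hy : y ∈ Y := ReflTransGen.refl
      have hz : z ∉ Y := hr
      have h1 := hcut Y hy hz
      have h2 := hnet Y
      rw [ind_of_mem hy, ind_of_not_mem hz] at h2
      have h3 : ((cut F Y).card : ℤ) ≤ net G Y := by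
        have hsub : cut F Y ⊆ G := by
          intro e he
          rw [mem_cut] at he
          by_contra hne
          exact he.2.2 (ReflTransGen.tail he.2.1 (Or.inl ⟨he.1, hne⟩))
        have h4 : ∑ e ∈ cut F Y, (1 : ℤ) ≤ ∑ e ∈ G, (ind Y e.1 - ind Y e.2) := by
          calc ∑ e ∈ cut F Y, (1 : ℤ) = ∑ e ∈ cut F Y, (ind Y e.1 - ind Y e.2) := by
                refine Finset.sum_congr rfl fun e he => ?_
                rw [mem_cut] at he
                rw [ind_of_mem he.2.1, ind_of_not_mem he.2.2]; norm_num
            _ ≤ _ := by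
                refine Finset.sum_le_sum_of_subset_of_nonneg hsub fun e he _ => ?_
                by_cases h5 : e.2 ∈ Y
                · have h6 : e.1 ∈ Y := ReflTransGen.tail h5 (Or.inr he)
                  rw [ind_of_mem h5, ind_of_mem h6]; norm_num
                · rw [ind_of_not_mem h5]
                  simp only [ind]; split_ifs <;> norm_num
        simpa [net] using h4
      have : (n : ℤ) ≤ m := by
        have : (n : ℤ) ≤ (cut F Y).card := by exact_mod_cast h1
        linarith
      omega

lemma arcsOf_cons (a c : ℕ) (l : List ℕ) :
    Dgraph.arcsOf (a :: c :: l) = insert (a, c) (Dgraph.arcsOf (c :: l)) := by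
  simp [Dgraph.arcsOf]

lemma arcsOf_mem {l : List ℕ} {p q : ℕ} (h : (p, q) ∈ Dgraph.arcsOf l) : p ∈ l ∧ q ∈ l := by
  simp only [Dgraph.arcsOf, List.mem_toFinset] at h
  have := List.of_mem_zip h
  exact ⟨this.1, List.mem_of_mem_tail this.2⟩

lemma net_arcsOf (b : ℕ) (Y : Set ℕ) : ∀ (l : List ℕ) (a : ℕ), (a :: l).Nodup →
    (a :: l).getLast? = some b → net (Dgraph.arcsOf (a :: l)) Y = ind Y a - ind Y b := by
  intro l
  induction l with
  | nil =>
    intro a _ hl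
    have : a = b := by simpa using hl
    subst this
    simp [net, Dgraph.arcsOf]
  | cons c l ih =>
    intro a hn hl
    rw [List.nodup_cons] at hn
    have hl' : (c :: l).getLast? = some b := by simpa using hl
    have := ih c hn.2 hl'
    rw [arcsOf_cons, net, Finset.sum_insert (fun h => hn.1 (arcsOf_mem h).1)]
    simp only [net] at this
    rw [this]; ring

lemma arcsOf_subset (G : Finset (ℕ × ℕ)) : ∀ (l : List ℕ),
    List.IsChain (fun a b => (a, b) ∈ G) l → Dgraph.arcsOf l ⊆ G := by
  intro l
  induction l with
  | nil => intro _; simp [Dgraph.arcsOf]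
  | cons a l ih =>
    cases l with
    | nil => intro _; simp [Dgraph.arcsOf]
    | cons c l =>
      intro h
      rw [List.isChain_cons_cons] at h
      rw [arcsOf_cons]
      exact Finset.insert_subset h.1 (ih h.2)

lemma exists_paths (y z : ℕ) (hyz : y ≠ z) : ∀ (n : ℕ) (G : Finset (ℕ × ℕ)),
    (∀ Y, net G Y = n * (ind Y y - ind Y z)) →
    ∃ P : Fin n → List ℕ, (∀ i, (P i).Nodup ∧ (P i).head? = some y ∧ (P i).getLast? = some z ∧
      List.IsChain (fun a b => (a, b) ∈ G) (P i)) ∧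
      Pairwise fun i j => Disjoint (Dgraph.arcsOf (P i)) (Dgraph.arcsOf (P j)) := by
  intro n
  induction n with
  | zero => intro G _; exact ⟨fun i => [], fun i => i.elim0, fun i => i.elim0⟩
  | succ n ih =>
    intro G hG
    have hr : ReflTransGen (fun a b => (a, b) ∈ G) y z := by
      by_contra hr
      set Y : Set ℕ := {v | ReflTransGen (fun a b => (a, b) ∈ G) y v} with hY
      have hy : y ∈ Y := ReflTransGen.refl
      have hz : z ∉ Y := hr
      have h1 := hG Y
      rw [ind_of_mem hy, ind_of_not_mem hz] at h1
      have h2 : net G Y ≤ 0 := by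
        refine Finset.sum_nonpos fun e he => ?_
        by_cases h5 : e.1 ∈ Y
        · have h6 : e.2 ∈ Y := ReflTransGen.tail h5 he
          rw [ind_of_mem h5, ind_of_mem h6]; norm_num
        · rw [ind_of_not_mem h5]
          simp only [ind]; split_ifs <;> norm_num
      push_cast at h1
      linarith
    obtain ⟨l, h1, h2, h3⟩ := exists_nodup hr
    have hsub := arcsOf_subset G _ h2
    obtain ⟨P, hP, hd⟩ := ih (G \ Dgraph.arcsOf (y :: l)) (by
      intro Y
      have h4 := net_arcsOf z Y l y h1 h3
      have h5 := hG Y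
      have h6 := Finset.sum_sdiff (f := fun e : ℕ × ℕ => ind Y e.1 - ind Y e.2) hsub
      simp only [net] at *
      push_cast at h5
      linarith)
    have hP' : ∀ i, Disjoint (Dgraph.arcsOf (y :: l)) (Dgraph.arcsOf (P i)) := fun i =>
      Finset.disjoint_of_subset_right (arcsOf_subset _ _ (hP i).2.2.2) Finset.disjoint_sdiff
    refine ⟨Fin.cons (y :: l) P, ?_, ?_⟩
    · intro i
      refine Fin.cases ?_ (fun i => ?_) i
      · exact ⟨h1, by simp, h3, h2⟩
      · refine ⟨(hP i).1, (hP i).2.1, (hP i).2.2.1, ?_⟩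
        exact (hP i).2.2.2.imp fun a b h => (Finset.mem_sdiff.1 h).1
    · intro i j
      refine Fin.cases ?_ (fun i => ?_) i
      · refine Fin.cases ?_ (fun j => ?_) j
        · intro h; exact absurd rfl h
        · intro _; exact hP' j
      · refine Fin.cases ?_ (fun j => ?_) j
        · intro h; exact (hP' i).symm
        · intro h
          exact hd (i := i) (j := j) (fun hh => h (congrArg Fin.succ hh))

lemma chain_verts (D : Dgraph) (hWF : D.WF) : ∀ (l : List ℕ) (a : ℕ), a ∈ D.verts →
    List.IsChain (fun a b => (a, b) ∈ D.arcs) (a :: l) → ∀ x ∈ a :: l, x ∈ D.verts := by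
  intro l
  induction l with
  | nil => intro a ha _ x hx; simp at hx; exact hx ▸ ha
  | cons c l ih =>
    intro a ha h x hx
    rw [List.isChain_cons_cons] at h
    rcases List.mem_cons.1 hx with rfl | hx
    · exact ha
    · exact ih c (hWF _ h.1).2.1 h.2 x hx

/-- Menger: if `λ(D) ≤ k` then every pair of vertices is separated by a dicut of size `≤ k`. -/
lemma exists_cut (D : Dgraph) (hWF : D.WF) (k : ℕ) (hlam : D.lam = k) (y z : ℕ)
    (hy : y ∈ D.verts) (hz : z ∈ D.verts) (hyz : y ≠ z) :
    ∃ Y : Set ℕ, y ∈ Y ∧ z ∉ Y ∧ (cut D.arcs Y).card ≤ k := by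
  by_contra! hcon
  obtain ⟨G, hG, hnet⟩ := exists_flow D.arcs y z (k + 1)
    (fun Y h1 h2 => hcon Y h1 h2) (k + 1) le_rfl
  obtain ⟨P, hP, hd⟩ := exists_paths y z hyz (k + 1) G hnet
  have hdip : ∀ i, D.IsDipath (P i) y z := by
    intro i
    obtain ⟨h1, h2, h3, h4⟩ := hP i
    have h5 : List.IsChain (fun a b => (a, b) ∈ D.arcs) (P i) := h4.imp fun a b h => hG h
    refine ⟨h1, h2, h3, ?_, h5⟩
    rcases hl : P i with _ | ⟨a, l⟩
    · rw [hl] at h2; simp at h2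
    · rw [hl] at h2 h5
      have : a = y := by simpa using h2
      subst this
      exact chain_verts D hWF l a hy h5
  have hbdd : BddAbove {n | ∃ P : Fin n → List ℕ, (∀ i, D.IsDipath (P i) y z) ∧
      Pairwise fun i j => Disjoint (Dgraph.arcsOf (P i)) (Dgraph.arcsOf (P j))} := by
    refine ⟨D.arcs.card, ?_⟩
    rintro n ⟨Q, hQ, hdQ⟩
    have hne : ∀ i, ∃ e, e ∈ Dgraph.arcsOf (Q i) := by
      intro i
      obtain ⟨_, h2, h3, _, _⟩ := hQ i
      rcases hl : Q i with _ | ⟨a, _ | ⟨c, l⟩⟩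
      · rw [hl] at h2; simp at h2
      · rw [hl] at h2 h3
        simp at h2 h3
        exact absurd (h2.symm.trans h3) hyz
      · exact ⟨(a, c), by rw [arcsOf_cons]; simp⟩
    choose e he using hne
    have hinj : Function.Injective e := by
      intro i j hij
      by_contra hne
      exact Finset.disjoint_left.1 (hdQ hne) (he i) (hij ▸ he j)
    have := Finset.card_le_card_of_injOn (s := (Finset.univ : Finset (Fin n))) (t := D.arcs) e
      (fun i _ => arcsOf_subset _ _ (hQ i).2.2.2.2 (he i)) hinj.injOn
    simpa using this
  have h1 : k + 1 ≤ D.locLam y z := le_csSup hbdd ⟨P, hdip, hd⟩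
  have h2 : D.locLam y z ≤ D.lam := by
    refine le_csSup ?_ ⟨y, hy, z, hz, hyz, rfl⟩
    have hfin : {n | ∃ u ∈ D.verts, ∃ v ∈ D.verts, u ≠ v ∧ n = D.locLam u v} ⊆
        ((D.verts ×ˢ D.verts).image fun p => D.locLam p.1 p.2 : Finset ℕ) := by
      rintro n ⟨u, hu, v, hv, _, rfl⟩
      simp only [Finset.coe_image, Set.mem_image]
      exact ⟨(u, v), by simp [hu, hv], rfl⟩
    exact (Set.Finite.subset (Finset.finite_toSet _) hfin).bddAbove
  omega

end HJ

namespace HJ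

open Relation Classical

/-! ### Colourings -/

/-- Monochromatic arcs. -/
def MM {k : ℕ} (F : Finset (ℕ × ℕ)) (φ : ℕ → Fin k) (a b : ℕ) : Prop := (a, b) ∈ F ∧ φ a = φ b

def Acyc (R : ℕ → ℕ → Prop) : Prop := ∀ v, ¬ TransGen R v v

def Col (k : ℕ) (F : Finset (ℕ × ℕ)) : Prop := ∃ φ : ℕ → Fin k, Acyc (MM F φ)

lemma Acyc.mono {R S : ℕ → ℕ → Prop} (h : Acyc S) (hRS : ∀ a b, R a b → S a b) : Acyc R :=
  fun v hv => h v (TransGen.mono hRS _ _ hv)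

lemma Col.mono {k : ℕ} {F G : Finset (ℕ × ℕ)} (h : Col k G) (hFG : F ⊆ G) : Col k F := by
  obtain ⟨φ, hφ⟩ := h
  exact ⟨φ, hφ.mono fun a b hab => ⟨hFG hab.1, hab.2⟩⟩

lemma acyc_perm {k : ℕ} {F : Finset (ℕ × ℕ)} {φ : ℕ → Fin k} (h : Acyc (MM F φ))
    (π : Fin k → Fin k) (hπ : Function.Injective π) : Acyc (MM F (fun v => π (φ v))) :=
  h.mono fun a b hab => ⟨hab.1, hπ hab.2⟩

lemma mm_color {k : ℕ} {F : Finset (ℕ × ℕ)} {φ : ℕ → Fin k} {a b : ℕ}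
    (h : ReflTransGen (MM F φ) a b) : φ a = φ b := by
  induction h with
  | refl => rfl
  | tail _ h ih => exact ih.trans h.2

/-- Adding an arc to an acyclic relation. -/
lemma acyc_add {R : ℕ → ℕ → Prop} (h : Acyc R) (p q : ℕ) (hqp : ¬ ReflTransGen R q p) :
    Acyc (fun a b => R a b ∨ (a = p ∧ b = q)) := by
  have key : ∀ a b, TransGen (fun a b => R a b ∨ (a = p ∧ b = q)) a b →
      TransGen R a b ∨ (ReflTransGen R a p ∧ ReflTransGen R q b) := by
    intro a b hab
    induction hab with
    | single h =>
      rcases h with h | ⟨rfl, rfl⟩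
      · exact Or.inl (TransGen.single h)
      · exact Or.inr ⟨.refl, .refl⟩
    | tail _ h ih =>
      rcases h with h | ⟨rfl, rfl⟩
      · rcases ih with ih | ih
        · exact Or.inl (ih.tail h)
        · exact Or.inr ⟨ih.1, ih.2.tail h⟩
      · rcases ih with ih | ih
        · exact Or.inr ⟨ih.to_reflTransGen, .refl⟩
        · exact absurd ih.2 hqp
  intro v hv
  rcases key v v hv with h1 | h1
  · exact h v h1
  · exact hqp (h1.2.trans h1.1)

/-- Closed sets and cycles: if no arc leaves `Y` then acyclicity can be checked on
`Y` and its complement. -/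
lemma acyc_split {R : ℕ → ℕ → Prop} (Y : Set ℕ) (hY : ∀ a b, R a b → a ∈ Y → b ∈ Y)
    (h1 : Acyc fun a b => R a b ∧ a ∈ Y ∧ b ∈ Y)
    (h2 : Acyc fun a b => R a b ∧ a ∉ Y ∧ b ∉ Y) : Acyc R := by
  have key1 : ∀ a b, TransGen R a b → a ∈ Y →
      b ∈ Y ∧ TransGen (fun a b => R a b ∧ a ∈ Y ∧ b ∈ Y) a b := by
    intro a b hab ha
    induction hab with
    | single h => exact ⟨hY _ _ h ha, .single ⟨h, ha, hY _ _ h ha⟩⟩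
    | tail _ h ih => exact ⟨hY _ _ h ih.1, ih.2.tail ⟨h, ih.1, hY _ _ h ih.1⟩⟩
  have key2 : ∀ a b, TransGen R a b → b ∉ Y →
      a ∉ Y ∧ TransGen (fun a b => R a b ∧ a ∉ Y ∧ b ∉ Y) a b := by
    intro a b hab hb
    induction hab using TransGen.head_induction_on with
    | single h =>
      have := fun ha => hb (hY _ _ h ha)
      exact ⟨this, .single ⟨h, this, hb⟩⟩
    | head h _ ih =>
      have := fun ha => ih.1 (hY _ _ h ha)
      exact ⟨this, .head ⟨h, this, ih.1⟩ ih.2⟩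
  intro v hv
  by_cases hvY : v ∈ Y
  · exact h1 v (key1 v v hv hvY).2
  · exact h2 v (key2 v v hv hvY).2

/-- Vertices incident to an arc of `H`. -/
def VV (H : Finset (ℕ × ℕ)) : Set ℕ := {v | ∃ a ∈ H, a.1 = v ∨ a.2 = v}

/-- `H` is minimal non-`k`-colourable. -/
def Crit (k : ℕ) (H : Finset (ℕ × ℕ)) : Prop := ¬ Col k H ∧ ∀ H' ⊂ H, Col k H'

lemma exists_crit {k : ℕ} {F : Finset (ℕ × ℕ)} (h : ¬ Col k F) : ∃ H ⊆ F, Crit k H := by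
  induction F using Finset.strongInduction with
  | H F ih =>
    by_cases hc : ∀ H' ⊂ F, Col k H'
    · exact ⟨F, subset_rfl, h, hc⟩
    · push Not at hc
      obtain ⟨H', hH', hn⟩ := hc
      obtain ⟨H, hH, hcrit⟩ := ih H' hH' hn
      exact ⟨H, hH.trans hH'.1, hcrit⟩

/-- In a critical arc set every nontrivial dicut has at least `k` arcs. -/
lemma Crit.cut_le {k : ℕ} (hk : 1 ≤ k) {H : Finset (ℕ × ℕ)} (hH : Crit k H) (Y : Set ℕ)
    (y z : ℕ) (hy : y ∈ VV H) (hyY : y ∈ Y) (hz : z ∈ VV H) (hzY : z ∉ Y) :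
    k ≤ (cut H Y).card := by
  by_contra! hlt
  obtain ⟨φ₁, h1⟩ := hH.2 (H.filter fun a => a.1 ∈ Y ∧ a.2 ∈ Y) (by
    refine Finset.filter_ssubset.2 ?_
    obtain ⟨a, ha, h⟩ := hz
    refine ⟨a, ha, ?_⟩
    rintro ⟨h1, h2⟩
    rcases h with rfl | rfl
    · exact hzY h1
    · exact hzY h2)
  obtain ⟨φ₂, h2⟩ := hH.2 (H.filter fun a => a.1 ∉ Y ∧ a.2 ∉ Y) (by
    refine Finset.filter_ssubset.2 ?_
    obtain ⟨a, ha, h⟩ := hy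
    refine ⟨a, ha, ?_⟩
    rintro ⟨h1, h2⟩
    rcases h with rfl | rfl
    · exact h1 hyY
    · exact h2 hyY)
  have : NeZero k := ⟨by omega⟩
  obtain ⟨s, hs⟩ : ∃ s : Fin k, s ∉ (cut H Y).image fun a => φ₁ a.1 - φ₂ a.2 := by
    by_contra! hall
    have h3 : (Finset.univ : Finset (Fin k)) ⊆ (cut H Y).image fun a => φ₁ a.1 - φ₂ a.2 :=
      fun s _ => hall s
    have h4 := (Finset.card_le_card h3).trans Finset.card_image_le
    simp at h4
    omega
  apply hH.1
  refine ⟨fun v => if v ∈ Y then φ₁ v else φ₂ v + s, acyc_split Y ?_ ?_ ?_⟩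
  · rintro a b ⟨hab, hc⟩ ha
    by_contra hb
    simp only [ha, hb, if_true, if_false] at hc
    apply hs
    refine Finset.mem_image.2 ⟨(a, b), mem_cut.2 ⟨hab, ha, hb⟩, ?_⟩
    simp only [hc]
    abel
  · refine h1.mono ?_
    rintro a b ⟨⟨hab, hc⟩, ha, hb⟩
    simp only [ha, hb, if_true] at hc
    exact ⟨Finset.mem_filter.2 ⟨hab, ha, hb⟩, hc⟩
  · refine h2.mono ?_
    rintro a b ⟨⟨hab, hc⟩, ha, hb⟩
    simp only [ha, hb, if_false] at hc
    exact ⟨Finset.mem_filter.2 ⟨hab, ha, hb⟩, add_right_cancel hc⟩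

/-- If a walk leads out of `Y`, some arc leaves `Y`. -/
lemma exists_leave {E : ℕ → ℕ → Prop} {y z : ℕ} (h : ReflTransGen E y z) (Y : Set ℕ)
    (hy : y ∈ Y) (hz : z ∉ Y) : ∃ a b, E a b ∧ a ∈ Y ∧ b ∉ Y := by
  by_contra! hcon
  apply hz
  induction h with
  | refl => exact hy
  | tail _ h ih => exact hcon _ _ h (by by_contra hb; exact hb (ih hb))

/-- The ear lemma. -/
lemma ear (W VH : Set ℕ) (R E : ℕ → ℕ → Prop)
    (hRE : ∀ a b, R a b → a ∈ W → b ∈ W → (a ∉ VH ∨ b ∉ VH) → E a b)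
    (noear : ∀ y ∈ VH, ∀ z ∈ VH, ReflTransGen E y z → y = z)
    (hfrom : ∀ c ∈ W, c ∉ VH → ∃ y ∈ VH, ReflTransGen E y c)
    (hto : ∀ c ∈ W, c ∉ VH → ∃ z ∈ VH, ReflTransGen E c z)
    (c₀ : ℕ) (h₀ : c₀ ∈ W) (h₀' : c₀ ∉ VH) :
    ∃ y₀ ∈ VH, ReflTransGen E y₀ c₀ ∧
      ∀ d, ReflTransGen (fun a b => (R a b ∨ R b a) ∧ b ∈ W ∧ b ≠ y₀) c₀ d → d ∉ VH := by
  obtain ⟨y₀, hy₀, hr⟩ := hfrom c₀ h₀ h₀'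
  refine ⟨y₀, hy₀, hr, fun d hd => ?_⟩
  suffices d ∈ W ∧ d ∉ VH ∧ ReflTransGen E y₀ d from this.2.1
  induction hd with
  | refl => exact ⟨h₀, h₀', hr⟩
  | @tail c d _ h ih =>
    obtain ⟨hcW, hcH, hcr⟩ := ih
    obtain ⟨hR, hdW, hdy⟩ := h
    rcases hR with hR | hR
    · have hE := hRE _ _ hR hcW hdW (Or.inl hcH)
      refine ⟨hdW, fun hdH => hdy ?_, hcr.tail hE⟩
      exact (noear _ hy₀ _ hdH (hcr.tail hE)).symm
    · have hE := hRE _ _ hR hdW hcW (Or.inr hcH)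
      obtain ⟨z, hz, hcz⟩ := hto c hcW hcH
      have hzy := noear _ hy₀ _ hz (hcr.trans hcz)
      subst hzy
      have hdH : d ∉ VH := fun hdH => hdy (noear _ hdH _ hz (hcz.head hE))
      refine ⟨hdW, hdH, ?_⟩
      obtain ⟨y', hy', hyd⟩ := hfrom d hdW hdH
      have := noear _ hy' _ hz ((hyd.tail hE).trans hcz)
      exact this ▸ hyd

/-! ### The working hypotheses -/

structure Good (k : ℕ) (V : Finset ℕ) (F : Finset (ℕ × ℕ)) : Prop where
  wf : ∀ a b, (a, b) ∈ F → a ∈ V ∧ b ∈ V ∧ a ≠ b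
  ncol : ¬ Col k F
  hcut : ∀ y ∈ V, ∀ z ∈ V, y ≠ z → ∃ Y : Set ℕ, y ∈ Y ∧ z ∉ Y ∧ (cut F Y).card ≤ k
  strong : ∀ y ∈ V, ∀ z ∈ V, ReflTransGen (fun a b => (a, b) ∈ F) y z
  bic : ∀ x ∈ V, ∀ y ∈ V, ∀ z ∈ V, y ≠ x → z ≠ x →
    ReflTransGen (fun a b => ((a, b) ∈ F ∨ (b, a) ∈ F) ∧ b ≠ x) y z

def rev (F : Finset (ℕ × ℕ)) : Finset (ℕ × ℕ) := F.map (Equiv.prodComm ℕ ℕ).toEmbedding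

lemma mem_rev {F : Finset (ℕ × ℕ)} {a b : ℕ} : (a, b) ∈ rev F ↔ (b, a) ∈ F := by
  simp [rev]

lemma rev_rev (F : Finset (ℕ × ℕ)) : rev (rev F) = F := by
  ext ⟨a, b⟩; simp [mem_rev]

lemma Col.rev {k : ℕ} {F : Finset (ℕ × ℕ)} (h : Col k F) : Col k (rev F) := by
  obtain ⟨φ, hφ⟩ := h
  refine ⟨φ, fun v hv => hφ v ?_⟩
  rw [← transGen_swap]
  refine TransGen.mono ?_ _ _ hv
  rintro a b ⟨h1, h2⟩
  exact ⟨mem_rev.1 h1, h2.symm⟩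

lemma cut_rev (F : Finset (ℕ × ℕ)) (Y : Set ℕ) : (cut (rev F) Yᶜ).card = (cut F Y).card := by
  have : cut (rev F) Yᶜ = rev (cut F Y) := by
    ext ⟨a, b⟩
    simp only [mem_rev, mem_cut, Set.mem_compl_iff, not_not]
    tauto
  rw [this, rev, Finset.card_map]

lemma Good.rev {k : ℕ} {V : Finset ℕ} {F : Finset (ℕ × ℕ)} (h : Good k V F) :
    Good k V (rev F) where
  wf a b hab := by
    have := h.wf _ _ (mem_rev.1 hab)
    exact ⟨this.2.1, this.1, this.2.2.symm⟩
  ncol hc := h.ncol (by simpa [rev_rev] using hc.rev)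
  hcut y hy z hz hyz := by
    obtain ⟨Y, h1, h2, h3⟩ := h.hcut z hz y hy hyz.symm
    exact ⟨Yᶜ, h2, by simpa using h1, by rwa [cut_rev]⟩
  strong y hy z hz := by
    rw [← reflTransGen_swap]
    refine ReflTransGen.mono ?_ _ _ (h.strong z hz y hy)
    intro a b hab
    exact mem_rev.2 hab
  bic x hx y hy z hz hyx hzx := by
    refine ReflTransGen.mono ?_ _ _ (h.bic x hx y hy z hz hyx hzx)
    rintro a b ⟨h1, h2⟩
    exact ⟨by rw [mem_rev, mem_rev]; exact h1.symm, h2⟩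

end HJ

namespace HJ

open Relation Classical

/-- Subdigraphs missing a vertex are `k`-colourable. -/
lemma Good.sub_col {k : ℕ} (hk : 1 ≤ k) {V : Finset ℕ} {F : Finset (ℕ × ℕ)} (h : Good k V F)
    (F' : Finset (ℕ × ℕ)) (hF' : F' ⊆ F) (c₀ : ℕ) (hc₀ : c₀ ∈ V) (hc₀' : c₀ ∉ VV F') :
    Col k F' := by
  by_contra hcol
  obtain ⟨H, hHF', hH⟩ := exists_crit hcol
  have hHF := hHF'.trans hF'
  have hHV : ∀ v ∈ VV H, v ∈ V := by
    rintro v ⟨⟨a, b⟩, ha, rfl | rfl⟩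
    · exact (h.wf _ _ (hHF ha)).1
    · exact (h.wf _ _ (hHF ha)).2.1
  have hc₀H : c₀ ∉ VV H := fun ⟨a, ha, h⟩ => hc₀' ⟨a, hHF' ha, h⟩
  obtain ⟨⟨p, q⟩, hpq⟩ : H.Nonempty := by
    rw [Finset.nonempty_iff_ne_empty]
    rintro rfl
    apply hH.1
    refine ⟨fun _ => ⟨0, by omega⟩, ?_⟩
    intro v hv
    rw [TransGen.head'_iff] at hv
    obtain ⟨_, hv, _⟩ := hv
    simpa using hv.1
  have hpH : p ∈ VV H := ⟨_, hpq, Or.inl rfl⟩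
  have hqH : q ∈ VV H := ⟨_, hpq, Or.inr rfl⟩
  have hpq' := (h.wf _ _ (hHF hpq)).2.2
  set E : ℕ → ℕ → Prop := fun a b => (a, b) ∈ F ∧ (a, b) ∉ H with hE
  have hEl : ∀ a b, (a, b) ∈ F → (a ∉ VV H ∨ b ∉ VV H) → E a b := by
    intro a b hab hor
    refine ⟨hab, fun hin => ?_⟩
    rcases hor with h1 | h1
    · exact h1 ⟨_, hin, Or.inl rfl⟩
    · exact h1 ⟨_, hin, Or.inr rfl⟩
  obtain ⟨y₀, hy₀, _, hno⟩ := ear (V : Set ℕ) (VV H) (fun a b => (a, b) ∈ F) E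
    (fun a b hab _ _ => hEl a b hab)
    (by
      intro y hy z hz hyz
      by_contra hne
      obtain ⟨Y, hyY, hzY, hcard⟩ := h.hcut y (hHV y hy) z (hHV z hz) hne
      have h1 := hH.cut_le hk Y y z hy hyY hz hzY
      have hsub : cut H Y ⊆ cut F Y := fun a ha => by
        rw [mem_cut] at ha ⊢; exact ⟨hHF ha.1, ha.2⟩
      have heq := Finset.eq_of_subset_of_card_le hsub (hcard.trans h1)
      obtain ⟨a, b, hab, haY, hbY⟩ := exists_leave hyz Y hyY hzY
      have : (a, b) ∈ cut F Y := mem_cut.2 ⟨hab.1, haY, hbY⟩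
      rw [← heq, mem_cut] at this
      exact hab.2 this.1)
    (by
      intro c hc hcH
      have := h.strong p (hHV p hpH) c hc
      induction this with
      | refl => exact absurd hpH hcH
      | @tail b c _ hbc ih =>
        have hbc' := hEl b c hbc (Or.inr hcH)
        by_cases hb : b ∈ VV H
        · exact ⟨b, hb, .single hbc'⟩
        · obtain ⟨y, hy, hr⟩ := ih (h.wf _ _ hbc).1 hb
          exact ⟨y, hy, hr.tail hbc'⟩)
    (by
      intro c hc hcH
      have := h.strong c hc p (hHV p hpH)
      induction this using ReflTransGen.head_induction_on with
      | refl => exact absurd hpH hcH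
      | @head c d hcd _ ih =>
        have hcd' := hEl c d hcd (Or.inl hcH)
        by_cases hd : d ∈ VV H
        · exact ⟨d, hd, .single hcd'⟩
        · obtain ⟨y, hy, hr⟩ := ih (h.wf _ _ hcd).2.1 hd
          exact ⟨y, hy, hr.head hcd'⟩)
    c₀ hc₀ hc₀H
  have hcy : c₀ ≠ y₀ := fun hh => hc₀H (hh ▸ hy₀)
  obtain ⟨r, hr, hry⟩ : ∃ r ∈ VV H, r ≠ y₀ := by
    by_cases hp : p = y₀
    · exact ⟨q, hqH, fun hq => hpq' (hp.trans hq.symm)⟩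
    · exact ⟨p, hpH, hp⟩
  refine hno r ?_ hr
  refine ReflTransGen.mono ?_ _ _ (h.bic y₀ (hHV _ hy₀) c₀ hc₀ r (hHV r hr) hcy hry)
  rintro a b ⟨hab, hb⟩
  refine ⟨hab, ?_, hb⟩
  rcases hab with hab | hab
  · exact (h.wf _ _ hab).2.1
  · exact (h.wf _ _ hab).1

lemma contract {M M' : ℕ → ℕ → Prop} (f : ℕ → ℕ) (P : ℕ → Prop)
    (hf : ∀ a b, P a → P b → f a = f b) (hB : Acyc fun a b => M a b ∧ P a ∧ P b)
    (hM' : Acyc M') (h : ∀ a b, M a b → (P a ∧ P b) ∨ M' (f a) (f b)) : Acyc M := by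
  have key : ∀ a b, TransGen M a b → TransGen M' (f a) (f b) ∨
      (f a = f b ∧ TransGen (fun a b => M a b ∧ P a ∧ P b) a b) := by
    intro a b hab
    induction hab with
    | single hs =>
      rcases h _ _ hs with h1 | h1
      · exact Or.inr ⟨hf _ _ h1.1 h1.2, .single ⟨hs, h1⟩⟩
      · exact Or.inl (.single h1)
    | tail _ hs ih =>
      rcases h _ _ hs with h1 | h1
      · have h2 := hf _ _ h1.1 h1.2
        rcases ih with ih | ih
        · exact Or.inl (h2 ▸ ih)
        · exact Or.inr ⟨ih.1.trans h2, ih.2.tail ⟨hs, h1⟩⟩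
      · rcases ih with ih | ih
        · exact Or.inl (ih.tail h1)
        · exact Or.inl (ih.1 ▸ .single h1)
  intro v hv
  rcases key v v hv with h1 | h1
  · exact hM' _ h1
  · exact hB _ h1.2

/-- Arcs of `F` inside `A ∪ {x}`. -/
def part (F : Finset (ℕ × ℕ)) (x : ℕ) (A : Finset ℕ) : Finset (ℕ × ℕ) :=
  F.filter fun a => a.1 ∈ insert x A ∧ a.2 ∈ insert x A

lemma mem_part {F : Finset (ℕ × ℕ)} {x : ℕ} {A : Finset ℕ} {a b : ℕ} :
    (a, b) ∈ part F x A ↔ (a, b) ∈ F ∧ (a = x ∨ a ∈ A) ∧ (b = x ∨ b ∈ A) := by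
  simp [part]

structure Sep (k : ℕ) (V : Finset ℕ) (F : Finset (ℕ × ℕ)) (x : ℕ) (A B : Finset ℕ) : Prop where
  good : Good k V F
  hV : V = insert x (A ∪ B)
  hxA : x ∉ A
  hxB : x ∉ B
  disj : ∀ v ∈ A, v ∉ B

lemma Sep.rev {k : ℕ} {V : Finset ℕ} {F : Finset (ℕ × ℕ)} {x : ℕ} {A B : Finset ℕ}
    (h : Sep k V F x A B) : Sep k V (rev F) x A B :=
  ⟨h.good.rev, h.hV, h.hxA, h.hxB, h.disj⟩

lemma Sep.symm {k : ℕ} {V : Finset ℕ} {F : Finset (ℕ × ℕ)} {x : ℕ} {A B : Finset ℕ}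
    (h : Sep k V F x A B) : Sep k V F x B A :=
  ⟨h.good, by rw [h.hV, Finset.union_comm], h.hxB, h.hxA, fun v hv hv' => h.disj v hv' hv⟩

lemma Sep.colA {k : ℕ} (hk : 1 ≤ k) {V : Finset ℕ} {F : Finset (ℕ × ℕ)} {x : ℕ} {A B : Finset ℕ}
    (h : Sep k V F x A B) {b : ℕ} (hb : b ∈ B) : Col k (part F x A) := by
  refine h.good.sub_col hk _ (Finset.filter_subset _ _) b (by rw [h.hV]; simp [hb]) ?_
  have h1 : ¬ (b = x ∨ b ∈ A) := by
    rintro (rfl | h1)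
    · exact h.hxB hb
    · exact h.disj _ h1 hb
  rintro ⟨⟨p, q⟩, hpq, hh⟩
  rw [mem_part] at hpq
  rcases hh with rfl | rfl
  · exact h1 hpq.2.1
  · exact h1 hpq.2.2

lemma Sep.cases {k : ℕ} {V : Finset ℕ} {F : Finset (ℕ × ℕ)} {x : ℕ} {A B : Finset ℕ}
    (h : Sep k V F x A B) {a b : ℕ} (hab : (a, b) ∈ F) :
    (a, b) ∈ part F x A ∨ (a, b) ∈ part F x B ∨ (a ∈ A ∧ b ∈ B) ∨ (a ∈ B ∧ b ∈ A) := by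
  have := h.good.wf _ _ hab
  simp only [h.hV, Finset.mem_insert, Finset.mem_union] at this
  simp only [mem_part, hab, true_and]
  tauto

lemma Sep.glue {k : ℕ} {V : Finset ℕ} {F : Finset (ℕ × ℕ)} {x : ℕ} {A B : Finset ℕ}
    (h : Sep k V F x A B) (φA φB : ℕ → Fin k) (hx : φB x = φA x)
    (hB : Acyc (MM (part F x B) φB)) (M' : ℕ → ℕ → Prop) (hM' : Acyc M')
    (h1 : ∀ a b, MM (part F x A) φA a b → M' a b)
    (h2 : ∀ a b, (a, b) ∈ F → a ∈ A → b ∈ B → φA a = φB b → M' a x)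
    (h3 : ∀ a b, (a, b) ∈ F → a ∈ B → b ∈ A → φB a = φA b → M' x b) : False := by
  apply h.good.ncol
  have e1 : ∀ v, v = x ∨ v ∈ B → (if v ∈ B then φB v else φA v) = φB v := by
    rintro v (rfl | hv)
    · rw [if_neg h.hxB, hx]
    · rw [if_pos hv]
  have e2 : ∀ v, v = x ∨ v ∈ A → (if v ∈ B then φB v else φA v) = φA v := by
    rintro v (rfl | hv)
    · rw [if_neg h.hxB]
    · rw [if_neg (h.disj v hv)]
  have f2 : ∀ v, v = x ∨ v ∈ A → (if v ∈ B then x else v) = v := by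
    rintro v (rfl | hv)
    · rw [if_neg h.hxB]
    · rw [if_neg (h.disj v hv)]
  refine ⟨fun v => if v ∈ B then φB v else φA v,
    contract (M' := M') (fun v => if v ∈ B then x else v) (fun v => v = x ∨ v ∈ B) ?_ ?_ hM' ?_⟩
  · have : ∀ a, a = x ∨ a ∈ B → (if a ∈ B then x else a) = x := by
      rintro a (rfl | ha)
      · simp
      · simp [ha]
    intro a b ha hb
    simp only [this a ha, this b hb]
  · refine hB.mono ?_
    rintro a b ⟨⟨hab, hc⟩, ha, hb⟩
    simp only [e1 a ha, e1 b hb] at hc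
    exact ⟨mem_part.2 ⟨hab, ha, hb⟩, hc⟩
  · rintro a b ⟨hab, hc⟩
    rcases h.cases hab with hh | hh | hh | hh
    · right
      have hh' := mem_part.1 hh
      simp only [e2 a hh'.2.1, e2 b hh'.2.2] at hc
      simp only [f2 a hh'.2.1, f2 b hh'.2.2]
      exact h1 _ _ ⟨hh, hc⟩
    · left; exact (mem_part.1 hh).2
    · right
      simp only [e2 a (Or.inr hh.1), e1 b (Or.inr hh.2)] at hc
      simp only [f2 a (Or.inr hh.1), if_pos hh.2]
      exact h2 _ _ hab hh.1 hh.2 hc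
    · right
      simp only [e1 a (Or.inr hh.1), e2 b (Or.inr hh.2)] at hc
      simp only [f2 b (Or.inr hh.2), if_pos hh.1]
      exact h3 _ _ hab hh.1 hh.2 hc

/-- Single crossing arc `pq`: then `px` is not an arc. -/
lemma Sep.no_px {k : ℕ} (hk : 1 ≤ k) {V : Finset ℕ} {F : Finset (ℕ × ℕ)} {x : ℕ}
    {A B : Finset ℕ} (h : Sep k V F x A B) (p q : ℕ) (hp : p ∈ A) (hq : q ∈ B)
    (cAB : ∀ a b, (a, b) ∈ F → a ∈ A → b ∈ B → a = p ∧ b = q)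
    (cBA : ∀ a b, (a, b) ∈ F → a ∈ B → b ∈ A → False) : (p, x) ∉ F := by
  intro hpx
  obtain ⟨φA, hA⟩ := h.colA hk hq
  obtain ⟨φB₀, hB₀⟩ := h.symm.colA hk hp
  set π := Equiv.swap (φB₀ x) (φA x) with hπ
  have hB := acyc_perm hB₀ π π.injective
  have hx : π (φB₀ x) = φA x := Equiv.swap_apply_left _ _
  by_cases hc : φA p = π (φB₀ q) ∧ φA p ≠ φA x
  · refine h.glue φA _ hx hB _ (acyc_add hA p x ?_) (fun a b hab => Or.inl hab) ?_ ?_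
    · intro hr
      exact hc.2 (mm_color hr).symm
    · intro a b hab ha hb _
      exact Or.inr ⟨(cAB a b hab ha hb).1, rfl⟩
    · intro a b hab ha hb _
      exact (cBA a b hab ha hb).elim
  · refine h.glue φA _ hx hB _ hA (fun a b hab => hab) ?_ ?_
    · intro a b hab ha hb he
      obtain ⟨rfl, rfl⟩ := cAB a b hab ha hb
      refine ⟨mem_part.2 ⟨hpx, Or.inr ha, Or.inl rfl⟩, ?_⟩
      by_contra hne
      exact hc ⟨he, hne⟩
    · intro a b hab ha hb _
      exact (cBA a b hab ha hb).elim

lemma Sep.no_xq {k : ℕ} (hk : 1 ≤ k) {V : Finset ℕ} {F : Finset (ℕ × ℕ)} {x : ℕ}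
    {A B : Finset ℕ} (h : Sep k V F x A B) (p q : ℕ) (hp : p ∈ A) (hq : q ∈ B)
    (cAB : ∀ a b, (a, b) ∈ F → a ∈ A → b ∈ B → a = p ∧ b = q)
    (cBA : ∀ a b, (a, b) ∈ F → a ∈ B → b ∈ A → False) : (x, q) ∉ F := by
  have := h.symm.rev.no_px hk q p hq hp
    (fun a b hab ha hb => (cAB b a (mem_rev.1 hab) hb ha).symm)
    (fun a b hab ha hb => cBA b a (mem_rev.1 hab) hb ha)
  rwa [mem_rev] at this

end HJ

namespace HJ

open Relation Classical

structure Bi (k : ℕ) (V : Finset ℕ) (F : Finset (ℕ × ℕ)) (x : ℕ) (A B : Finset ℕ)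
    (t u w : ℕ) : Prop where
  sep : Sep k V F x A B
  ht : t ∈ A
  hw : w ∈ A
  hu : u ∈ B
  htu : (t, u) ∈ F
  huw : (u, w) ∈ F
  cAB : ∀ a b, (a, b) ∈ F → a ∈ A → b ∈ B → a = t ∧ b = u
  cBA : ∀ a b, (a, b) ∈ F → a ∈ B → b ∈ A → a = u ∧ b = w
  conn : ReflTransGen (fun a b => ((a, b) ∈ F ∨ (b, a) ∈ F) ∧ a ∈ A ∧ b ∈ A) t w

section

variable {k : ℕ} {V : Finset ℕ} {F : Finset (ℕ × ℕ)} {x : ℕ} {A B : Finset ℕ} {t u w : ℕ}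

lemma Bi.rev (h : Bi k V F x A B t u w) : Bi k V (rev F) x A B w u t where
  sep := h.sep.rev
  ht := h.hw
  hw := h.ht
  hu := h.hu
  htu := mem_rev.2 h.huw
  huw := mem_rev.2 h.htu
  cAB a b hab ha hb := (h.cBA b a (mem_rev.1 hab) hb ha).symm
  cBA a b hab ha hb := (h.cAB b a (mem_rev.1 hab) hb ha).symm
  conn := by
    rw [← reflTransGen_swap]
    refine ReflTransGen.mono ?_ _ _ h.conn
    rintro a b ⟨h1, h2, h3⟩
    exact ⟨by rw [mem_rev, mem_rev]; exact h1, h3, h2⟩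

lemma perm2 {p q p' q' : Fin k} (h : p ≠ q) (h' : p' ≠ q') :
    ∃ π : Equiv.Perm (Fin k), π p = p' ∧ π q = q' := by
  refine ⟨(Equiv.swap p p').trans (Equiv.swap (Equiv.swap p p' q) q'), ?_, ?_⟩
  · simp only [Equiv.trans_apply, Equiv.swap_apply_left]
    refine Equiv.swap_apply_of_ne_of_ne ?_ h'
    intro hh
    have : Equiv.swap p p' p = Equiv.swap p p' q := by rw [Equiv.swap_apply_left]; exact hh
    exact h ((Equiv.swap p p').injective this)
  · simp

lemma Bi.tx (h : Bi k V F x A B t u w) : t ≠ x := fun hh => h.sep.hxA (hh ▸ h.ht)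
lemma Bi.wx (h : Bi k V F x A B t u w) : w ≠ x := fun hh => h.sep.hxA (hh ▸ h.hw)
lemma Bi.ux (h : Bi k V F x A B t u w) : u ≠ x := fun hh => h.sep.hxB (hh ▸ h.hu)
lemma Bi.memV (h : Bi k V F x A B t u w) : x ∈ V ∧ t ∈ V ∧ w ∈ V ∧ u ∈ V := by
  simp [h.sep.hV, h.ht, h.hw, h.hu]

lemma Bi.colA (hk : 3 ≤ k) (h : Bi k V F x A B t u w) : Col k (part F x A) :=
  h.sep.colA (by omega) h.hu

lemma Bi.colB (hk : 3 ≤ k) (h : Bi k V F x A B t u w) : Col k (part F x B) :=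
  h.sep.symm.colA (by omega) h.ht

/-- In every `k`-colouring of the `B`-side, `u` and `x` get the same colour. -/
lemma Bi.same (hk : 3 ≤ k) (h : Bi k V F x A B t u w) (φB₀ : ℕ → Fin k)
    (hB₀ : Acyc (MM (part F x B) φB₀)) : φB₀ u = φB₀ x := by
  by_contra hne
  obtain ⟨φA, hA⟩ := h.colA hk
  obtain ⟨c, hc⟩ : ∃ c : Fin k, c ∉ ({φA x, φA t} : Finset (Fin k)) := by
    by_contra! hall
    have h1 : (Finset.univ : Finset (Fin k)) ⊆ {φA x, φA t} := fun s _ => hall s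
    have h2 := (Finset.card_le_card h1).trans Finset.card_le_two
    simp at h2
    omega
  simp only [Finset.mem_insert, Finset.mem_singleton, not_or] at hc
  obtain ⟨π, hπ1, hπ2⟩ := perm2 (p := φB₀ x) (q := φB₀ u) (p' := φA x) (q' := c)
    (fun hh => hne hh.symm) (fun hh => hc.1 hh.symm)
  have hB := acyc_perm hB₀ π π.injective
  have key2 : ∀ a b, (a, b) ∈ F → a ∈ A → b ∈ B → φA a = π (φB₀ b) → False := by
    intro a b hab ha hb he
    obtain ⟨rfl, rfl⟩ := h.cAB a b hab ha hb
    exact hc.2 (hπ2 ▸ he.symm)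
  by_cases hcw : φA w = c
  · refine h.sep.glue φA _ hπ1 hB _ (acyc_add hA x w ?_) (fun a b hab => Or.inl hab) ?_ ?_
    · intro hr
      exact hc.1 (hcw ▸ mm_color hr)
    · intro a b hab ha hb he
      exact (key2 a b hab ha hb he).elim
    · intro a b hab ha hb _
      exact Or.inr ⟨rfl, (h.cBA a b hab ha hb).2⟩
  · refine h.sep.glue φA _ hπ1 hB _ hA (fun a b hab => hab) ?_ ?_
    · intro a b hab ha hb he
      exact (key2 a b hab ha hb he).elim
    · intro a b hab ha hb he
      obtain ⟨rfl, rfl⟩ := h.cBA a b hab ha hb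
      exact (hcw (hπ2 ▸ he.symm)).elim

lemma Bi.nB (hk : 3 ≤ k) (h : Bi k V F x A B t u w) :
    ¬ Col k (insert (u, x) (insert (x, u) (part F x B))) := by
  rintro ⟨φ, hφ⟩
  have h1 := h.same hk φ (hφ.mono fun a b hab => ⟨by simp [hab.1], hab.2⟩)
  refine hφ u (.tail (b := x) (.single ⟨by simp, h1⟩) ⟨by simp, h1.symm⟩)

lemma Bi.nA (hk : 3 ≤ k) (h : Bi k V F x A B t u w) :
    ¬ Col k (insert (t, x) (insert (x, w) (part F x A))) := by
  rintro ⟨φA, hA⟩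
  obtain ⟨φB₀, hB₀⟩ := h.colB hk
  have h1 := h.same hk φB₀ hB₀
  set π := Equiv.swap (φB₀ x) (φA x) with hπ
  have hB := acyc_perm hB₀ π π.injective
  have hx : π (φB₀ x) = φA x := Equiv.swap_apply_left _ _
  refine h.sep.glue φA _ hx hB _ hA (fun a b hab => ⟨by simp [hab.1], hab.2⟩) ?_ ?_
  · intro a b hab ha hb he
    obtain ⟨rfl, rfl⟩ := h.cAB a b hab ha hb
    exact ⟨by simp, by rw [he, h1, hx]⟩
  · intro a b hab ha hb he
    obtain ⟨rfl, rfl⟩ := h.cBA a b hab ha hb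
    exact ⟨by simp, by rw [← he, h1, hx]⟩

lemma Bi.not_both {a b : ℕ} (h : Bi k V F x A B t u w) (h1 : (a, b) ∈ part F x A)
    (h2 : (a, b) ∈ part F x B) : False := by
  rw [mem_part] at h1 h2
  have h3 := (h.sep.good.wf _ _ h1.1).2.2
  have h4 := h.sep.disj a
  have h5 := h.sep.disj b
  rcases h1 with ⟨_, rfl | ha, rfl | hb⟩
  · exact h3 rfl
  · rcases h2.2.2 with rfl | hb'
    · exact h3 rfl
    · exact h5 hb hb'
  · rcases h2.2.1 with rfl | hb'
    · exact h3 rfl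
    · exact h4 ha hb'
  · rcases h2.2.1 with rfl | hb'
    · exact h.sep.hxA ha
    · exact h4 ha hb'

lemma Bi.no_ux (hk : 3 ≤ k) (h : Bi k V F x A B t u w) : (u, x) ∉ F := by
  intro hux
  have hdj := h.sep.disj
  obtain ⟨HB, hHBs, hHB⟩ := exists_crit (h.nB hk)
  obtain ⟨HA, hHAs, hHA⟩ := exists_crit (h.nA hk)
  have huxB : (u, x) ∈ part F x B := mem_part.2 ⟨hux, Or.inr h.hu, Or.inl rfl⟩
  have hxu : (x, u) ∈ HB := by
    by_contra hn
    apply hHB.1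
    refine (h.colB hk).mono fun a ha => ?_
    have := hHBs ha
    simp only [Finset.mem_insert] at this
    rcases this with rfl | rfl | this
    · exact huxB
    · exact absurd ha hn
    · exact this
  obtain ⟨Y, huY, hxY, hcard⟩ := h.sep.good.hcut u h.memV.2.2.2 x h.memV.1 h.ux
  have h1 := hHB.cut_le (by omega) Y u x ⟨_, hxu, Or.inr rfl⟩ huY ⟨_, hxu, Or.inl rfl⟩ hxY
  have h2 : cut HB Y ⊆ part F x B := by
    intro a ha
    rw [mem_cut] at ha
    have := hHBs ha.1
    simp only [Finset.mem_insert] at this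
    rcases this with rfl | rfl | this
    · exact huxB
    · exact absurd ha.2.1 hxY
    · exact this
  have h3 : cut HB Y ⊆ cut F Y := by
    intro a ha
    have := h2 ha
    rw [mem_cut] at ha ⊢
    exact ⟨(Finset.mem_filter.1 this).1, ha.2⟩
  have h4 := Finset.eq_of_subset_of_card_le h3 (hcard.trans h1)
  -- every arc leaving `Y` lies in the `B` part
  have h5 : ∀ a b, (a, b) ∈ F → a ∈ Y → b ∉ Y → (a, b) ∈ part F x B := by
    intro a b hab ha hb
    apply h2
    rw [h4]
    exact mem_cut.2 ⟨hab, ha, hb⟩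
  have h6 : ∀ a, a ∈ A → ¬ (a = x ∨ a ∈ B) := by
    rintro a ha (rfl | hb)
    · exact h.sep.hxA ha
    · exact hdj a ha hb
  have hwY : w ∈ Y := by
    by_contra hwY
    exact h6 w h.hw (mem_part.1 (h5 u w h.huw huY hwY)).2.2
  have htY : t ∈ Y := by
    by_contra htY
    obtain ⟨a, b, hab, ⟨haY, haA⟩, hb⟩ := exists_leave (h.sep.good.strong w h.memV.2.2.1 x h.memV.1)
      (Y ∩ A) ⟨hwY, h.hw⟩ (fun hh => hxY hh.1)
    by_cases hbY : b ∈ Y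
    · have hbA : b ∉ A := fun hbA => hb ⟨hbY, hbA⟩
      rcases h.sep.cases hab with hh | hh | hh | hh
      · rcases (mem_part.1 hh).2.2 with rfl | hh
        · exact hxY hbY
        · exact hbA hh
      · exact h6 a haA (mem_part.1 hh).2.1
      · exact htY ((h.cAB a b hab hh.1 hh.2).1 ▸ haY)
      · exact hbA hh.2
    · exact h6 a haA (mem_part.1 (h5 a b hab haY hbY)).2.1
  have h7 : x ∈ VV HA ∧ ∃ y ∈ VV HA, y ∈ Y := by
    by_cases ha : (t, x) ∈ HA
    · exact ⟨⟨_, ha, Or.inr rfl⟩, t, ⟨_, ha, Or.inl rfl⟩, htY⟩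
    by_cases hb : (x, w) ∈ HA
    · exact ⟨⟨_, hb, Or.inl rfl⟩, w, ⟨_, hb, Or.inr rfl⟩, hwY⟩
    exfalso
    apply hHA.1
    refine (h.colA hk).mono fun a ha' => ?_
    have := hHAs ha'
    simp only [Finset.mem_insert] at this
    rcases this with rfl | rfl | this
    · exact absurd ha' ha
    · exact absurd ha' hb
    · exact this
  obtain ⟨hxHA, y, hyHA, hyY⟩ := h7
  have h8 := hHA.cut_le (by omega) Y y x hyHA hyY hxHA hxY
  obtain ⟨⟨a, b⟩, ha, hne⟩ := Finset.exists_mem_ne (s := cut HA Y) (by omega) (t, x)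
  rw [mem_cut] at ha
  have := hHAs ha.1
  simp only [Finset.mem_insert] at this
  rcases this with h9 | h9 | h9
  · exact hne h9
  · simp only [Prod.mk.injEq] at h9
    exact hxY (h9.1 ▸ ha.2.1)
  · exact h.not_both h9 (h5 a b (mem_part.1 h9).1 ha.2.1 ha.2.2)

lemma Bi.no_tx (hk : 3 ≤ k) (h : Bi k V F x A B t u w) : (t, x) ∉ F := by
  intro htx
  have hdj := h.sep.disj
  have h6 : ∀ a, a ∈ A → ¬ (a = x ∨ a ∈ B) := by
    rintro a ha (rfl | hb)
    · exact h.sep.hxA ha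
    · exact hdj a ha hb
  have h6' : ∀ a, a ∈ B → ¬ (a = x ∨ a ∈ A) := by
    rintro a ha (rfl | hb)
    · exact h.sep.hxB ha
    · exact hdj a hb ha
  obtain ⟨HB, hHBs, hHB⟩ := exists_crit (h.nB hk)
  obtain ⟨HA, hHAs, hHA⟩ := exists_crit (h.nA hk)
  have htxA : (t, x) ∈ part F x A := mem_part.2 ⟨htx, Or.inr h.ht, Or.inl rfl⟩
  have hHAs' : ∀ e ∈ HA, e ≠ (x, w) → e ∈ part F x A := by
    intro e he hne
    have := hHAs he
    simp only [Finset.mem_insert] at this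
    rcases this with rfl | rfl | this
    · exact htxA
    · exact absurd rfl hne
    · exact this
  have hxw : (x, w) ∈ HA := by
    by_contra hn
    apply hHA.1
    exact (h.colA hk).mono fun a ha => hHAs' a ha (fun hh => hn (hh ▸ ha))
  have hxHA : x ∈ VV HA := ⟨_, hxw, Or.inl rfl⟩
  have hwHA : w ∈ VV HA := ⟨_, hxw, Or.inr rfl⟩
  have hHAV : ∀ v ∈ VV HA, v ∈ V := by
    rintro v ⟨⟨a, b⟩, hab, hv⟩
    by_cases he : (a, b) = (x, w)
    · simp only [Prod.mk.injEq] at he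
      obtain ⟨rfl, rfl⟩ := he
      rcases hv with rfl | rfl
      · exact h.memV.1
      · exact h.memV.2.2.1
    · have := h.sep.good.wf _ _ (mem_part.1 (hHAs' _ hab he)).1
      rcases hv with rfl | rfl
      · exact this.1
      · exact this.2.1
  have hHBx : x ∈ VV HB ∧ u ∈ VV HB := by
    by_cases ha : (u, x) ∈ HB
    · exact ⟨⟨_, ha, Or.inr rfl⟩, ⟨_, ha, Or.inl rfl⟩⟩
    by_cases hb : (x, u) ∈ HB
    · exact ⟨⟨_, hb, Or.inl rfl⟩, ⟨_, hb, Or.inr rfl⟩⟩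
    exfalso
    apply hHB.1
    refine (h.colB hk).mono fun a ha' => ?_
    have := hHBs ha'
    simp only [Finset.mem_insert] at this
    rcases this with rfl | rfl | this
    · exact absurd ha' ha
    · exact absurd ha' hb
    · exact this
  -- any set separating `u` and `x` has a leaving arc in the `B` part
  have hBarc : ∀ Y : Set ℕ, (u ∈ Y ∧ x ∉ Y) ∨ (x ∈ Y ∧ u ∉ Y) →
      ∃ a b, (a, b) ∈ part F x B ∧ a ∈ Y ∧ b ∉ Y := by
    intro Y hY
    rcases hY with hY | hY
    · have h8 := hHB.cut_le (by omega) Y u x hHBx.2 hY.1 hHBx.1 hY.2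
      obtain ⟨⟨a, b⟩, ha, hne⟩ := Finset.exists_mem_ne (s := cut HB Y) (by omega) (u, x)
      rw [mem_cut] at ha
      have := hHBs ha.1
      simp only [Finset.mem_insert] at this
      rcases this with h9 | h9 | h9
      · exact absurd h9 hne
      · simp only [Prod.mk.injEq] at h9
        exact absurd (h9.1 ▸ ha.2.1) hY.2
      · exact ⟨a, b, h9, ha.2⟩
    · have h8 := hHB.cut_le (by omega) Y x u hHBx.1 hY.1 hHBx.2 hY.2
      obtain ⟨⟨a, b⟩, ha, hne⟩ := Finset.exists_mem_ne (s := cut HB Y) (by omega) (x, u)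
      rw [mem_cut] at ha
      have := hHBs ha.1
      simp only [Finset.mem_insert] at this
      rcases this with h9 | h9 | h9
      · simp only [Prod.mk.injEq] at h9
        exact absurd (h9.1 ▸ ha.2.1) hY.2
      · exact absurd h9 hne
      · exact ⟨a, b, h9, ha.2⟩
  by_cases htHA : t ∈ VV HA
  · obtain ⟨Y, htY, hxY, hcard⟩ := h.sep.good.hcut t h.memV.2.1 x h.memV.1 h.tx
    have h1 := hHA.cut_le (by omega) Y t x htHA htY hxHA hxY
    have h2 : cut HA Y ⊆ part F x A := by
      intro a ha
      rw [mem_cut] at ha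
      exact hHAs' a ha.1 (fun hh => hxY (by rw [hh] at ha; exact ha.2.1))
    have h3 : cut HA Y ⊆ cut F Y := by
      intro a ha
      have := h2 ha
      rw [mem_cut] at ha ⊢
      exact ⟨(Finset.mem_filter.1 this).1, ha.2⟩
    have h4 := Finset.eq_of_subset_of_card_le h3 (hcard.trans h1)
    have h5 : ∀ a b, (a, b) ∈ F → a ∈ Y → b ∉ Y → (a, b) ∈ part F x A := by
      intro a b hab ha hb
      apply h2
      rw [h4]
      exact mem_cut.2 ⟨hab, ha, hb⟩
    have huY : u ∈ Y := by
      by_contra huY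
      exact h6' u h.hu (mem_part.1 (h5 t u h.htu htY huY)).2.2
    obtain ⟨a, b, hab, haY, hbY⟩ := hBarc Y (Or.inl ⟨huY, hxY⟩)
    exact h.not_both (h5 a b (mem_part.1 hab).1 haY hbY) hab
  · set E : ℕ → ℕ → Prop := fun a b => (a, b) ∈ part F x A ∧ (a, b) ∉ HA with hE
    have hEl : ∀ a b, (a, b) ∈ part F x A → (a ∉ VV HA ∨ b ∉ VV HA) → E a b := by
      intro a b hab hor
      refine ⟨hab, fun hin => ?_⟩
      rcases hor with h1 | h1
      · exact h1 ⟨_, hin, Or.inl rfl⟩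
      · exact h1 ⟨_, hin, Or.inr rfl⟩
    have noear : ∀ y ∈ VV HA, ∀ z ∈ VV HA, ReflTransGen E y z → y = z := by
      intro y hy z hz hyz
      by_contra hne
      obtain ⟨Y, hyY, hzY, hcard⟩ := h.sep.good.hcut y (hHAV y hy) z (hHAV z hz) hne
      have h1 := hHA.cut_le (by omega) Y y z hy hyY hz hzY
      obtain ⟨a, b, hab, haY, hbY⟩ := exists_leave hyz Y hyY hzY
      have hm : (a, b) ∈ cut F Y := mem_cut.2 ⟨(mem_part.1 hab.1).1, haY, hbY⟩
      have hsub : (cut HA Y).erase (x, w) ⊆ cut F Y := by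
        intro e he
        rw [Finset.mem_erase, mem_cut] at he
        rw [mem_cut]
        exact ⟨(Finset.mem_filter.1 (hHAs' e he.2.1 he.1)).1, he.2.2⟩
      have hnot : (a, b) ∉ (cut HA Y).erase (x, w) := by
        rw [Finset.mem_erase, mem_cut]
        exact fun hh => hab.2 hh.2.1
      by_cases hxwY : (x, w) ∈ cut HA Y
      · have hxY : x ∈ Y := (mem_cut.1 hxwY).2.1
        have hwY : w ∉ Y := (mem_cut.1 hxwY).2.2
        -- one more arc outside the `A` part
        obtain ⟨c, d, hcd, hcdA⟩ : ∃ c d, (c, d) ∈ cut F Y ∧ (c, d) ∉ part F x A := by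
          by_cases huY : u ∈ Y
          · refine ⟨u, w, mem_cut.2 ⟨h.huw, huY, hwY⟩, fun hh => ?_⟩
            exact h6' u h.hu (mem_part.1 hh).2.1
          · obtain ⟨c, d, hcd, hc, hd⟩ := hBarc Y (Or.inr ⟨hxY, huY⟩)
            exact ⟨c, d, mem_cut.2 ⟨(mem_part.1 hcd).1, hc, hd⟩, fun hh => h.not_both hh hcd⟩
        have hs : insert (c, d) (insert (a, b) ((cut HA Y).erase (x, w))) ⊆ cut F Y :=
          Finset.insert_subset hcd (Finset.insert_subset hm hsub)
        have hcc := Finset.card_le_card hs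
        rw [Finset.card_insert_of_notMem, Finset.card_insert_of_notMem hnot,
          Finset.card_erase_of_mem hxwY] at hcc
        · omega
        · rw [Finset.mem_insert, not_or]
          refine ⟨fun hh => hcdA (hh ▸ hab.1), fun hh => hcdA ?_⟩
          rw [Finset.mem_erase, mem_cut] at hh
          exact hHAs' _ hh.2.1 hh.1
      · rw [Finset.erase_eq_of_notMem hxwY] at hsub hnot
        have hcc := Finset.card_le_card (Finset.insert_subset hm hsub)
        rw [Finset.card_insert_of_notMem hnot] at hcc
        omega
    obtain ⟨y₀, hy₀, hr₀, hno⟩ := ear (A : Set ℕ) (VV HA) (fun a b => (a, b) ∈ F) E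
      (fun a b hab ha hb => hEl a b (mem_part.2 ⟨hab, Or.inr ha, Or.inr hb⟩))
      noear
      (by
        intro c hc hcH
        have hc' : c ∈ A := hc
        have := h.sep.good.strong x h.memV.1 c (by simp [h.sep.hV, hc'])
        clear hc
        induction this with
        | refl => exact absurd hxHA hcH
        | @tail b c _ hbc ih =>
          have hb : b = x ∨ b ∈ A := by
            rcases h.sep.cases hbc with hh | hh | hh | hh
            · exact (mem_part.1 hh).2.1
            · exact absurd (mem_part.1 hh).2.2 (h6 c hc')
            · exact Or.inr hh.1
            · exact absurd ((h.cBA b c hbc hh.1 hh.2).2 ▸ hwHA) hcH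
          have hbc' := hEl b c (mem_part.2 ⟨hbc, hb, Or.inr hc'⟩) (Or.inr hcH)
          by_cases hbH : b ∈ VV HA
          · exact ⟨b, hbH, .single hbc'⟩
          · rcases hb with rfl | hb
            · exact absurd hxHA hbH
            · obtain ⟨y, hy, hr⟩ := ih hbH hb
              exact ⟨y, hy, hr.tail hbc'⟩)
      (by
        intro c hc hcH
        have hc' : c ∈ A := hc
        have := h.sep.good.strong c (by simp [h.sep.hV, hc']) x h.memV.1
        clear hc
        induction this using ReflTransGen.head_induction_on with
        | refl => exact absurd hxHA hcH
        | @head c d hcd _ ih =>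
          by_cases hct : c = t
          · subst hct
            exact ⟨x, hxHA, .single (hEl _ _ htxA (Or.inl hcH))⟩
          have hd : d = x ∨ d ∈ A := by
            rcases h.sep.cases hcd with hh | hh | hh | hh
            · exact (mem_part.1 hh).2.2
            · exact absurd (mem_part.1 hh).2.1 (h6 c hc')
            · exact absurd (h.cAB c d hcd hh.1 hh.2).1 hct
            · exact Or.inr hh.2
          have hcd' := hEl c d (mem_part.2 ⟨hcd, Or.inr hc', hd⟩) (Or.inl hcH)
          by_cases hdH : d ∈ VV HA
          · exact ⟨d, hdH, .single hcd'⟩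
          · rcases hd with rfl | hd
            · exact absurd hxHA hdH
            · obtain ⟨y, hy, hr⟩ := ih hdH hd
              exact ⟨y, hy, hr.head hcd'⟩)
      t h.ht htHA
    have hy₀x : y₀ = x := noear y₀ hy₀ x hxHA (hr₀.tail (hEl _ _ htxA (Or.inl htHA)))
    subst hy₀x
    refine hno w ?_ hwHA
    refine ReflTransGen.mono ?_ _ _ h.conn
    rintro a b ⟨h1, _, h3⟩
    exact ⟨h1, h3, fun hh => h.sep.hxA (hh ▸ h3)⟩

lemma Bi.no_xu (hk : 3 ≤ k) (h : Bi k V F x A B t u w) : (x, u) ∉ F := by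
  have := h.rev.no_ux hk
  rwa [mem_rev] at this

lemma Bi.no_xw (hk : 3 ≤ k) (h : Bi k V F x A B t u w) : (x, w) ∉ F := by
  have := h.rev.no_tx hk
  rwa [mem_rev] at this

end

end HJ

namespace HJ

open Relation Classical Dgraph

lemma renArc_self (x : ℕ) (a : ℕ × ℕ) : renArc x x a = a := by
  obtain ⟨a, b⟩ := a
  simp only [renArc, ren, Prod.mk.injEq]
  constructor <;> split_ifs with h <;> simp_all

lemma renArc_fix {m x : ℕ} {a : ℕ × ℕ} (h1 : a.1 ≠ m) (h2 : a.2 ≠ m) : renArc m x a = a := by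
  obtain ⟨a, b⟩ := a
  simp_all [renArc, ren]

lemma renArc_back {m x : ℕ} {a : ℕ × ℕ} (h1 : a.1 ≠ m) (h2 : a.2 ≠ m) :
    renArc m x (renArc x m a) = a := by
  obtain ⟨a, b⟩ := a
  simp only [renArc, ren, Prod.mk.injEq] at *
  constructor <;> split_ifs <;> simp_all

lemma image_back {F : Finset (ℕ × ℕ)} {x m : ℕ} {P Q : Finset (ℕ × ℕ)}
    (hP : P ⊆ F) (hQ : Q ⊆ F) (hm : ∀ a ∈ F, a.1 ≠ m ∧ a.2 ≠ m) :
    ((P ∪ Q.image (renArc x m)).image fun a => renArc m x (renArc x x a)) = P ∪ Q := by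
  ext a
  simp only [Finset.mem_image, Finset.mem_union, renArc_self]
  constructor
  · rintro ⟨b, hb | ⟨c, hc, rfl⟩, rfl⟩
    · rw [renArc_fix (hm _ (hP hb)).1 (hm _ (hP hb)).2]; exact Or.inl hb
    · rw [renArc_back (hm _ (hQ hc)).1 (hm _ (hQ hc)).2]; exact Or.inr hc
  · rintro (h | h)
    · exact ⟨a, Or.inl h, renArc_fix (hm _ (hP h)).1 (hm _ (hP h)).2⟩
    · exact ⟨_, Or.inr ⟨a, h, rfl⟩, renArc_back (hm _ (hQ h)).1 (hm _ (hQ h)).2⟩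

/-- A bundle of facts on the two sides of a separation. -/
lemma Sep.sides {k : ℕ} {V : Finset ℕ} {F : Finset (ℕ × ℕ)} {x : ℕ} {A B : Finset ℕ}
    (h : Sep k V F x A B) :
    ∃ m, m ∉ V ∧ (∀ a ∈ F, a.1 ≠ m ∧ a.2 ≠ m) ∧
      (∀ a ∈ part F x A, a.1 ∈ insert x A ∧ a.2 ∈ insert x A ∧ a.1 ≠ a.2) ∧
      (∀ a ∈ (part F x B).image (renArc x m),
        a.1 ∈ insert m B ∧ a.2 ∈ insert m B ∧ a.1 ≠ a.2) ∧
      Disjoint (insert x A) (insert m B) ∧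
      x ∉ ((insert x A).erase x) ∪ ((insert m B).erase m) ∧
      V = insert x (((insert x A).erase x) ∪ ((insert m B).erase m)) ∧
      (∀ b, (b, m) ∈ (part F x B).image (renArc x m) → (b, x) ∈ F) ∧
      (∀ b, (m, b) ∈ (part F x B).image (renArc x m) → (x, b) ∈ F) := by
  obtain ⟨m, hm⟩ := Infinite.exists_notMem_finset V
  have hVm : ∀ v ∈ V, v ≠ m := fun v hv e => hm (e ▸ hv)
  have hFm : ∀ a ∈ F, a.1 ≠ m ∧ a.2 ≠ m := fun a ha =>
    ⟨hVm _ (h.good.wf a.1 a.2 ha).1, hVm _ (h.good.wf a.1 a.2 ha).2.1⟩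
  have hmV : m ∉ insert x (A ∪ B) := h.hV ▸ hm
  simp only [Finset.mem_insert, Finset.mem_union, not_or] at hmV
  obtain ⟨hmx, hmA, hmB⟩ := hmV
  refine ⟨m, hm, hFm, ?_, ?_, ?_, ?_, ?_, ?_, ?_⟩
  · rintro ⟨a, b⟩ hab
    rw [mem_part] at hab
    simp only [Finset.mem_insert]
    exact ⟨hab.2.1, hab.2.2, (h.good.wf _ _ hab.1).2.2⟩
  · rintro c hc
    obtain ⟨⟨a, b⟩, hab, rfl⟩ := Finset.mem_image.1 hc
    rw [mem_part] at hab
    have h3 := (h.good.wf _ _ hab.1).2.2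
    have h4 := hFm _ hab.1
    have hxB := h.hxB
    obtain ⟨_, h1, h2⟩ := hab
    simp only [Finset.mem_insert, renArc, ren]
    simp only at h4
    refine ⟨?_, ?_, ?_⟩
    · split_ifs with e
      · simp
      · exact Or.inr (h1.resolve_left e)
    · split_ifs with e
      · simp
      · exact Or.inr (h2.resolve_left e)
    · split_ifs with e1 e2 e2
      · exact absurd (e1.trans e2.symm) h3
      · exact h4.2.symm
      · exact h4.1
      · exact h3
  · rw [Finset.disjoint_left]
    intro v hv hv'
    rw [Finset.mem_insert] at hv hv'
    rcases hv with rfl | hv <;> rcases hv' with rfl | hv'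
    · exact hmx rfl
    · exact h.hxB hv'
    · exact hmA hv
    · exact h.disj v hv hv'
  · rw [Finset.erase_insert h.hxA, Finset.erase_insert hmB]
    simp [h.hxA, h.hxB]
  · rw [Finset.erase_insert h.hxA, Finset.erase_insert hmB]
    exact h.hV
  · intro b hb
    obtain ⟨⟨c, d⟩, hcd, e⟩ := Finset.mem_image.1 hb
    rw [mem_part] at hcd
    have h4 := hFm _ hcd.1
    simp only [renArc, ren, Prod.mk.injEq] at e h4
    obtain ⟨e1, e2⟩ := e
    have hd : d = x := by
      by_contra hd
      rw [if_neg hd] at e2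
      exact h4.2 e2
    have h5 := (h.good.wf _ _ hcd.1).2.2
    have hc : c ≠ x := fun e => h5 (e.trans hd.symm)
    rw [if_neg hc] at e1
    subst e1 hd
    exact hcd.1
  · intro b hb
    obtain ⟨⟨c, d⟩, hcd, e⟩ := Finset.mem_image.1 hb
    rw [mem_part] at hcd
    have h4 := hFm _ hcd.1
    simp only [renArc, ren, Prod.mk.injEq] at e h4
    obtain ⟨e1, e2⟩ := e
    have hc : c = x := by
      by_contra hc
      rw [if_neg hc] at e1
      exact h4.1 e1
    have h5 := (h.good.wf _ _ hcd.1).2.2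
    have hd : d ≠ x := fun e => h5 (hc.trans e.symm)
    rw [if_neg hd] at e2
    subst e2 hc
    exact hcd.1

lemma part_sub {F : Finset (ℕ × ℕ)} {x : ℕ} {A : Finset ℕ} : part F x A ⊆ F := by
  rintro ⟨a, b⟩ h
  exact (mem_part.1 h).1

lemma join_one {k : ℕ} (hk : 1 ≤ k) {D : Dgraph} {x : ℕ} {A B : Finset ℕ}
    (h : Sep k D.verts D.arcs x A B) (p q : ℕ) (hp : p ∈ A) (hq : q ∈ B) (hpq : (p, q) ∈ D.arcs)
    (cAB : ∀ a b, (a, b) ∈ D.arcs → a ∈ A → b ∈ B → a = p ∧ b = q)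
    (cBA : ∀ a b, (a, b) ∈ D.arcs → a ∈ B → b ∈ A → False) :
    ∃ D1 D2, IsDirHajosJoin D D1 D2 := by
  have h1 := Sep.no_px hk h p q hp hq cAB cBA
  have h2 := Sep.no_xq hk h p q hp hq cAB cBA
  obtain ⟨m, hm, hFm, wA, wB, hdis, hx, hV, hbm, hmb⟩ := h.sides
  have hqm : q ≠ m := (hFm _ hpq).2
  have hpx : p ≠ x := fun e => h.hxA (e ▸ hp)
  refine ⟨⟨insert x A, insert (p, x) (part D.arcs x A)⟩,
    ⟨insert m B, insert (m, q) ((part D.arcs x B).image (renArc x m))⟩, p, x, m, q, x,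
    ?_, ?_, hdis, by simp, by simp, hx, hV, ?_⟩
  · intro a ha
    rcases Finset.mem_insert.1 ha with rfl | ha
    · simp [hp, hpx]
    · exact wA a ha
  · intro a ha
    rcases Finset.mem_insert.1 ha with rfl | ha
    · simp [hq, hqm.symm]
    · exact wB a ha
  · simp only
    rw [Finset.erase_insert (fun hh => h1 (part_sub hh)),
      Finset.erase_insert (fun hh => h2 (hmb _ hh)),
      image_back part_sub part_sub hFm]
    ext ⟨a, b⟩
    rw [Finset.mem_insert, Finset.mem_union]
    constructor
    · intro hab
      rcases h.cases hab with h3 | h3 | h3 | h3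
      · exact Or.inr (Or.inl h3)
      · exact Or.inr (Or.inr h3)
      · left; obtain ⟨rfl, rfl⟩ := cAB a b hab h3.1 h3.2; rfl
      · exact (cBA a b hab h3.1 h3.2).elim
    · rintro (e | e | e)
      · rw [e]; exact hpq
      · exact part_sub e
      · exact part_sub e

lemma join_two {k : ℕ} (hk : 3 ≤ k) {D : Dgraph} {x : ℕ} {A B : Finset ℕ} {t u w : ℕ}
    (h : Bi k D.verts D.arcs x A B t u w) :
    ∃ D1 D2, IsHajosBijoin D D1 D2 := by
  have n1 := Bi.no_ux hk h
  have n2 := Bi.no_tx hk h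
  have n3 := Bi.no_xu hk h
  have n4 := Bi.no_xw hk h
  obtain ⟨m, hm, hFm, wA, wB, hdis, hx, hV, hbm, hmb⟩ := h.sep.sides
  have hum : u ≠ m := (hFm _ h.htu).2
  have htx := h.tx
  have hwx := h.wx
  have sd : ∀ (S : Finset (ℕ × ℕ)) (p q : ℕ × ℕ), p ∉ S → q ∉ S →
      (insert p (insert q S)) \ {p, q} = S := by
    intro S p q hp hq
    ext a
    simp only [Finset.mem_sdiff, Finset.mem_insert, Finset.mem_singleton]
    constructor
    · tauto
    · intro ha
      refine ⟨Or.inr (Or.inr ha), ?_⟩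
      rintro (rfl | rfl)
      · exact hp ha
      · exact hq ha
  refine ⟨⟨insert x A, insert (t, x) (insert (x, w) (part D.arcs x A))⟩,
    ⟨insert m B, insert (u, m) (insert (m, u) ((part D.arcs x B).image (renArc x m)))⟩,
    t, x, w, u, m, u, x,
    ?_, ?_, hdis, by simp, by simp, by simp, by simp, ?_, ReflTransGen.refl, hx, hV, ?_⟩
  · intro a ha
    rcases Finset.mem_insert.1 ha with rfl | ha
    · simp [h.ht, htx]
    rcases Finset.mem_insert.1 ha with rfl | ha
    · simp [h.hw, hwx.symm]
    · exact wA a ha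
  · intro a ha
    rcases Finset.mem_insert.1 ha with rfl | ha
    · simp [h.hu, hum]
    rcases Finset.mem_insert.1 ha with rfl | ha
    · simp [h.hu, hum.symm]
    · exact wB a ha
  · refine ReflTransGen.mono ?_ _ _ h.conn
    rintro a b ⟨hab, ha, hb⟩
    have hax : a ≠ x := fun e => h.sep.hxA (e ▸ ha)
    have hbx : b ≠ x := fun e => h.sep.hxA (e ▸ hb)
    simp only [adj, delVert, induce, Finset.mem_filter, Finset.mem_insert, mem_part,
      Finset.mem_erase, Finset.erase_insert_eq_erase]
    rcases hab with hab | hab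
    · left; tauto
    · right; tauto
  · simp only
    rw [sd _ _ _ (fun hh => n2 (part_sub hh)) (fun hh => n4 (part_sub hh)),
      sd _ _ _ (fun hh => n1 (hbm _ hh)) (fun hh => n3 (hmb _ hh)),
      image_back part_sub part_sub hFm]
    ext ⟨a, b⟩
    rw [Finset.mem_insert, Finset.mem_insert, Finset.mem_union]
    constructor
    · intro hab
      rcases h.sep.cases hab with h3 | h3 | h3 | h3
      · exact Or.inr (Or.inr (Or.inl h3))
      · exact Or.inr (Or.inr (Or.inr h3))
      · left; obtain ⟨rfl, rfl⟩ := h.cAB a b hab h3.1 h3.2; rfl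
      · right; left; obtain ⟨rfl, rfl⟩ := h.cBA a b hab h3.1 h3.2; rfl
    · rintro (e | e | e | e)
      · rw [e]; exact h.htu
      · rw [e]; exact h.huw
      · exact part_sub e
      · exact part_sub e

lemma chain_rtg {R : ℕ → ℕ → Prop} : ∀ (l : List ℕ) (a b : ℕ), List.IsChain R (a :: l) →
    (a :: l).getLast? = some b → ReflTransGen R a b := by
  intro l
  induction l with
  | nil => intro a b _ h; have : a = b := by simpa using h
           exact this ▸ .refl
  | cons c l ih =>
    intro a b hc h
    rw [List.isChain_cons_cons] at hc
    exact .head hc.1 (ih c b hc.2 (by simpa using h))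

lemma good_of_extremal {k : ℕ} {D : Dgraph} (hWF : D.WF) (hext : Extremal k D) :
    Good k D.verts D.arcs := by
  obtain ⟨hbic, hstr, hchi, hlam⟩ := hext
  refine ⟨fun a b hab => hWF _ hab, ?_, fun y hy z hz hyz => exists_cut D hWF k hlam y z hy hz hyz,
    ?_, ?_⟩
  · rintro ⟨φ, hφ⟩
    have : D.dichi ≤ k := by
      apply Nat.sInf_le
      refine ⟨φ, ?_⟩
      rintro p ⟨hlen, hnd, hv, hch, hcl⟩ ⟨c, hc⟩
      match p, hlen with
      | a :: l, _ =>
        obtain ⟨z, hz⟩ : ∃ z, (a :: l).getLast? = some z :=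
          ⟨_, List.getLast?_eq_getLast_of_ne_nil (by simp)⟩
        have hzl : z ∈ a :: l := List.mem_of_getLast? hz
        have h1 := chain_rtg (R := MM D.arcs φ) l a z
          (by
            refine List.IsChain.imp_of_mem_imp ?_ hch
            intro p q hp hq hpq
            exact ⟨hpq, (hc p hp).trans (hc q hq).symm⟩) hz
        have h2 := hcl z a hz rfl
        exact hφ a (TransGen.tail' h1 ⟨h2, (hc z hzl).trans (hc a (by simp)).symm⟩)
    omega
  · intro y hy z hz
    by_cases hyz : y = z
    · exact hyz ▸ .refl
    · obtain ⟨p, hnd, hh, hl, hv, hch⟩ := hstr y hy z hz hyz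
      cases p with
      | nil => simp at hh
      | cons a l =>
        have : a = y := by simpa using hh
        subst this
        exact chain_rtg l a z hch hl
  · intro x hx y hy z hz hyx hzx
    have h1 : (D.delVert x).UConnected := by
      by_contra hn
      exact hbic.2 x ⟨hx, hn⟩
    have h2 := h1.2 y (by simp [delVert, induce, hy, hyx]) z (by simp [delVert, induce, hz, hzx])
    refine ReflTransGen.mono ?_ _ _ h2
    intro a b hab
    simp only [adj, delVert, induce, Finset.mem_filter, Finset.mem_erase] at hab
    tauto

end HJ

namespace HJ

open Relation Classical Dgraph

lemma rtg_restrict {R : ℕ → ℕ → Prop} {t v : ℕ} (h : ReflTransGen R t v) :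
    ReflTransGen (fun a b => R a b ∧ ReflTransGen R t a ∧ ReflTransGen R t b) t v := by
  induction h with
  | refl => exact .refl
  | @tail b c hb hbc ih => exact ih.tail ⟨hbc, hb, hb.tail hbc⟩

theorem main {k : ℕ} (hk : 3 ≤ k) {D : Dgraph}
    (g : Good k D.verts D.arcs) {t u w x : ℕ}
    (htu : (t, u) ∈ D.arcs) (huw : (u, w) ∈ D.arcs)
    (hx : (D.delArcs {(t, u), (u, w)}).IsCutvertex x) :
    (∃ D1 D2, IsDirHajosJoin D D1 D2) ∨ (∃ D1 D2, IsHajosBijoin D D1 D2) := by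
  obtain ⟨hxV, hnc⟩ := hx
  replace hxV : x ∈ D.verts := hxV
  obtain ⟨htV, huV, htu'⟩ := g.wf _ _ htu
  obtain ⟨-, hwV, huw'⟩ := g.wf _ _ huw
  set R : ℕ → ℕ → Prop := fun a b => a ≠ x ∧ b ≠ x ∧
    (((a, b) ∈ D.arcs ∧ ¬ (a = t ∧ b = u) ∧ ¬ (a = u ∧ b = w)) ∨
     ((b, a) ∈ D.arcs ∧ ¬ (b = t ∧ a = u) ∧ ¬ (b = u ∧ a = w))) with hR
  have hsymm : ∀ a b, R a b → R b a := fun a b ⟨h1, h2, h3⟩ => ⟨h2, h1, h3.symm⟩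
  have hSymm : ∀ a b, ReflTransGen R a b → ReflTransGen R b a := by
    intro a b h
    induction h with
    | refl => exact .refl
    | tail _ hbc ih => exact .head (hsymm _ _ hbc) ih
  have hadj : ∀ a b, R a b → ((D.delArcs {(t, u), (u, w)}).delVert x).adj a b := by
    intro a b ⟨ha, hb, h⟩
    simp only [adj, delVert, induce, delArcs, Finset.mem_filter, Finset.mem_erase,
      Finset.mem_sdiff, Finset.mem_insert, Finset.mem_singleton, Prod.mk.injEq, not_or]
    rcases h with ⟨h, h'⟩ | ⟨h, h'⟩
    · have := g.wf _ _ h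
      left; tauto
    · have := g.wf _ _ h
      right; tauto
  obtain ⟨y, z, hy, hyx, hz, hzx, hyz⟩ : ∃ y z, y ∈ D.verts ∧ y ≠ x ∧ z ∈ D.verts ∧ z ≠ x ∧
      ¬ ReflTransGen R y z := by
    by_contra hcon
    push Not at hcon
    apply hnc
    have hmem : ∀ v, v ∈ ((D.delArcs {(t, u), (u, w)}).delVert x).verts ↔
        v ∈ D.verts ∧ v ≠ x := by
      intro v
      simp only [delVert, induce, delArcs, Finset.mem_inter, Finset.mem_erase]
      tauto
    constructor
    · by_cases e : u = x
      · exact ⟨t, (hmem t).2 ⟨htV, fun h => htu' (h.trans e.symm)⟩⟩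
      · exact ⟨u, (hmem u).2 ⟨huV, e⟩⟩
    · intro a ha b hb
      rw [hmem] at ha hb
      exact ReflTransGen.mono hadj _ _ (hcon a b ha.1 ha.2 hb.1 hb.2)
  have hux : u ≠ x := by
    intro e
    obtain ⟨a, b, ⟨hab, hbx⟩, ⟨hax, ha⟩, hb⟩ := exists_leave (g.bic x hxV y hy z hz hyx hzx)
      {v | v ≠ x ∧ ReflTransGen R y v} ⟨hyx, .refl⟩ (fun h => hyz h.2)
    apply hb
    refine ⟨hbx, ha.tail ⟨hax, hbx, ?_⟩⟩
    rw [← e] at hax hbx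
    tauto
  obtain ⟨p, hp, hpx, hup⟩ : ∃ p, p ∈ D.verts ∧ p ≠ x ∧ ¬ ReflTransGen R u p := by
    by_contra hcon
    push Not at hcon
    exact hyz ((hSymm _ _ (hcon y hy hyx)).trans (hcon z hz hzx))
  have hleave : (t ≠ x ∧ ¬ ReflTransGen R u t) ∨ (w ≠ x ∧ ¬ ReflTransGen R u w) := by
    obtain ⟨a, b, ⟨hab, hbx⟩, ⟨hax, ha⟩, hb⟩ := exists_leave (g.bic x hxV u huV p hp hux hpx)
      {v | v ≠ x ∧ ReflTransGen R u v} ⟨hux, .refl⟩ (fun h => hup h.2)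
    have hb' : ¬ ReflTransGen R u b := fun h => hb ⟨hbx, h⟩
    have hnR : ¬ R a b := fun h => hb' (ha.tail h)
    have hor : (b = t ∨ b = w) ∨ b = u := by
      by_contra hcon
      apply hnR
      refine ⟨hax, hbx, ?_⟩
      tauto
    rcases hor with (rfl | rfl) | rfl
    · exact Or.inl ⟨hbx, hb'⟩
    · exact Or.inr ⟨hbx, hb'⟩
    · exact absurd .refl hb'
  -- the class of a vertex gives a separation
  have hsep : ∀ s, Sep k D.verts D.arcs x
      (D.verts.filter fun v => v ≠ x ∧ ReflTransGen R s v)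
      (D.verts.filter fun v => v ≠ x ∧ ¬ ReflTransGen R s v) := by
    intro s
    refine ⟨g, ?_, by simp, by simp, ?_⟩
    · ext v
      simp only [Finset.mem_insert, Finset.mem_union, Finset.mem_filter]
      by_cases e : v = x
      · simp [e, hxV]
      · tauto
    · intro v hv hv'
      exact (Finset.mem_filter.1 hv').2.2 (Finset.mem_filter.1 hv).2.2
  -- crossing arcs
  have hcr : ∀ s a b, (a, b) ∈ D.arcs → a ≠ x → b ≠ x →
      ¬ (ReflTransGen R s a ↔ ReflTransGen R s b) → (a = t ∧ b = u) ∨ (a = u ∧ b = w) := by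
    intro s a b hab ha hb hne
    by_contra hcon
    rw [not_or] at hcon
    have hRab : R a b := ⟨ha, hb, Or.inl ⟨hab, hcon⟩⟩
    exact hne ⟨fun h => h.tail hRab, fun h => h.tail (hsymm _ _ hRab)⟩
  by_cases ht : t ≠ x ∧ ¬ ReflTransGen R u t
  · obtain ⟨htx, htn⟩ := ht
    have htn' : ¬ ReflTransGen R t u := fun h => htn (hSymm _ _ h)
    have cAB : ∀ a b, (a, b) ∈ D.arcs →
        a ∈ (D.verts.filter fun v => v ≠ x ∧ ReflTransGen R t v) →
        b ∈ (D.verts.filter fun v => v ≠ x ∧ ¬ ReflTransGen R t v) → a = t ∧ b = u := by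
      intro a b hab ha hb
      rw [Finset.mem_filter] at ha hb
      rcases hcr t a b hab ha.2.1 hb.2.1 (fun h => hb.2.2 (h.1 ha.2.2)) with h | ⟨rfl, rfl⟩
      · exact h
      · exact absurd ha.2.2 htn'
    have cBA : ∀ a b, (a, b) ∈ D.arcs →
        a ∈ (D.verts.filter fun v => v ≠ x ∧ ¬ ReflTransGen R t v) →
        b ∈ (D.verts.filter fun v => v ≠ x ∧ ReflTransGen R t v) → a = u ∧ b = w := by
      intro a b hab ha hb
      rw [Finset.mem_filter] at ha hb
      rcases hcr t a b hab ha.2.1 hb.2.1 (fun h => ha.2.2 (h.2 hb.2.2)) with ⟨rfl, rfl⟩ | h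
      · exact absurd .refl ha.2.2
      · exact h
    by_cases hw : w ≠ x ∧ ReflTransGen R t w
    · right
      refine join_two hk (t := t) (u := u) (w := w) ⟨hsep t, ?_, ?_, ?_, htu, huw, cAB, cBA, ?_⟩
      · simp [htV, htx, ReflTransGen.refl]
      · simp [hwV, hw]
      · simp [huV, hux, htn']
      · refine ReflTransGen.mono ?_ _ _ (rtg_restrict hw.2)
        rintro a b ⟨⟨ha, hb, hab⟩, h1, h2⟩
        have hor : (a, b) ∈ D.arcs ∨ (b, a) ∈ D.arcs := by tauto
        have hV : a ∈ D.verts ∧ b ∈ D.verts := by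
          rcases hor with h | h
          · exact ⟨(g.wf _ _ h).1, (g.wf _ _ h).2.1⟩
          · exact ⟨(g.wf _ _ h).2.1, (g.wf _ _ h).1⟩
        exact ⟨hor, Finset.mem_filter.2 ⟨hV.1, ha, h1⟩, Finset.mem_filter.2 ⟨hV.2, hb, h2⟩⟩
    · left
      refine join_one (by omega) (hsep t) t u ?_ ?_ htu cAB ?_
      · simp [htV, htx, ReflTransGen.refl]
      · simp [huV, hux, htn']
      · intro a b hab ha hb
        obtain ⟨rfl, rfl⟩ := cBA a b hab ha hb
        exact hw (Finset.mem_filter.1 hb).2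
  · obtain ⟨hwx, hwn⟩ := hleave.resolve_left ht
    have hwn' : ¬ ReflTransGen R w u := fun h => hwn (hSymm _ _ h)
    left
    refine join_one (by omega) (hsep w).symm u w ?_ ?_ huw ?_ ?_
    · simp [huV, hux, hwn']
    · simp [hwV, hwx, ReflTransGen.refl]
    · intro a b hab ha hb
      rw [Finset.mem_filter] at ha hb
      rcases hcr w a b hab ha.2.1 hb.2.1 (fun h => ha.2.2 (h.2 hb.2.2)) with ⟨rfl, rfl⟩ | h
      · exact absurd hb.2.2 hwn'
      · exact h
    · intro a b hab ha hb
      rw [Finset.mem_filter] at ha hb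
      rcases hcr w a b hab ha.2.1 hb.2.1 (fun h => hb.2.2 (h.1 ha.2.2)) with ⟨rfl, rfl⟩ | ⟨rfl, rfl⟩
      · exact ht ⟨ha.2.1, fun h => hwn (h.trans (hSymm _ _ ha.2.2))⟩
      · exact hwn' ha.2.2

end HJ

open Dgraph

open Dgraph

/-- Lemma 5.7: if D is k-extremal (k ≥ 3) and D − {tu, uw}
has a cutvertex for some arcs tu, uw ∈ A(D), then D is a directed Hajós join
or a Hajós bijoin of two digraphs. -/
theorem statement_13 (k : ℕ) (hk : 3 ≤ k) (D : Dgraph) (hWF : D.WF)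
    (hext : Extremal k D) (t u w : ℕ)
    (htu : (t, u) ∈ D.arcs) (huw : (u, w) ∈ D.arcs)
    (hcut : ∃ v, (D.delArcs {(t, u), (u, w)}).IsCutvertex v) :
    (∃ D1 D2, IsDirHajosJoin D D1 D2) ∨ (∃ D1 D2, IsHajosBijoin D D1 D2) := by
  obtain ⟨x, hx⟩ := hcut
  exact HJ.main hk (HJ.good_of_extremal hWF hext) htu huw hx
end
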